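/- Let X ⊂ ℝ be the attractor of a strongly separated self-conformal IFS, let s = dim_H X, let μ be the normalized s-Hausdorff measure on X, and let r = (c n^{−1/s})_{n≥1} with c > 0. (1) If c < (sup_α f(α)/(sα))^{1/s}, then ℙ_μ({ω : X ⊆ E_r(ω)}) = 0. (2) If c > (sup_α f(α)/(sα))^{1/s}, then ℙ_μ({ω : X ⊆ E_r(ω)}) = 1. -/

import Mathlib

open MeasureTheory Metric Filter Set
open scoped ENNReal Topology NNReal

noncomputable section

/-- The random covering set `E_r(ω) = limsup_n B(ω_n, r_n)`. -/
def coverSet (r : ℕ → ℝ) (ω : ℕ → ℝ) : Set ℝ :=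
  ⋂ k, ⋃ n, ⋃ (_ : k ≤ n), ball (ω n) (r n)

/-- The average `(1/(-log t)) ∫_t^1 μ(B(x,ρ)) ρ^{-s-1} dρ`. -/
def avgA (μ : Measure ℝ) (s x t : ℝ) : ℝ :=
  (1 / (-Real.log t)) * ∫ ρ in t..1, (μ (ball x ρ)).toReal * ρ ^ (-s - 1)

/-- The upper average density of `μ` at `x`. -/
def upperAvg (μ : Measure ℝ) (s x : ℝ) : ℝ := limsup (fun t => avgA μ s x t) (𝓝[>] 0)

/-- The lower average density of `μ` at `x`. -/
def lowerAvg (μ : Measure ℝ) (s x : ℝ) : ℝ := liminf (fun t => avgA μ s x t) (𝓝[>] 0)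

/-- The truncated Riesz energy `∫ max(t, |x - y|)^{-s} dμ(y)`. -/
def rieszEnergy (μ : Measure ℝ) (s x t : ℝ) : ℝ := ∫ y, (max t |x - y|) ^ (-s) ∂μ

lemma integrable_riesz_kernel (μ : Measure ℝ) [IsFiniteMeasure μ] {p t : ℝ} (hp : 0 ≤ p)
    (ht : 0 < t) (x : ℝ) : Integrable (fun y => (max t |x - y|) ^ (-p)) μ := by
  refine Integrable.of_bound (C := t ^ (-p)) ?_ (ae_of_all _ fun y => ?_)
  · refine Continuous.aestronglyMeasurable ?_
    refine Continuous.rpow_const (by fun_prop) fun y => Or.inl ?_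
    exact (lt_max_of_lt_left ht).ne'
  · have h1 : 0 < max t |x - y| := lt_max_of_lt_left ht
    rw [Real.norm_of_nonneg (Real.rpow_nonneg h1.le _)]
    exact Real.rpow_le_rpow_of_nonpos ht (le_max_left _ _) (by linarith)

lemma rieszEnergy_anti (μ : Measure ℝ) [IsFiniteMeasure μ] {s t t' : ℝ} (hs : 0 ≤ s)
    (ht' : 0 < t') (h : t' ≤ t) (x : ℝ) : rieszEnergy μ s x t ≤ rieszEnergy μ s x t' := by
  refine integral_mono (integrable_riesz_kernel μ hs (ht'.trans_le h) x)
    (integrable_riesz_kernel μ hs ht' x) fun y => ?_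
  exact Real.rpow_le_rpow_of_nonpos (lt_max_of_lt_left ht') (max_le_max_right _ h) (by linarith)

/-- Upper `s`-regularity at the points of `X`. -/
def UpperRegular (μ : Measure ℝ) (s : ℝ) (X : Set ℝ) (C : ℝ) : Prop :=
  0 ≤ C ∧ ∀ x ∈ X, ∀ ρ : ℝ, 0 < ρ → μ (closedBall x ρ) ≤ ENNReal.ofReal (C * ρ ^ s)

lemma UpperRegular.real_le {μ : Measure ℝ} {s C : ℝ} {X : Set ℝ} (h : UpperRegular μ s X C)
    {x ρ : ℝ} (hx : x ∈ X) (hρ : 0 < ρ) : μ.real (closedBall x ρ) ≤ C * ρ ^ s := by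
  refine ENNReal.toReal_le_of_le_ofReal ?_ (h.2 x hx ρ hρ)
  exact mul_nonneg h.1 (Real.rpow_nonneg hρ.le _)

lemma integral_le_tsum_of_shells {μ : Measure ℝ} {s C : ℝ} {X : Set ℝ}
    (h : UpperRegular μ s X C) {x : ℝ} (hx : x ∈ X) {φ : ℝ → ℝ} (hφ : Integrable φ μ)
    (hφ0 : ∀ y, 0 ≤ φ y) {b ρ : ℕ → ℝ} (hb : ∀ k, 0 ≤ b k) (hρ : ∀ k, 0 < ρ k)
    (hcov : ∀ᵐ y ∂μ, ∃ k, φ y ≤ b k ∧ |x - y| ≤ ρ k)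
    (hsum : Summable fun k => b k * (C * ρ k ^ s)) :
    ∫ y, φ y ∂μ ≤ ∑' k, b k * (C * ρ k ^ s) := by
  have hterm : ∀ k, 0 ≤ b k * (C * ρ k ^ s) := fun k =>
    mul_nonneg (hb k) (mul_nonneg h.1 (Real.rpow_nonneg (hρ k).le _))
  rw [integral_eq_lintegral_of_nonneg_ae (ae_of_all _ hφ0) hφ.aestronglyMeasurable]
  refine ENNReal.toReal_le_of_le_ofReal (tsum_nonneg hterm) ?_
  calc ∫⁻ y, ENNReal.ofReal (φ y) ∂μ
      ≤ ∫⁻ y, ∑' k, (closedBall x (ρ k)).indicator (fun _ => ENNReal.ofReal (b k)) y ∂μ := by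
        refine lintegral_mono_ae ?_
        filter_upwards [hcov] with y hy
        obtain ⟨k, hk, hk'⟩ := hy
        refine le_trans ?_ (ENNReal.le_tsum k)
        rw [indicator_of_mem]
        · exact ENNReal.ofReal_le_ofReal hk
        · rw [mem_closedBall, Real.dist_eq, abs_sub_comm]; exact hk'
    _ = ∑' k, ENNReal.ofReal (b k) * μ (closedBall x (ρ k)) := by
        rw [lintegral_tsum fun k => (measurable_const.indicator measurableSet_closedBall).aemeasurable]
        congr 1; ext k
        rw [lintegral_indicator_const measurableSet_closedBall]
    _ ≤ ∑' k, ENNReal.ofReal (b k * (C * ρ k ^ s)) := by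
        refine ENNReal.tsum_le_tsum fun k => ?_
        rw [ENNReal.ofReal_mul (hb k)]
        gcongr
        exact h.2 x hx _ (hρ k)
    _ = ENNReal.ofReal (∑' k, b k * (C * ρ k ^ s)) :=
        (ENNReal.ofReal_tsum_of_nonneg hterm hsum).symm

lemma exists_dyadic_shell {u : ℝ} (hu : 1 < u) : ∃ k : ℕ, (2:ℝ) ^ k ≤ u ∧ u ≤ 2 ^ (k + 1) := by
  obtain ⟨k, hk, hk'⟩ := exists_nat_pow_near hu.le (by norm_num : (1:ℝ) < 2)
  exact ⟨k, hk, hk'.le⟩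

/-- The tail of the kernel of exponent `s + 1` is controlled by upper regularity. -/
lemma mul_integral_kernel_succ_le {μ : Measure ℝ} [IsFiniteMeasure μ] {s C : ℝ} {X : Set ℝ}
    (hs : 0 < s)
    (h : UpperRegular μ s X C) {x t : ℝ} (hx : x ∈ X) (ht : 0 < t) :
    t * ∫ y, (max t |x - y|) ^ (-(s + 1)) ∂μ ≤ 2 * (C * 2 ^ s) := by
  have key : ∀ k : ℕ, ((2:ℝ) ^ k * t) ^ (-(s + 1)) * (C * (2 ^ (k + 1) * t) ^ s)
      = (C * 2 ^ s * t⁻¹) * (1 / 2) ^ k := by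
    intro k
    have h2 : (0:ℝ) < 2 ^ k * t := by positivity
    rw [pow_succ, mul_right_comm, Real.mul_rpow h2.le (by norm_num), Real.rpow_neg h2.le,
      Real.rpow_add h2, Real.rpow_one]
    have h3 : (0:ℝ) < (2 ^ k * t) ^ s := Real.rpow_pos_of_pos h2 _
    rw [one_div, inv_pow]
    field_simp
  have hsum : Summable fun k : ℕ => ((2:ℝ) ^ k * t) ^ (-(s + 1)) * (C * (2 ^ (k + 1) * t) ^ s) := by
    simp_rw [key]
    exact (summable_geometric_two).mul_left _
  have hI := integral_le_tsum_of_shells h hx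
    (integrable_riesz_kernel μ (by linarith : 0 ≤ s + 1) ht x) (fun y => by positivity)
    (b := fun k => ((2:ℝ) ^ k * t) ^ (-(s + 1))) (ρ := fun k => 2 ^ (k + 1) * t)
    (fun k => by positivity) (fun k => by positivity) (ae_of_all _ fun y => ?_) hsum
  · simp_rw [key] at hI
    rw [tsum_mul_left, tsum_geometric_two] at hI
    calc _ ≤ t * (C * 2 ^ s * t⁻¹ * 2) := by gcongr
      _ = _ := by field_simp
  · rcases le_or_gt |x - y| t with hle | hgt
    · refine ⟨0, ?_, ?_⟩
      · simp [max_eq_left hle]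
      · simp; linarith
    · obtain ⟨k, hk, hk'⟩ := exists_dyadic_shell ((one_lt_div ht).2 hgt)
      refine ⟨k, ?_, ?_⟩
      · rw [le_div_iff₀ ht] at hk
        exact Real.rpow_le_rpow_of_nonpos (by positivity) (hk.trans (le_max_right _ _)) (by linarith)
      · rwa [div_le_iff₀ ht] at hk'

/-- A Hölder weight makes the kernel integrable, uniformly in the truncation. -/
lemma exists_integral_weighted_kernel_le {μ : Measure ℝ} [IsFiniteMeasure μ] {s C ε R : ℝ}
    {X : Set ℝ} (hε : 0 < ε) (hs : 0 < s) (hR : 0 < R)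
    (h : UpperRegular μ s X C) (hX : ∀ x ∈ X, ∀ᵐ y ∂μ, |x - y| ≤ R) :
    ∃ B : ℝ, 0 ≤ B ∧ ∀ x ∈ X, ∀ t : ℝ, 0 < t →
      Integrable (fun y => |x - y| ^ ε * (max t |x - y|) ^ (-s)) μ ∧
      ∫ y, |x - y| ^ ε * (max t |x - y|) ^ (-s) ∂μ ≤ B := by
  have key : ∀ k : ℕ, (((1/2:ℝ) ^ k * R) ^ ε * ((1/2:ℝ) ^ (k+1) * R) ^ (-s)) *
      (C * ((1/2) ^ k * R) ^ s) = (C * R ^ ε * 2 ^ s) * ((1 / 2) ^ ε) ^ k := by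
    intro k
    have h2 : (0:ℝ) < (1/2) ^ k * R := by positivity
    have h3 : (0:ℝ) < ((1/2) ^ k * R) ^ s := Real.rpow_pos_of_pos h2 _
    have e1 : ((1/2:ℝ) ^ (k+1) * R) = ((1/2) ^ k * R) * 2⁻¹ := by ring
    rw [e1, Real.mul_rpow h2.le (by norm_num), Real.rpow_neg h2.le, Real.inv_rpow (by norm_num),
      Real.rpow_neg (by norm_num), inv_inv, Real.mul_rpow (by positivity) hR.le,
      ← Real.rpow_natCast, ← Real.rpow_natCast, ← Real.rpow_mul (by norm_num),
      ← Real.rpow_mul (by norm_num), mul_comm (k:ℝ) ε]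
    rw [← Real.rpow_natCast] at h3
    field_simp
  have hlt : ((1:ℝ) / 2) ^ ε < 1 := Real.rpow_lt_one (by norm_num) (by norm_num) hε
  have hsum : Summable fun k : ℕ => (((1/2:ℝ) ^ k * R) ^ ε * ((1/2:ℝ) ^ (k+1) * R) ^ (-s)) *
      (C * ((1/2) ^ k * R) ^ s) := by
    simp_rw [key]
    exact (summable_geometric_of_lt_one (by positivity) hlt).mul_left _
  have hC := h.1
  refine ⟨∑' k : ℕ, (((1/2:ℝ) ^ k * R) ^ ε * ((1/2:ℝ) ^ (k+1) * R) ^ (-s)) *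
      (C * ((1/2) ^ k * R) ^ s), tsum_nonneg fun k => by positivity, fun x hx t ht => ?_⟩
  have hinteg : Integrable (fun y => |x - y| ^ ε * (max t |x - y|) ^ (-s)) μ := by
    refine Integrable.of_bound (C := R ^ ε * t ^ (-s)) ?_ ?_
    · refine Continuous.aestronglyMeasurable ?_
      refine Continuous.mul ?_ ?_
      · exact Continuous.rpow_const (by fun_prop) fun y => Or.inr hε.le
      · refine Continuous.rpow_const (by fun_prop) fun y => Or.inl ?_
        exact (lt_max_of_lt_left ht).ne'
    · filter_upwards [hX x hx] with y hy
      rw [Real.norm_of_nonneg (by positivity)]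
      exact mul_le_mul (Real.rpow_le_rpow (abs_nonneg _) hy hε.le)
        (Real.rpow_le_rpow_of_nonpos ht (le_max_left _ _) (by linarith)) (by positivity)
        (by positivity)
  refine ⟨hinteg, integral_le_tsum_of_shells h hx hinteg (fun y => by positivity)
    (fun k => by positivity) (fun k => by positivity) ?_ hsum⟩
  filter_upwards [hX x hx] with y hy
  rcases eq_or_lt_of_le (abs_nonneg (x - y)) with h0 | h0
  · refine ⟨0, ?_, ?_⟩
    · rw [← h0, Real.zero_rpow hε.ne', zero_mul]; positivity
    · simpa using hy
  · obtain ⟨k, hk, hk'⟩ := exists_nat_pow_near_of_lt_one (x := |x - y| / R) (y := 1/2)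
      (by positivity) ((div_le_one hR).2 hy) (by norm_num) (by norm_num)
    rw [lt_div_iff₀ hR] at hk
    rw [div_le_iff₀ hR] at hk'
    refine ⟨k, ?_, hk'⟩
    exact mul_le_mul (Real.rpow_le_rpow (abs_nonneg _) hk' hε.le)
      (Real.rpow_le_rpow_of_nonpos (by positivity) (hk.le.trans (le_max_right _ _)) (by linarith))
      (by positivity) (by positivity)

lemma rpow_neg_sub_le {s u v : ℝ} (hs : 0 < s) (hu : 0 < u) (huv : u ≤ v) :
    u ^ (-s) - v ^ (-s) ≤ s * u ^ (-(s + 1)) * (v - u) := by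
  have hv : 0 < v := hu.trans_le huv
  have h1 : Real.log (v / u) ≤ v / u - 1 := Real.log_le_sub_one_of_pos (by positivity)
  have h2 : 1 - s * (v / u - 1) ≤ (v / u) ^ (-s) := by
    rw [Real.rpow_def_of_pos (by positivity)]
    have := Real.add_one_le_exp (Real.log (v / u) * -s)
    nlinarith
  have h3 : v ^ (-s) = u ^ (-s) * (v / u) ^ (-s) := by
    rw [← Real.mul_rpow hu.le (by positivity)]; field_simp
  have h4 : u ^ (-(s + 1)) = u ^ (-s) * u⁻¹ := by
    rw [neg_add, Real.rpow_add hu, Real.rpow_neg_one]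
  have h5 : 0 < u ^ (-s) := Real.rpow_pos_of_pos hu _
  rw [h3, h4]
  have h6 : s * (u ^ (-s) * u⁻¹) * (v - u) = u ^ (-s) * (s * (v / u - 1)) := by
    field_simp
  rw [h6]
  nlinarith

/-- Moving the base point by at most `M t` changes the energy at scale `t` by a bounded amount. -/
lemma rieszEnergy_sub_le {μ : Measure ℝ} [IsFiniteMeasure μ] {s C : ℝ} {X : Set ℝ}
    (hs : 0 < s) (h : UpperRegular μ s X C) {x x' t M : ℝ} (hx : x ∈ X) (ht : 0 < t)
    (hM : 0 ≤ M) (hxx : |x - x'| ≤ M * t) :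
    rieszEnergy μ s x t - rieszEnergy μ s x' t ≤ s * M * (2 * (C * 2 ^ s)) := by
  have hk := mul_integral_kernel_succ_le hs h hx ht
  have hi := integrable_riesz_kernel μ (by linarith : 0 ≤ s + 1) ht x
  rw [rieszEnergy, rieszEnergy, ← integral_sub (integrable_riesz_kernel μ hs.le ht x)
    (integrable_riesz_kernel μ hs.le ht x')]
  calc _ ≤ ∫ y, (s * M * t) * (max t |x - y|) ^ (-(s + 1)) ∂μ := by
        refine integral_mono ((integrable_riesz_kernel μ hs.le ht x).sub
          (integrable_riesz_kernel μ hs.le ht x')) (hi.const_mul _) fun y => ?_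
        have hu : 0 < max t |x - y| := lt_max_of_lt_left ht
        have hu' : 0 < max t |x' - y| := lt_max_of_lt_left ht
        have hpos : 0 < (max t |x - y|) ^ (-(s + 1)) := Real.rpow_pos_of_pos hu _
        rcases le_total (max t |x - y|) (max t |x' - y|) with hle | hle
        · refine (rpow_neg_sub_le hs hu hle).trans ?_
          have hd : max t |x' - y| - max t |x - y| ≤ M * t := by
            have := abs_max_sub_max_le_abs |x' - y| |x - y| t
            rw [max_comm _ t, max_comm _ t] at this
            have h2 := abs_abs_sub_abs_le (x' - y) (x - y)
            have h3 : x' - y - (x - y) = -(x - x') := by ring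
            rw [h3, abs_neg] at h2
            exact (le_abs_self _).trans (this.trans (h2.trans hxx))
          calc s * (max t |x - y|) ^ (-(s + 1)) * (max t |x' - y| - max t |x - y|)
              ≤ s * (max t |x - y|) ^ (-(s + 1)) * (M * t) := by gcongr
            _ = _ := by ring
        · have : (max t |x - y|) ^ (-s) ≤ (max t |x' - y|) ^ (-s) :=
            Real.rpow_le_rpow_of_nonpos hu' hle (by linarith)
          have h0 : 0 ≤ s * M * t * (max t |x - y|) ^ (-(s + 1)) := by positivity
          linarith
    _ = s * M * (t * ∫ y, (max t |x - y|) ^ (-(s + 1)) ∂μ) := by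
        rw [integral_const_mul]; ring
    _ ≤ _ := by gcongr

lemma rieszEnergy_sub_integral_add_le {μ : Measure ℝ} [IsFiniteMeasure μ] {s C : ℝ} {X : Set ℝ}
    (hs : 0 < s) (h : UpperRegular μ s X C) {x t : ℝ} (hx : x ∈ X) (ht : 0 < t) :
    Integrable (fun y => (|x - y| + t) ^ (-s)) μ ∧
    rieszEnergy μ s x t - ∫ y, (|x - y| + t) ^ (-s) ∂μ ≤ s * (2 * (C * 2 ^ s)) := by
  have hk := mul_integral_kernel_succ_le hs h hx ht
  have hi := integrable_riesz_kernel μ (by linarith : 0 ≤ s + 1) ht x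
  have hinteg : Integrable (fun y => (|x - y| + t) ^ (-s)) μ := by
    refine Integrable.of_bound (C := t ^ (-s)) ?_ (ae_of_all _ fun y => ?_)
    · refine Continuous.aestronglyMeasurable ?_
      refine Continuous.rpow_const (by fun_prop) fun y => Or.inl ?_
      positivity
    · rw [Real.norm_of_nonneg (by positivity)]
      exact Real.rpow_le_rpow_of_nonpos ht (le_add_of_nonneg_left (abs_nonneg _)) (by linarith)
  refine ⟨hinteg, ?_⟩
  rw [rieszEnergy, ← integral_sub (integrable_riesz_kernel μ hs.le ht x) hinteg]
  calc _ ≤ ∫ y, (s * t) * (max t |x - y|) ^ (-(s + 1)) ∂μ := by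
        refine integral_mono ((integrable_riesz_kernel μ hs.le ht x).sub hinteg)
          (hi.const_mul _) fun y => ?_
        have hu : 0 < max t |x - y| := lt_max_of_lt_left ht
        have h0 := abs_nonneg (x - y)
        have hle : max t |x - y| ≤ |x - y| + t := max_le (by linarith) (by linarith)
        refine (rpow_neg_sub_le hs hu hle).trans ?_
        have hd : |x - y| + t - max t |x - y| ≤ t := by
          have := le_max_right t |x - y|
          linarith
        calc s * (max t |x - y|) ^ (-(s + 1)) * (|x - y| + t - max t |x - y|)
            ≤ s * (max t |x - y|) ^ (-(s + 1)) * t := by gcongr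
          _ = _ := by ring
    _ = s * (t * ∫ y, (max t |x - y|) ^ (-(s + 1)) ∂μ) := by
        rw [integral_const_mul]; ring
    _ ≤ _ := by gcongr

/-- Change of the truncation scale, from above. -/
lemma rieszEnergy_scale_le (μ : Measure ℝ) [IsFiniteMeasure μ] {s x t t' : ℝ}
    (hs : 0 < s) (ht' : 0 < t') (htt : t' ≤ t) :
    rieszEnergy μ s x t' - rieszEnergy μ s x t ≤ t' ^ (-s) * μ.real (closedBall x t) := by
  have ht : 0 < t := ht'.trans_le htt
  rw [rieszEnergy, rieszEnergy, ← integral_sub (integrable_riesz_kernel μ hs.le ht' x)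
    (integrable_riesz_kernel μ hs.le ht x)]
  have hb : MeasurableSet (closedBall x t) := measurableSet_closedBall
  calc _ ≤ ∫ y, (closedBall x t).indicator (fun _ => t' ^ (-s)) y ∂μ := by
        refine integral_mono ((integrable_riesz_kernel μ hs.le ht' x).sub
          (integrable_riesz_kernel μ hs.le ht x)) ((integrable_const _).indicator hb) fun y => ?_
        beta_reduce
        by_cases hy : y ∈ closedBall x t
        · rw [indicator_of_mem hy]
          have h1 : (max t' |x - y|) ^ (-s) ≤ t' ^ (-s) :=
            Real.rpow_le_rpow_of_nonpos ht' (le_max_left _ _) (by linarith)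
          have h2 : 0 ≤ (max t |x - y|) ^ (-s) := by positivity
          linarith
        · rw [indicator_of_notMem hy]
          rw [mem_closedBall, Real.dist_eq, abs_sub_comm, not_le] at hy
          rw [max_eq_right hy.le, max_eq_right (htt.trans hy.le), sub_self]
    _ = _ := by rw [integral_indicator_const _ hb, smul_eq_mul, mul_comm]

/-- Change of the truncation scale, from below. -/
lemma le_rieszEnergy_scale (μ : Measure ℝ) [IsFiniteMeasure μ] {s x t t' : ℝ}
    (hs : 0 < s) (ht' : 0 < t') (htt : t' ≤ t) :
    (t' ^ (-s) - t ^ (-s)) * μ.real (closedBall x t') ≤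
      rieszEnergy μ s x t' - rieszEnergy μ s x t := by
  have ht : 0 < t := ht'.trans_le htt
  rw [rieszEnergy, rieszEnergy, ← integral_sub (integrable_riesz_kernel μ hs.le ht' x)
    (integrable_riesz_kernel μ hs.le ht x)]
  have hb : MeasurableSet (closedBall x t') := measurableSet_closedBall
  calc _ = ∫ y, (closedBall x t').indicator (fun _ => t' ^ (-s) - t ^ (-s)) y ∂μ := by
        rw [integral_indicator_const _ hb, smul_eq_mul, mul_comm]
    _ ≤ _ := by
        refine integral_mono ((integrable_const _).indicator hb)
          ((integrable_riesz_kernel μ hs.le ht' x).sub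
          (integrable_riesz_kernel μ hs.le ht x)) fun y => ?_
        beta_reduce
        by_cases hy : y ∈ closedBall x t'
        · rw [indicator_of_mem hy]
          rw [mem_closedBall, Real.dist_eq, abs_sub_comm] at hy
          rw [max_eq_left hy, max_eq_left (hy.trans htt)]
        · rw [indicator_of_notMem hy, sub_nonneg]
          exact Real.rpow_le_rpow_of_nonpos (lt_max_of_lt_left ht') (max_le_max_right _ htt)
            (by linarith)

/-- The average of the statement in terms of the energy. -/
lemma integral_ball_eq_rieszEnergy (μ : Measure ℝ) [IsFiniteMeasure μ] {s x t : ℝ}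
    (hs : 0 < s) (ht : 0 < t) (ht1 : t ≤ 1) :
    ∫ ρ in t..1, (μ (ball x ρ)).toReal * ρ ^ (-s - 1) =
      (rieszEnergy μ s x t - rieszEnergy μ s x 1) / s := by
  have hmeas : MeasurableSet {p : ℝ × ℝ | |x - p.2| < p.1} :=
    measurableSet_lt (by fun_prop) (by fun_prop)
  have hF : Integrable (Function.uncurry fun ρ y : ℝ =>
      ({p : ℝ × ℝ | |x - p.2| < p.1}.indicator (fun p => p.1 ^ (-s - 1))) (ρ, y))
      ((volume.restrict (Ioc t 1)).prod μ) := by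
    refine Integrable.of_bound (C := t ^ (-s - 1)) ?_ ?_
    · refine Measurable.aestronglyMeasurable ?_
      exact (Measurable.indicator (by fun_prop) hmeas)
    · have : ∀ᵐ p ∂((volume.restrict (Ioc t 1)).prod μ), p.1 ∈ Ioc t 1 := by
        have h1 : ∀ᵐ ρ ∂(volume.restrict (Ioc t 1)), ρ ∈ Ioc t 1 :=
          ae_restrict_mem measurableSet_Ioc
        exact Measure.quasiMeasurePreserving_fst.ae h1
      filter_upwards [this] with p hp
      have hp0 : 0 < p.1 := ht.trans hp.1
      refine (norm_indicator_le_norm_self (fun p : ℝ × ℝ => p.1 ^ (-s - 1)) p).trans ?_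
      rw [Real.norm_of_nonneg (by positivity)]
      exact Real.rpow_le_rpow_of_nonpos ht hp.1.le (by linarith)
  have hswap := integral_integral_swap hF
  have hL : ∀ ρ : ℝ, ∫ y, ({p : ℝ × ℝ | |x - p.2| < p.1}.indicator (fun p => p.1 ^ (-s - 1))) (ρ, y) ∂μ
      = (μ (ball x ρ)).toReal * ρ ^ (-s - 1) := by
    intro ρ
    have : (fun y => ({p : ℝ × ℝ | |x - p.2| < p.1}.indicator (fun p => p.1 ^ (-s - 1))) (ρ, y))
        = (ball x ρ).indicator (fun _ => ρ ^ (-s - 1)) := by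
      ext y
      simp only [indicator, mem_ofPred_eq, mem_ball, Real.dist_eq, abs_sub_comm x y]
    rw [this, integral_indicator_const _ measurableSet_ball, smul_eq_mul]
    rfl
  have hR : ∀ y : ℝ, ∫ ρ in Ioc t 1,
      ({p : ℝ × ℝ | |x - p.2| < p.1}.indicator (fun p => p.1 ^ (-s - 1))) (ρ, y)
      = ((max t |x - y|) ^ (-s) - (max 1 |x - y|) ^ (-s)) / s := by
    intro y
    have h1 : (fun ρ : ℝ => ({p : ℝ × ℝ | |x - p.2| < p.1}.indicator (fun p => p.1 ^ (-s - 1))) (ρ, y))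
        = (Ioi |x - y|).indicator (fun ρ => ρ ^ (-s - 1)) := by
      ext ρ
      simp only [indicator, mem_ofPred_eq, mem_Ioi]
    rw [h1, setIntegral_indicator measurableSet_Ioi]
    have h2 : Ioc t 1 ∩ Ioi |x - y| = Ioc (max t |x - y|) 1 := by
      ext ρ; simp only [mem_inter_iff, mem_Ioc, mem_Ioi, max_lt_iff]; tauto
    rw [h2]
    rcases le_total |x - y| 1 with hle | hle
    · have hm : max t |x - y| ≤ 1 := max_le ht1 hle
      have hpos : 0 < max t |x - y| := lt_max_of_lt_left ht
      rw [← intervalIntegral.integral_of_le hm, integral_rpow, max_eq_left hle]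
      · have : -s - 1 + 1 = -s := by ring
        rw [this]
        field_simp
        ring
      · right
        refine ⟨by linarith, ?_⟩
        rw [uIcc_of_le hm]
        exact fun h => absurd h.1 (not_le.2 hpos)
    · rw [max_eq_right hle, max_eq_right (ht1.trans hle), sub_self, zero_div, Ioc_eq_empty,
        setIntegral_empty]
      exact not_lt.2 hle
  rw [intervalIntegral.integral_of_le ht1]
  calc _ = ∫ ρ in Ioc t 1, ∫ y, ({p : ℝ × ℝ | |x - p.2| < p.1}.indicator
        (fun p => p.1 ^ (-s - 1))) (ρ, y) ∂μ := by simp_rw [hL]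
    _ = ∫ y, ((max t |x - y|) ^ (-s) - (max 1 |x - y|) ^ (-s)) / s ∂μ := by
        rw [hswap]; simp_rw [hR]
    _ = _ := by
        rw [integral_div, integral_sub (integrable_riesz_kernel μ hs.le ht x)
          (integrable_riesz_kernel μ hs.le one_pos x), rieszEnergy, rieszEnergy]

lemma exists_deriv_mul_eq {G : ℝ → ℝ} (hG : Differentiable ℝ G) {J : Set ℝ} [hJ : J.OrdConnected]
    {x y : ℝ} (hx : x ∈ J) (hy : y ∈ J) :
    ∃ ξ ∈ J, |ξ - x| ≤ |x - y| ∧ |G x - G y| = |deriv G ξ| * |x - y| := by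
  rcases lt_trichotomy x y with h | h | h
  · obtain ⟨c, hc, hc'⟩ := exists_deriv_eq_slope G h hG.continuous.continuousOn
      hG.differentiableOn
    refine ⟨c, hJ.out hx hy (Ioo_subset_Icc_self hc), ?_, ?_⟩
    · rw [abs_of_pos (by linarith [hc.1]), abs_of_neg (by linarith)]; linarith [hc.2]
    · have : y - x ≠ 0 := by linarith
      rw [← abs_mul, hc']; congr 1
      rw [div_mul_eq_mul_div, eq_div_iff this]; ring
  · exact ⟨x, hx, by simp, by simp [h]⟩
  · obtain ⟨c, hc, hc'⟩ := exists_deriv_eq_slope G h hG.continuous.continuousOn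
      hG.differentiableOn
    refine ⟨c, hJ.out hy hx (Ioo_subset_Icc_self hc), ?_, ?_⟩
    · rw [abs_of_neg (by linarith [hc.2]), abs_of_pos (by linarith)]; linarith [hc.1]
    · rw [← abs_mul, hc']; congr 1
      have : x - y ≠ 0 := by linarith
      field_simp

lemma measure_le_of_cells {m n : Measure ℝ} {k : ℝ≥0∞} {δ : ℝ} (hδ : 0 < δ) {X : Set ℝ}
    (h : ∀ A, MeasurableSet A → A ⊆ X → (∀ x ∈ A, ∀ y ∈ A, |x - y| ≤ δ) → m A ≤ k * n A)
    {A : Set ℝ} (hA : MeasurableSet A) (hAX : A ⊆ X) : m A ≤ k * n A := by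
  set c : ℤ → Set ℝ := fun j => A ∩ (fun x => ⌊x / δ⌋) ⁻¹' {j} with hc
  have hcm : ∀ j, MeasurableSet (c j) := fun j =>
    hA.inter ((Int.measurable_floor.comp (measurable_id.div_const δ)) (measurableSet_singleton j))
  have hcd : Pairwise (Function.onFun Disjoint c) := by
    intro i j hij
    refine Set.disjoint_left.2 fun x hx hx' => hij ?_
    exact hx.2.symm.trans hx'.2
  have hcA : A = ⋃ j, c j := by
    ext x; simp [hc]
  have hsm : ∀ j, ∀ x ∈ c j, ∀ y ∈ c j, |x - y| ≤ δ := by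
    intro j x hx y hy
    have hx' : ⌊x / δ⌋ = j := hx.2
    have hy' : ⌊y / δ⌋ = j := hy.2
    have := (Int.abs_sub_lt_one_of_floor_eq_floor (hx'.trans hy'.symm)).le
    rwa [← sub_div, abs_div, abs_of_pos hδ, div_le_one hδ] at this
  calc m A = ∑' j, m (c j) := by conv_lhs => rw [hcA, measure_iUnion hcd hcm]
    _ ≤ ∑' j, k * n (c j) := ENNReal.tsum_le_tsum fun j =>
        h _ (hcm j) (inter_subset_left.trans hAX) (hsm j)
    _ = k * n A := by
        rw [ENNReal.tsum_mul_left]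
        conv_rhs => rw [hcA, measure_iUnion hcd hcm]

/-- The Hausdorff measure of an image under a `C¹` map with controlled distortion. -/
lemma hausdorffMeasure_image_eq {G : ℝ → ℝ} (hG : ContDiff ℝ 1 G) {J X : Set ℝ}
    [hJ : J.OrdConnected] (hXJ : X ⊆ J) (hne : ∀ x, deriv G x ≠ 0)
    {C ε s : ℝ} (hε : 0 < ε) (hs : 0 < s)
    (hdist : ∀ x ∈ J, ∀ y ∈ J, |deriv G x| ≤ Real.exp (C * |x - y| ^ ε) * |deriv G y|) (hC : 0 ≤ C)
    {A : Set ℝ} (hA : MeasurableSet A) (hAX : A ⊆ X) :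
    μH[s] (G '' A) = ∫⁻ y in A, ENNReal.ofReal (|deriv G y| ^ s) ∂μH[s] := by
  have hGd : Differentiable ℝ G := hG.differentiable one_ne_zero
  have hinj : Function.Injective G := by
    intro x y hxy
    obtain ⟨ξ, -, -, h⟩ := exists_deriv_mul_eq hGd (J := univ) (mem_univ x) (mem_univ y)
    rw [hxy, sub_self, abs_zero, eq_comm, mul_eq_zero] at h
    rcases h with h | h
    · exact absurd (abs_eq_zero.1 h) (hne ξ)
    · exact sub_eq_zero.1 (abs_eq_zero.1 h)
  have hemb : MeasurableEmbedding G := hG.continuous.measurableEmbedding hinj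
  set m : Measure ℝ := (μH[s] : Measure ℝ).comap G with hm
  set h : ℝ → ℝ≥0∞ := fun y => ENNReal.ofReal (|deriv G y| ^ s) with hh
  set n : Measure ℝ := (μH[s] : Measure ℝ).withDensity h with hn
  have hmA : ∀ B, m B = μH[s] (G '' B) := fun B => hemb.comap_apply _ _
  have hnA : ∀ B, MeasurableSet B → n B = ∫⁻ y in B, h y ∂μH[s] :=
    fun B hB => withDensity_apply _ hB
  have hpow : ∀ u v : ℝ, 0 ≤ v → ∀ y, |deriv G y| ≤ Real.exp u * v →
      |deriv G y| ^ s ≤ Real.exp (u * s) * v ^ s := by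
    intro u v hv y hy
    rw [Real.exp_mul u s, ← Real.mul_rpow (Real.exp_pos _).le hv]
    exact Real.rpow_le_rpow (abs_nonneg _) hy hs.le
  have cell : ∀ δ : ℝ, 0 < δ → ∀ B, MeasurableSet B → B ⊆ X → (∀ x ∈ B, ∀ y ∈ B, |x - y| ≤ δ) →
      m B ≤ ENNReal.ofReal (Real.exp (2 * (C * δ ^ ε) * s)) * n B ∧
      n B ≤ ENNReal.ofReal (Real.exp (2 * (C * δ ^ ε) * s)) * m B := by
    intro δ hδ B hB hBX hBδ
    rcases B.eq_empty_or_nonempty with rfl | ⟨z, hz⟩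
    · simp
    obtain ⟨η, hη⟩ : ∃ η, η = C * δ ^ ε := ⟨_, rfl⟩
    rw [← hη]
    have hdz : 0 < |deriv G z| := abs_pos.2 (hne z)
    have hd : ∀ x ∈ J, ∀ y ∈ J, |x - y| ≤ δ → |deriv G x| ≤ Real.exp η * |deriv G y| := by
      intro x hx y hy hxy
      refine (hdist x hx y hy).trans ?_
      rw [hη]
      gcongr
    have hBc : ∀ x ∈ B, ∀ y ∈ B, ∃ ξ ∈ J, |ξ - z| ≤ δ ∧ |G x - G y| = |deriv G ξ| * |x - y| := by
      intro x hx y hy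
      have : (J ∩ Icc (z - δ) (z + δ)).OrdConnected := hJ.inter ordConnected_Icc
      have hmem : ∀ x ∈ B, x ∈ J ∩ Icc (z - δ) (z + δ) := fun x hx =>
        ⟨hXJ (hBX hx), by have := abs_le.1 (hBδ x hx z hz); constructor <;> linarith [this.1, this.2]⟩
      obtain ⟨ξ, hξ, -, h⟩ := exists_deriv_mul_eq hGd (hmem x hx) (hmem y hy)
      exact ⟨ξ, hξ.1, abs_le.2 ⟨by linarith [hξ.2.1], by linarith [hξ.2.2]⟩, h⟩
    have hzJ : z ∈ J := hXJ (hBX hz)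
    have hexp : Real.exp (2 * η * s) = Real.exp (η * s) * Real.exp (η * s) := by
      rw [← Real.exp_add]; ring_nf
    have hmm : μH[s] (G '' B) ≤ ENNReal.ofReal (Real.exp (η * s) * |deriv G z| ^ s) * μH[s] B := by
      have hL : LipschitzOnWith (Real.toNNReal (Real.exp η * |deriv G z|)) G B := by
        refine LipschitzOnWith.of_dist_le_mul fun x hx y hy => ?_
        obtain ⟨ξ, hξJ, hξz, hξ⟩ := hBc x hx y hy
        rw [Real.dist_eq, Real.dist_eq, hξ, Real.coe_toNNReal _ (by positivity)]
        gcongr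
        exact hd ξ hξJ z hzJ hξz
      refine (hL.hausdorffMeasure_image_le hs.le).trans (le_of_eq ?_)
      congr 1
      rw [Real.exp_mul η s, ← Real.mul_rpow (Real.exp_pos _).le hdz.le,
        ← ENNReal.ofReal_rpow_of_nonneg (by positivity) hs.le]
      rfl
    have hmm' : ENNReal.ofReal (|deriv G z| ^ s) * μH[s] B ≤
        ENNReal.ofReal (Real.exp (η * s)) * μH[s] (G '' B) := by
      have hL : LipschitzOnWith (Real.toNNReal (Real.exp η * |deriv G z|⁻¹))
          (Function.invFun G) (G '' B) := by
        refine LipschitzOnWith.of_dist_le_mul ?_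
        rintro _ ⟨x, hx, rfl⟩ _ ⟨y, hy, rfl⟩
        rw [Function.leftInverse_invFun hinj x, Function.leftInverse_invFun hinj y]
        obtain ⟨ξ, hξJ, hξz, hξ⟩ := hBc x hx y hy
        rw [Real.dist_eq, Real.dist_eq, hξ, Real.coe_toNNReal _ (by positivity)]
        have h1 : 1 ≤ Real.exp η * |deriv G z|⁻¹ * |deriv G ξ| := by
          have := hd z hzJ ξ hξJ (by rw [abs_sub_comm]; exact hξz)
          rw [mul_right_comm, ← div_eq_mul_inv, one_le_div hdz]
          exact this
        calc |x - y| = 1 * |x - y| := (one_mul _).symm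
          _ ≤ (Real.exp η * |deriv G z|⁻¹ * |deriv G ξ|) * |x - y| := by gcongr
          _ = _ := by ring
      have h2 := hL.hausdorffMeasure_image_le hs.le
      rw [Function.LeftInverse.image_image (Function.leftInverse_invFun hinj)] at h2
      calc ENNReal.ofReal (|deriv G z| ^ s) * μH[s] B
          ≤ ENNReal.ofReal (|deriv G z| ^ s) *
            (ENNReal.ofReal (Real.exp (η * s) * (|deriv G z|⁻¹) ^ s) * μH[s] (G '' B)) := by
            gcongr
            refine h2.trans (le_of_eq ?_)
            congr 1
            rw [Real.exp_mul η s, ← Real.mul_rpow (Real.exp_pos _).le (by positivity),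
              ← ENNReal.ofReal_rpow_of_nonneg (by positivity) hs.le]
            rfl
        _ = _ := by
            rw [← mul_assoc, ← ENNReal.ofReal_mul (by positivity)]
            congr 2
            rw [Real.inv_rpow hdz.le]
            have := Real.rpow_pos_of_pos hdz s
            field_simp
    have hnn : ENNReal.ofReal (|deriv G z| ^ s) * μH[s] B ≤ ENNReal.ofReal (Real.exp (η * s)) * n B := by
      rw [hnA B hB, ← lintegral_const_mul' _ _ ENNReal.ofReal_ne_top, ← setLIntegral_const]
      refine setLIntegral_mono' hB fun y hy => ?_
      rw [← ENNReal.ofReal_mul (by positivity)]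
      refine ENNReal.ofReal_le_ofReal (hpow η _ (abs_nonneg _) z (hd z hzJ y (hXJ (hBX hy)) ?_))
      exact hBδ z hz y hy
    have hnn' : n B ≤ ENNReal.ofReal (Real.exp (η * s) * |deriv G z| ^ s) * μH[s] B := by
      rw [hnA B hB, ← setLIntegral_const]
      refine setLIntegral_mono' hB fun y hy => ?_
      refine ENNReal.ofReal_le_ofReal (hpow η _ (abs_nonneg _) y (hd y (hXJ (hBX hy)) z hzJ ?_))
      exact hBδ y hy z hz
    rw [ENNReal.ofReal_mul (by positivity)] at hmm hnn'
    rw [hmA, hexp, ENNReal.ofReal_mul (by positivity), mul_assoc, mul_assoc]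
    rw [mul_assoc] at hmm hnn'
    exact ⟨hmm.trans (by gcongr), hnn'.trans (by gcongr)⟩
  have lim : Tendsto (fun δ : ℝ => ENNReal.ofReal (Real.exp (2 * (C * δ ^ ε) * s))) (𝓝[>] 0) (𝓝 1) := by
    have : Tendsto (fun δ : ℝ => ENNReal.ofReal (Real.exp (2 * (C * δ ^ ε) * s))) (𝓝[>] 0)
        (𝓝 (ENNReal.ofReal (Real.exp (2 * (C * (0:ℝ) ^ ε) * s)))) := by
      refine ENNReal.tendsto_ofReal ?_
      refine (Real.continuous_exp.tendsto _).comp ?_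
      refine Tendsto.mul_const _ (Tendsto.const_mul _ (Tendsto.const_mul _ ?_))
      exact ((Real.continuousAt_rpow_const 0 ε (Or.inr hε.le)).tendsto).mono_left nhdsWithin_le_nhds
    simpa [Real.zero_rpow hε.ne'] using this
  have l1 : m A ≤ n A := by
    have := ENNReal.Tendsto.mul_const (b := n A) lim (Or.inl one_ne_zero)
    rw [one_mul] at this
    refine ge_of_tendsto this ?_
    filter_upwards [self_mem_nhdsWithin] with δ hδ
    exact measure_le_of_cells hδ (fun B h1 h2 h3 => (cell δ hδ B h1 h2 h3).1) hA hAX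
  have l2 : n A ≤ m A := by
    have := ENNReal.Tendsto.mul_const (b := m A) lim (Or.inl one_ne_zero)
    rw [one_mul] at this
    refine ge_of_tendsto this ?_
    filter_upwards [self_mem_nhdsWithin] with δ hδ
    exact measure_le_of_cells hδ (fun B h1 h2 h3 => (cell δ hδ B h1 h2 h3).2) hA hAX
  rw [← hmA, ← hnA A hA]
  exact le_antisymm l1 l2

/-- Transfer to a normalized restriction of the Hausdorff measure. -/
lemma setLIntegral_image_eq {G : ℝ → ℝ} (hG : ContDiff ℝ 1 G) {J X : Set ℝ}
    [hJ : J.OrdConnected] (hXJ : X ⊆ J) (hX : MeasurableSet X) (hne : ∀ x, deriv G x ≠ 0)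
    {C ε s : ℝ} (hε : 0 < ε) (hs : 0 < s)
    (hdist : ∀ x ∈ J, ∀ y ∈ J, |deriv G x| ≤ Real.exp (C * |x - y| ^ ε) * |deriv G y|) (hC : 0 ≤ C)
    (hGX : MapsTo G X X) {k : ℝ≥0∞} {μ : Measure ℝ} (hμ : μ = k • (μH[s]).restrict X)
    {F : ℝ → ℝ≥0∞} (hF : Measurable F) :
    ∫⁻ z in G '' X, F z ∂μ = ∫⁻ y, F (G y) * ENNReal.ofReal (|deriv G y| ^ s) ∂μ := by
  have hGd : Differentiable ℝ G := hG.differentiable one_ne_zero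
  have hinj : Function.Injective G := by
    intro x y hxy
    obtain ⟨ξ, -, -, h⟩ := exists_deriv_mul_eq hGd (J := univ) (mem_univ x) (mem_univ y)
    rw [hxy, sub_self, abs_zero, eq_comm, mul_eq_zero] at h
    rcases h with h | h
    · exact absurd (abs_eq_zero.1 h) (hne ξ)
    · exact sub_eq_zero.1 (abs_eq_zero.1 h)
  have hemb : MeasurableEmbedding G := hG.continuous.measurableEmbedding hinj
  have hh : Measurable fun y => ENNReal.ofReal (|deriv G y| ^ s) := by
    have := (hG.continuous_deriv le_rfl).measurable
    fun_prop
  have hGXm : MeasurableSet (G '' X) := hemb.measurableSet_image.2 hX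
  have hGXX : G '' X ∩ X = G '' X := inter_eq_left.2 hGX.image_subset
  have key : ((μH[s] : Measure ℝ).restrict (G '' X)) =
      (((μH[s] : Measure ℝ).restrict X).withDensity
        (fun y => ENNReal.ofReal (|deriv G y| ^ s))).map G := by
    ext B hB
    rw [Measure.map_apply hemb.measurable hB, withDensity_apply _ (hemb.measurable hB),
      Measure.restrict_restrict (hemb.measurable hB), Measure.restrict_apply hB,
      ← hausdorffMeasure_image_eq hG hXJ hne hε hs hdist hC ((hemb.measurable hB).inter hX)
        inter_subset_right]
    congr 1
    rw [image_preimage_inter]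
  rw [hμ, Measure.restrict_smul, lintegral_smul_measure, lintegral_smul_measure,
    Measure.restrict_restrict hGXm, hGXX, key, lintegral_map hF hemb.measurable,
    lintegral_withDensity_eq_lintegral_mul _ hh
      (show Measurable fun y => F (G y) from hF.comp hemb.measurable)]
  congr 1
  refine lintegral_congr fun y => ?_
  simp only [Pi.mul_apply, mul_comm]

/-- A strongly separated conformal iterated function system with attractor `X`, together with an
invariant interval `J ⊇ X` of length at most `R` and uniform contraction, distortion and separation
constants. -/
structure ConformalIFS {ι : Type*} (g : ι → ℝ → ℝ) (X J : Set ℝ) (R θ ε Cg δ : ℝ) : Prop where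
  contDiff : ∀ i, ContDiff ℝ 1 (g i)
  deriv_ne : ∀ i x, deriv (g i) x ≠ 0
  ordConnected : J.OrdConnected
  subset : X ⊆ J
  mapsTo : ∀ i, MapsTo (g i) J J
  bounded : ∀ x ∈ J, ∀ y ∈ J, |x - y| ≤ R
  R_pos : 0 < R
  θ_pos : 0 < θ
  θ_lt : θ < 1
  lip : ∀ i x y, |g i x - g i y| ≤ θ * |x - y|
  ε_pos : 0 < ε
  Cg_nonneg : 0 ≤ Cg
  dist : ∀ i, ∀ x ∈ J, ∀ y ∈ J, |deriv (g i) x| ≤ Real.exp (Cg * |x - y| ^ ε) * |deriv (g i) y|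
  isCompact : IsCompact X
  nonempty : X.Nonempty
  inv : X = ⋃ i, g i '' X
  δ_pos : 0 < δ
  sep : ∀ i j, i ≠ j → ∀ x ∈ X, ∀ y ∈ X, δ ≤ |g i x - g j y|

lemma exists_distortion {f : ℝ → ℝ} {J : Set ℝ} (hJ : IsCompact J) (hf : ContDiff ℝ 1 f)
    (hder : ∀ x, deriv f x ≠ 0) {e K : ℝ≥0} (hH : HolderWith K e (deriv f)) {R : ℝ}
    (hR : ∀ x ∈ J, ∀ y ∈ J, |x - y| ≤ R) {ε : ℝ} (hε : 0 < ε) (hεe : ε ≤ e) :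
    ∃ C : ℝ, 0 ≤ C ∧ ∀ x ∈ J, ∀ y ∈ J,
      |deriv f x| ≤ Real.exp (C * |x - y| ^ ε) * |deriv f y| := by
  rcases J.eq_empty_or_nonempty with rfl | hne
  · exact ⟨0, le_rfl, by simp⟩
  obtain ⟨z, hz, hmin⟩ := hJ.exists_isMinOn hne
    (f := fun x => |deriv f x|) (hf.continuous_deriv le_rfl).abs.continuousOn
  set m := |deriv f z| with hm
  have hm0 : 0 < m := abs_pos.2 (hder z)
  set T := max R 1 with hT
  have hT1 : 1 ≤ T := le_max_right _ _
  have hT0 : 0 < T := one_pos.trans_le hT1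
  refine ⟨K / m * T ^ (e : ℝ), by positivity, fun x hx y hy => ?_⟩
  have h1 : |deriv f x| ≤ |deriv f y| + K * |x - y| ^ (e : ℝ) := by
    have := hH.dist_le x y
    rw [Real.dist_eq, Real.dist_eq] at this
    have h2 := abs_sub_abs_le_abs_sub (deriv f x) (deriv f y)
    linarith
  have h3 : |x - y| ^ (e : ℝ) ≤ T ^ (e : ℝ) * |x - y| ^ ε := by
    have hq0 : 0 ≤ |x - y| / T := by positivity
    have hq1 : |x - y| / T ≤ 1 :=
      (div_le_one hT0).2 ((hR x hx y hy).trans (le_max_left _ _))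
    calc |x - y| ^ (e : ℝ) = (T * (|x - y| / T)) ^ (e : ℝ) := by
          congr 1; field_simp
      _ = T ^ (e : ℝ) * (|x - y| / T) ^ (e : ℝ) := Real.mul_rpow hT0.le hq0
      _ ≤ T ^ (e : ℝ) * |x - y| ^ ε := by
          gcongr ?_ * ?_
          calc (|x - y| / T) ^ (e : ℝ) ≤ (|x - y| / T) ^ ε := by
                exact Real.rpow_le_rpow_of_exponent_ge_of_imp hq0 hq1 hεe
                  (fun _ h => absurd h (hε.trans_le hεe).ne')
            _ ≤ |x - y| ^ ε := by
                refine Real.rpow_le_rpow hq0 ?_ hε.le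
                exact div_le_self (abs_nonneg _) hT1
  have hmy : m ≤ |deriv f y| := hmin hy
  have h4 : K * |x - y| ^ (e : ℝ) ≤ (K / m * T ^ (e : ℝ) * |x - y| ^ ε) * |deriv f y| := by
    calc K * |x - y| ^ (e : ℝ) ≤ K * (T ^ (e : ℝ) * |x - y| ^ ε) := by gcongr
      _ = (K / m * T ^ (e : ℝ) * |x - y| ^ ε) * m := by field_simp
      _ ≤ _ := by gcongr
  have h5 := Real.add_one_le_exp (K / m * T ^ (e : ℝ) * |x - y| ^ ε)
  calc |deriv f x| ≤ (K / m * T ^ (e : ℝ) * |x - y| ^ ε + 1) * |deriv f y| := by linarith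
    _ ≤ _ := by gcongr

lemma exists_conformalIFS {ι : Type*} [Fintype ι] [Nonempty ι] (g : ι → ℝ → ℝ)
    (hreg : ∀ i, ContDiff ℝ 1 (g i) ∧
      ∃ (ε K : ℝ≥0), 0 < ε ∧ HolderWith K ε (deriv (g i)))
    (hcontr : ∀ i, ∃ L : ℝ≥0, L < 1 ∧ LipschitzWith L (g i))
    (hder : ∀ i x, deriv (g i) x ≠ 0)
    (X : Set ℝ) (hXc : IsCompact X) (hXne : X.Nonempty)
    (hXinv : X = ⋃ i, g i '' X)
    (hsep : Pairwise fun i j => Disjoint (g i '' X) (g j '' X)) :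
    ∃ J R θ ε Cg δ, ConformalIFS g X J R θ ε Cg δ := by
  choose hC1 e K he hH using hreg
  choose L hL1 hL using hcontr
  obtain ⟨θ, hθ0, hθ1, hθ⟩ : ∃ θ : ℝ, 0 < θ ∧ θ < 1 ∧ ∀ i, (L i : ℝ) ≤ θ := by
    refine ⟨max (Finset.univ.sup L : ℝ≥0) (1 / 2), by positivity, max_lt ?_ (by norm_num), ?_⟩
    · have : Finset.univ.sup L < 1 := (Finset.sup_lt_iff (by simp)).2 fun i _ => hL1 i
      exact_mod_cast this
    · intro i
      refine le_trans ?_ (le_max_left _ _)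
      exact_mod_cast Finset.le_sup (f := L) (Finset.mem_univ i)
  have hlip : ∀ i x y, |g i x - g i y| ≤ θ * |x - y| := by
    intro i x y
    have := (hL i).dist_le_mul x y
    rw [Real.dist_eq, Real.dist_eq] at this
    exact this.trans (by gcongr; exact hθ i)
  obtain ⟨x0, hx0⟩ := hXne
  obtain ⟨M, hM⟩ : ∃ M, X ⊆ closedBall x0 M := hXc.isBounded.subset_closedBall x0
  have hM0 : 0 ≤ M := by
    have := hM hx0
    simpa using this
  set R := M / (1 - θ) + 1 with hR
  have h1θ : 0 < 1 - θ := by linarith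
  have hR0 : 0 < R := by positivity
  have hRθ : θ * R + M ≤ R := by
    have : (1 - θ) * (M / (1 - θ)) = M := by field_simp
    nlinarith
  have hgX : ∀ i, ∀ x ∈ X, g i x ∈ X := fun i x hx => by
    rw [hXinv]; exact mem_iUnion.2 ⟨i, mem_image_of_mem _ hx⟩
  have hmaps : ∀ i, MapsTo (g i) (closedBall x0 R) (closedBall x0 R) := by
    intro i x hx
    rw [mem_closedBall, Real.dist_eq] at hx ⊢
    have h1 := hM (hgX i x0 hx0)
    rw [mem_closedBall, Real.dist_eq] at h1
    have h2 := hlip i x x0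
    have h3 := abs_sub_le (g i x) (g i x0) x0
    have h4 : θ * |x - x0| ≤ θ * R := by gcongr
    linarith
  have hsub : X ⊆ closedBall x0 R := by
    refine hM.trans (closedBall_subset_closedBall ?_)
    have : M ≤ M / (1 - θ) := le_div_self hM0 h1θ (by linarith)
    linarith
  have hbd : ∀ x ∈ closedBall x0 R, ∀ y ∈ closedBall x0 R, |x - y| ≤ 2 * R := by
    intro x hx y hy
    rw [mem_closedBall, Real.dist_eq] at hx hy
    have := abs_sub_le x x0 y
    rw [abs_sub_comm x0 y] at this
    linarith
  set ε : ℝ := ((Finset.univ.inf' Finset.univ_nonempty e : ℝ≥0) : ℝ) with hε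
  have hε0 : 0 < ε := by
    have : 0 < Finset.univ.inf' Finset.univ_nonempty e :=
      (Finset.lt_inf'_iff _).2 fun i _ => he i
    exact_mod_cast this
  have hεe : ∀ i, ε ≤ e i := fun i => by
    exact_mod_cast Finset.inf'_le e (Finset.mem_univ i)
  choose Cf hCf0 hCf using fun i => exists_distortion (isCompact_closedBall x0 R) (hC1 i)
    (hder i) (hH i) hbd hε0 (hεe i)
  have hCle : ∀ i, Cf i ≤ ∑ i, Cf i :=
    fun i => Finset.single_le_sum (fun j _ => hCf0 j) (Finset.mem_univ i)
  have hδ : ∀ i j, ∃ δ : ℝ, 0 < δ ∧ (i ≠ j → ∀ x ∈ X, ∀ y ∈ X, δ ≤ |g i x - g j y|) := by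
    intro i j
    by_cases hij : i = j
    · exact ⟨1, one_pos, fun h => absurd hij h⟩
    have hc1 := hXc.image (hC1 i).continuous
    have hc2 := hXc.image (hC1 j).continuous
    obtain ⟨δ, hδ, h⟩ := (hsep hij).exists_thickenings hc1 hc2.isClosed
    refine ⟨δ, hδ, fun _ x hx y hy => ?_⟩
    by_contra! hlt
    refine Set.disjoint_left.1 h ?_ (self_subset_thickening hδ _ (mem_image_of_mem _ hy))
    rw [mem_thickening_iff]
    exact ⟨g i x, mem_image_of_mem _ hx, by rwa [dist_comm, Real.dist_eq]⟩
  choose δ hδ0 hδ using hδ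
  refine ⟨closedBall x0 R, 2 * R, θ, ε, ∑ i, Cf i,
    Finset.univ.inf' Finset.univ_nonempty fun p : ι × ι => δ p.1 p.2, ?_⟩
  exact
    { contDiff := hC1
      deriv_ne := hder
      ordConnected := (convex_closedBall x0 R).ordConnected
      subset := hsub
      mapsTo := hmaps
      bounded := hbd
      R_pos := by positivity
      θ_pos := hθ0
      θ_lt := hθ1
      lip := hlip
      ε_pos := hε0
      Cg_nonneg := Finset.sum_nonneg fun i _ => hCf0 i
      dist := fun i x hx y hy => (hCf i x hx y hy).trans (by gcongr; exact hCle i)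
      isCompact := hXc
      nonempty := ⟨x0, hx0⟩
      inv := hXinv
      δ_pos := (Finset.lt_inf'_iff _).2 fun p _ => hδ0 p.1 p.2
      sep := fun i j hij x hx y hy =>
        (Finset.inf'_le (fun p : ι × ι => δ p.1 p.2) (Finset.mem_univ (i, j))).trans
          (hδ i j hij x hx y hy) }

/-- The composition `g_{w_1} ∘ ⋯ ∘ g_{w_n}` along a finite word. -/
def cyl {ι : Type*} (g : ι → ℝ → ℝ) : List ι → ℝ → ℝ
  | [] => id
  | i :: w => g i ∘ cyl g w

lemma cyl_append {ι : Type*} (g : ι → ℝ → ℝ) (u v : List ι) :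
    cyl g (u ++ v) = cyl g u ∘ cyl g v := by
  induction u with
  | nil => rfl
  | cons i u ih => simp only [List.cons_append, cyl, ih]; rfl

namespace ConformalIFS

variable {ι : Type*} {g : ι → ℝ → ℝ} {X J : Set ℝ} {R θ ε Cg δ : ℝ}

lemma cyl_contDiff (h : ConformalIFS g X J R θ ε Cg δ) (w : List ι) : ContDiff ℝ 1 (cyl g w) := by
  induction w with
  | nil => exact contDiff_id
  | cons i w ih => exact (h.contDiff i).comp ih

lemma cyl_differentiable (h : ConformalIFS g X J R θ ε Cg δ) (w : List ι) :
    Differentiable ℝ (cyl g w) := (h.cyl_contDiff w).differentiable one_ne_zero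

lemma deriv_cyl_append (h : ConformalIFS g X J R θ ε Cg δ) (u v : List ι) (x : ℝ) :
    deriv (cyl g (u ++ v)) x = deriv (cyl g u) (cyl g v x) * deriv (cyl g v) x := by
  rw [cyl_append]
  exact deriv_comp x (h.cyl_differentiable u _) (h.cyl_differentiable v _)

lemma deriv_cyl_cons (h : ConformalIFS g X J R θ ε Cg δ) (i : ι) (w : List ι) (x : ℝ) :
    deriv (cyl g (i :: w)) x = deriv (g i) (cyl g w x) * deriv (cyl g w) x :=
  deriv_comp x ((h.contDiff i).differentiable one_ne_zero _) (h.cyl_differentiable w _)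

lemma deriv_cyl_ne (h : ConformalIFS g X J R θ ε Cg δ) (w : List ι) (x : ℝ) :
    deriv (cyl g w) x ≠ 0 := by
  induction w with
  | nil => simp [cyl]
  | cons i w ih => rw [h.deriv_cyl_cons]; exact mul_ne_zero (h.deriv_ne i _) ih

lemma mapsTo_attractor (h : ConformalIFS g X J R θ ε Cg δ) (i : ι) : MapsTo (g i) X X := by
  intro x hx
  rw [h.inv]; exact mem_iUnion.2 ⟨i, mem_image_of_mem _ hx⟩

lemma cyl_mapsTo (h : ConformalIFS g X J R θ ε Cg δ) (w : List ι) : MapsTo (cyl g w) X X := by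
  induction w with
  | nil => exact mapsTo_id X
  | cons i w ih => exact (h.mapsTo_attractor i).comp ih

lemma cyl_mapsTo_interval (h : ConformalIFS g X J R θ ε Cg δ) (w : List ι) :
    MapsTo (cyl g w) J J := by
  induction w with
  | nil => exact mapsTo_id J
  | cons i w ih => exact (h.mapsTo i).comp ih

lemma cyl_lip (h : ConformalIFS g X J R θ ε Cg δ) (w : List ι) (x y : ℝ) :
    |cyl g w x - cyl g w y| ≤ θ ^ w.length * |x - y| := by
  induction w with
  | nil => simp [cyl]
  | cons i w ih =>
    have hθ := h.θ_pos
    calc |cyl g (i :: w) x - cyl g (i :: w) y| ≤ θ * |cyl g w x - cyl g w y| := h.lip i _ _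
      _ ≤ θ * (θ ^ w.length * |x - y|) := by gcongr
      _ = _ := by rw [List.length_cons, pow_succ]; ring

/-- The distortion constant of the cylinder maps. -/
def distConst (θ ε Cg : ℝ) : ℝ := Cg / (1 - θ ^ ε)

lemma rpow_lt_one (h : ConformalIFS g X J R θ ε Cg δ) : θ ^ ε < 1 :=
  Real.rpow_lt_one h.θ_pos.le h.θ_lt h.ε_pos

lemma distConst_nonneg (h : ConformalIFS g X J R θ ε Cg δ) : 0 ≤ distConst θ ε Cg :=
  div_nonneg h.Cg_nonneg (by linarith [h.rpow_lt_one])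

lemma cyl_dist (h : ConformalIFS g X J R θ ε Cg δ) (w : List ι) {x y : ℝ} (hx : x ∈ J)
    (hy : y ∈ J) : |deriv (cyl g w) x| ≤
      Real.exp (distConst θ ε Cg * |x - y| ^ ε) * |deriv (cyl g w) y| := by
  have hr := h.rpow_lt_one
  have hr0 : 0 < θ ^ ε := Real.rpow_pos_of_pos h.θ_pos _
  have hθ := h.θ_pos
  have hCg := h.Cg_nonneg
  have key : |deriv (cyl g w) x| ≤
      Real.exp (distConst θ ε Cg * (1 - (θ ^ ε) ^ w.length) * |x - y| ^ ε)
        * |deriv (cyl g w) y| := by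
    induction w with
    | nil => simp [cyl]
    | cons i w ih =>
      rw [h.deriv_cyl_cons, h.deriv_cyl_cons, abs_mul, abs_mul]
      have h1 := h.dist i _ (h.cyl_mapsTo_interval w hx) _ (h.cyl_mapsTo_interval w hy)
      have h2 : |cyl g w x - cyl g w y| ^ ε ≤ (θ ^ ε) ^ w.length * |x - y| ^ ε := by
        calc |cyl g w x - cyl g w y| ^ ε ≤ (θ ^ w.length * |x - y|) ^ ε :=
              Real.rpow_le_rpow (abs_nonneg _) (h.cyl_lip w x y) h.ε_pos.le
          _ = (θ ^ ε) ^ w.length * |x - y| ^ ε := by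
              rw [Real.mul_rpow (by positivity) (abs_nonneg _), ← Real.rpow_natCast,
                ← Real.rpow_natCast, ← Real.rpow_mul hθ.le, ← Real.rpow_mul hθ.le, mul_comm ε]
      calc _ ≤ (Real.exp (Cg * ((θ ^ ε) ^ w.length * |x - y| ^ ε))
              * |deriv (g i) (cyl g w y)|) *
            (Real.exp (distConst θ ε Cg * (1 - (θ ^ ε) ^ w.length) * |x - y| ^ ε)
              * |deriv (cyl g w) y|) := by
            refine mul_le_mul (h1.trans ?_) ih (abs_nonneg _) (by positivity)
            gcongr
        _ = Real.exp (Cg * ((θ ^ ε) ^ w.length * |x - y| ^ ε) +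
            distConst θ ε Cg * (1 - (θ ^ ε) ^ w.length) * |x - y| ^ ε) *
            (|deriv (g i) (cyl g w y)| * |deriv (cyl g w) y|) := by
            rw [Real.exp_add]; ring
        _ = _ := by
            congr 2
            have : Cg = distConst θ ε Cg * (1 - θ ^ ε) := by
              rw [distConst]; field_simp [(sub_pos.2 hr).ne']
            nth_rewrite 1 [this]
            rw [List.length_cons, pow_succ]; ring
  refine key.trans ?_
  have hD := h.distConst_nonneg
  gcongr
  have : 0 ≤ (θ ^ ε) ^ w.length := by positivity
  nlinarith

/-- The uniform bound for ratios of derivatives of cylinder maps. -/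
def ratioConst (R θ ε Cg : ℝ) : ℝ := Real.exp (distConst θ ε Cg * R ^ ε)

lemma one_le_ratioConst (h : ConformalIFS g X J R θ ε Cg δ) : 1 ≤ ratioConst R θ ε Cg :=
  Real.one_le_exp (mul_nonneg h.distConst_nonneg (Real.rpow_nonneg h.R_pos.le _))

lemma cyl_ratio (h : ConformalIFS g X J R θ ε Cg δ) (w : List ι) {x y : ℝ} (hx : x ∈ J)
    (hy : y ∈ J) : |deriv (cyl g w) x| ≤ ratioConst R θ ε Cg * |deriv (cyl g w) y| := by
  refine (h.cyl_dist w hx hy).trans ?_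
  have := h.distConst_nonneg
  have hb := h.bounded x hx y hy
  have hε := h.ε_pos
  rw [ratioConst]
  gcongr

lemma cyl_le (h : ConformalIFS g X J R θ ε Cg δ) (w : List ι) {x y z : ℝ} (hx : x ∈ J)
    (hy : y ∈ J) (hz : z ∈ J) : |cyl g w x - cyl g w y| ≤
      ratioConst R θ ε Cg * |deriv (cyl g w) z| * |x - y| := by
  have := h.ordConnected
  obtain ⟨ξ, hξ, -, he⟩ := exists_deriv_mul_eq (h.cyl_differentiable w) hx hy
  rw [he]
  gcongr
  exact h.cyl_ratio w hξ hz

lemma le_cyl (h : ConformalIFS g X J R θ ε Cg δ) (w : List ι) {x y z : ℝ} (hx : x ∈ J)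
    (hy : y ∈ J) (hz : z ∈ J) : |deriv (cyl g w) z| * |x - y| ≤
      ratioConst R θ ε Cg * |cyl g w x - cyl g w y| := by
  have := h.ordConnected
  obtain ⟨ξ, hξ, -, he⟩ := exists_deriv_mul_eq (h.cyl_differentiable w) hx hy
  rw [he, ← mul_assoc]
  gcongr
  exact h.cyl_ratio w hz hξ

lemma abs_deriv_cyl_le (h : ConformalIFS g X J R θ ε Cg δ) (w : List ι) (x : ℝ) :
    |deriv (cyl g w) x| ≤ θ ^ w.length := by
  have hθ := h.θ_pos
  exact norm_deriv_le_of_lip' (𝕜 := ℝ) (f := cyl g w) (x₀ := x) (C := θ ^ w.length)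
    (by positivity) (Filter.Eventually.of_forall fun y => h.cyl_lip w y x)

lemma cyl_injective (h : ConformalIFS g X J R θ ε Cg δ) (w : List ι) :
    Function.Injective (cyl g w) := by
  intro x y hxy
  obtain ⟨ξ, -, -, he⟩ :=
    exists_deriv_mul_eq (h.cyl_differentiable w) (J := univ) (mem_univ x) (mem_univ y)
  rw [hxy, sub_self, abs_zero, eq_comm, mul_eq_zero, abs_eq_zero, abs_eq_zero] at he
  exact sub_eq_zero.1 (he.resolve_left (h.deriv_cyl_ne w ξ))

lemma exists_cyl_eq (h : ConformalIFS g X J R θ ε Cg δ) (n : ℕ) {x : ℝ} (hx : x ∈ X) :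
    ∃ w : List ι, w.length = n ∧ x ∈ cyl g w '' X := by
  induction n generalizing x with
  | zero => exact ⟨[], rfl, x, hx, rfl⟩
  | succ n ih =>
    rw [h.inv] at hx
    obtain ⟨i, y, hy, rfl⟩ := mem_iUnion.1 hx
    obtain ⟨w, hw, z, hz, rfl⟩ := ih hy
    exact ⟨i :: w, by simp [hw], z, hz, rfl⟩

/-- Points of `X` outside a cylinder are at distance comparable to its size. -/
lemma cyl_sep (h : ConformalIFS g X J R θ ε Cg δ) (w : List ι) {x y z : ℝ} (hx : x ∈ X)
    (hy : y ∈ X) (hyw : y ∉ cyl g w '' X) (hz : z ∈ X) :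
    δ * |deriv (cyl g w) z| ≤ ratioConst R θ ε Cg ^ 2 * |cyl g w x - y| := by
  set K := ratioConst R θ ε Cg with hK
  have hK1 : 1 ≤ K := h.one_le_ratioConst
  have hK0 : 0 < K := one_pos.trans_le hK1
  have hδ := h.δ_pos
  suffices H : ∀ (w u : List ι) (y : ℝ), y ∈ X → y ∉ cyl g w '' X →
      δ * |deriv (cyl g (u ++ w)) z| ≤ K ^ 2 * |cyl g (u ++ w) x - cyl g u y| by
    simpa [cyl] using H w [] y hy hyw
  intro w
  induction w with
  | nil => intro u y hy hyw; exact absurd ⟨y, hy, rfl⟩ hyw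
  | cons i w ih =>
    intro u y hy hyw
    have hyU := hy
    rw [h.inv] at hyU
    obtain ⟨j, y', hy', rfl⟩ := mem_iUnion.1 hyU
    by_cases hij : i = j
    · subst hij
      have := ih (u ++ [i]) y' hy' (fun ⟨t, ht, hte⟩ => hyw ⟨t, ht, by simp [cyl, hte]⟩)
      simpa [cyl_append, cyl] using this
    · have hsep := h.sep i j hij _ (h.cyl_mapsTo w hx) _ hy'
      have h1 : |deriv (cyl g (u ++ i :: w)) z| ≤ |deriv (cyl g u) (cyl g (i :: w) z)| := by
        rw [h.deriv_cyl_append, abs_mul]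
        have := h.abs_deriv_cyl_le (i :: w) z
        have h2 : θ ^ (i :: w).length ≤ 1 := pow_le_one₀ h.θ_pos.le h.θ_lt.le
        exact mul_le_of_le_one_right (abs_nonneg _) (this.trans h2)
      have h3 := h.le_cyl u (h.subset (h.cyl_mapsTo (i :: w) hx)) (h.subset hy)
        (h.subset (h.cyl_mapsTo (i :: w) hz))
      rw [show cyl g (u ++ i :: w) x = cyl g u (cyl g (i :: w) x) by rw [cyl_append]; rfl]
      calc δ * |deriv (cyl g (u ++ i :: w)) z|
          ≤ |cyl g (i :: w) x - g j y'| * |deriv (cyl g u) (cyl g (i :: w) z)| := by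
            gcongr
            exact hsep
        _ = |deriv (cyl g u) (cyl g (i :: w) z)| * |cyl g (i :: w) x - g j y'| := mul_comm _ _
        _ ≤ K * |cyl g u (cyl g (i :: w) x) - cyl g u (g j y')| := h3
        _ ≤ K ^ 2 * |cyl g u (cyl g (i :: w) x) - cyl g u (g j y')| := by
            gcongr; nlinarith

lemma isCompact_cyl (h : ConformalIFS g X J R θ ε Cg δ) (w : List ι) :
    IsCompact (cyl g w '' X) := h.isCompact.image (h.cyl_contDiff w).continuous

lemma cyl_disjoint (h : ConformalIFS g X J R θ ε Cg δ) {u v : List ι} (hl : u.length = v.length)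
    (huv : u ≠ v) : Disjoint (cyl g u '' X) (cyl g v '' X) := by
  induction u generalizing v with
  | nil => exact absurd (List.length_eq_zero_iff.1 hl.symm).symm huv
  | cons i u ih =>
    cases v with
    | nil => simp at hl
    | cons j v =>
      rw [Set.disjoint_left]
      rintro _ ⟨x, hx, rfl⟩ ⟨y, hy, hxy⟩
      by_cases hij : i = j
      · subst hij
        have hne : u ≠ v := fun e => huv (by rw [e])
        have hinj : Function.Injective (g i) := h.cyl_injective [i]
        refine Set.disjoint_left.1 (ih (by simpa using hl) hne) ⟨x, hx, rfl⟩ ⟨y, hy, hinj hxy⟩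
      · have := h.sep i j hij _ (h.cyl_mapsTo u hx) _ (h.cyl_mapsTo v hy)
        have h2 : g i (cyl g u x) - g j (cyl g v y) = 0 := sub_eq_zero.2 hxy.symm
        rw [h2, abs_zero] at this
        exact absurd this (not_le.2 h.δ_pos)

end ConformalIFS

lemma ae_mem_of_smul_restrict {X : Set ℝ} (hX : MeasurableSet X) {k : ℝ≥0} {ν μ : Measure ℝ}
    (hμ : μ = k • ν.restrict X) : ∀ᵐ y ∂μ, y ∈ X := by
  rw [hμ]
  exact Measure.ae_smul_measure (ae_restrict_mem hX) k

namespace ConformalIFS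

variable {ι : Type*} {g : ι → ℝ → ℝ} {X J : Set ℝ} {R θ ε Cg δ s : ℝ} {k : ℝ≥0} {μ : Measure ℝ}

lemma setLIntegral_cyl (h : ConformalIFS g X J R θ ε Cg δ) (hs : 0 < s)
    (hμ : μ = k • (μH[s]).restrict X) (w : List ι) {F : ℝ → ℝ≥0∞} (hF : Measurable F) :
    ∫⁻ z in cyl g w '' X, F z ∂μ =
      ∫⁻ y, F (cyl g w y) * ENNReal.ofReal (|deriv (cyl g w) y| ^ s) ∂μ :=
  have := h.ordConnected
  setLIntegral_image_eq (h.cyl_contDiff w) h.subset h.isCompact.measurableSet (h.deriv_cyl_ne w)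
    h.ε_pos hs (fun _ hx _ hy => h.cyl_dist w hx hy) h.distConst_nonneg (h.cyl_mapsTo w) hμ hF

lemma measurable_deriv_cyl (h : ConformalIFS g X J R θ ε Cg δ) (w : List ι) :
    Measurable (deriv (cyl g w)) := ((h.cyl_contDiff w).continuous_deriv le_rfl).measurable

lemma setIntegral_cyl (h : ConformalIFS g X J R θ ε Cg δ) (hs : 0 < s)
    (hμ : μ = k • (μH[s]).restrict X) (w : List ι) {f : ℝ → ℝ} (hf : Measurable f)
    (hf0 : ∀ x, 0 ≤ f x) :
    ∫ z in cyl g w '' X, f z ∂μ = ∫ y, f (cyl g w y) * |deriv (cyl g w) y| ^ s ∂μ := by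
  have hd := h.measurable_deriv_cyl w
  have hc := (h.cyl_contDiff w).continuous.measurable
  rw [integral_eq_lintegral_of_nonneg_ae (ae_of_all _ hf0) hf.aestronglyMeasurable,
    integral_eq_lintegral_of_nonneg_ae (ae_of_all _ fun y => mul_nonneg (hf0 _) (by positivity)),
    h.setLIntegral_cyl hs hμ w (F := fun z => ENNReal.ofReal (f z)) (by fun_prop)]
  · congr 1
    refine lintegral_congr fun y => ?_
    rw [ENNReal.ofReal_mul (hf0 _)]
  · exact Measurable.aestronglyMeasurable (by fun_prop)

lemma measure_cyl (h : ConformalIFS g X J R θ ε Cg δ) (hs : 0 < s)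
    (hμ : μ = k • (μH[s]).restrict X) (w : List ι) :
    μ (cyl g w '' X) = ∫⁻ y, ENNReal.ofReal (|deriv (cyl g w) y| ^ s) ∂μ := by
  have := h.setLIntegral_cyl hs hμ w (F := fun _ => 1) measurable_const
  simpa using this

lemma ae_mem (h : ConformalIFS g X J R θ ε Cg δ) (hμ : μ = k • (μH[s]).restrict X) :
    ∀ᵐ y ∂μ, y ∈ X := ae_mem_of_smul_restrict h.isCompact.measurableSet hμ

lemma measure_cyl_le [IsProbabilityMeasure μ] (h : ConformalIFS g X J R θ ε Cg δ) (hs : 0 < s)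
    (hμ : μ = k • (μH[s]).restrict X) (w : List ι) {z : ℝ} (hz : z ∈ X) :
    μ (cyl g w '' X) ≤ ENNReal.ofReal ((ratioConst R θ ε Cg * |deriv (cyl g w) z|) ^ s) := by
  rw [h.measure_cyl hs hμ]
  calc _ ≤ ∫⁻ _, ENNReal.ofReal ((ratioConst R θ ε Cg * |deriv (cyl g w) z|) ^ s) ∂μ := by
        refine lintegral_mono_ae ?_
        filter_upwards [h.ae_mem hμ] with y hy
        refine ENNReal.ofReal_le_ofReal (Real.rpow_le_rpow (abs_nonneg _) ?_ hs.le)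
        exact h.cyl_ratio w (h.subset hy) (h.subset hz)
    _ = _ := by simp

lemma le_measure_cyl [IsProbabilityMeasure μ] (h : ConformalIFS g X J R θ ε Cg δ) (hs : 0 < s)
    (hμ : μ = k • (μH[s]).restrict X) (w : List ι) {z : ℝ} (hz : z ∈ X) :
    ENNReal.ofReal ((|deriv (cyl g w) z| / ratioConst R θ ε Cg) ^ s) ≤ μ (cyl g w '' X) := by
  have hK := one_pos.trans_le h.one_le_ratioConst
  rw [h.measure_cyl hs hμ]
  calc _ = ∫⁻ _, ENNReal.ofReal ((|deriv (cyl g w) z| / ratioConst R θ ε Cg) ^ s) ∂μ := by simp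
    _ ≤ _ := by
        refine lintegral_mono_ae ?_
        filter_upwards [h.ae_mem hμ] with y hy
        refine ENNReal.ofReal_le_ofReal (Real.rpow_le_rpow (by positivity) ?_ hs.le)
        rw [div_le_iff₀' hK]
        exact h.cyl_ratio w (h.subset hz) (h.subset hy)

lemma exists_le_deriv_cyl_snoc [Fintype ι] [Nonempty ι] (h : ConformalIFS g X J R θ ε Cg δ)
    {x0 : ℝ} (hx0 : x0 ∈ X) : ∃ m : ℝ, 0 < m ∧ ∀ (w : List ι) (i : ι),
      m * |deriv (cyl g w) x0| ≤ |deriv (cyl g (w ++ [i])) x0| := by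
  have hK := one_pos.trans_le h.one_le_ratioConst
  set m := Finset.univ.inf' Finset.univ_nonempty fun i => |deriv (cyl g [i]) x0| with hm
  have hm0 : 0 < m := (Finset.lt_inf'_iff _).2 fun i _ => abs_pos.2 (h.deriv_cyl_ne _ _)
  have hmi : ∀ i, m ≤ |deriv (cyl g [i]) x0| := fun i =>
    Finset.inf'_le (fun i => |deriv (cyl g [i]) x0|) (Finset.mem_univ i)
  refine ⟨m / ratioConst R θ ε Cg, by positivity, fun w i => ?_⟩
  rw [h.deriv_cyl_append, abs_mul, div_mul_eq_mul_div, div_le_iff₀ hK]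
  have := h.cyl_ratio w (h.subset hx0) (h.subset (h.cyl_mapsTo [i] hx0))
  calc m * |deriv (cyl g w) x0|
      ≤ |deriv (cyl g [i]) x0| * (ratioConst R θ ε Cg * |deriv (cyl g w) (cyl g [i] x0)|) := by
        gcongr
        exact hmi i
    _ = _ := by ring

lemma exists_upperRegular [IsProbabilityMeasure μ] [Fintype ι] [Nonempty ι]
    (h : ConformalIFS g X J R θ ε Cg δ) (hs : 0 < s) (hμ : μ = k • (μH[s]).restrict X) :
    ∃ C, UpperRegular μ s X C := by
  obtain ⟨x0, hx0⟩ := h.nonempty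
  obtain ⟨m, hm0, hm⟩ := h.exists_le_deriv_cyl_snoc hx0
  set K := ratioConst R θ ε Cg with hK
  have hK1 : 1 ≤ K := h.one_le_ratioConst
  have hK0 : 0 < K := one_pos.trans_le hK1
  have hδ := h.δ_pos
  have hθ := h.θ_pos
  set q := δ / (2 * K ^ 2) with hq
  have hq0 : 0 < q := by positivity
  refine ⟨(K / (q * m)) ^ s + (1 / q) ^ s, by positivity, fun x hx ρ hρ => ?_⟩
  by_cases hρq : q ≤ ρ
  · refine prob_le_one.trans ?_
    rw [← ENNReal.ofReal_one]
    refine ENNReal.ofReal_le_ofReal ?_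
    have h1 : 1 ≤ (1 / q) ^ s * ρ ^ s := by
      rw [← Real.mul_rpow (by positivity) hρ.le]
      refine Real.one_le_rpow ?_ hs.le
      rw [div_mul_eq_mul_div, one_mul, le_div_iff₀ hq0]; linarith
    have h2 : 0 ≤ (K / (q * m)) ^ s * ρ ^ s := by positivity
    linarith
  push Not at hρq
  let Q : ℕ → Prop := fun n => ∀ w : List ι, w.length = n → x ∈ cyl g w '' X →
    q * |deriv (cyl g w) x0| ≤ ρ
  have hQ : ∃ n, Q n := by
    have h1 : Tendsto (fun n => q * θ ^ n) atTop (𝓝 (q * 0)) :=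
      (tendsto_pow_atTop_nhds_zero_of_lt_one hθ.le h.θ_lt).const_mul q
    rw [mul_zero] at h1
    obtain ⟨n, hn⟩ := (h1.eventually_lt_const hρ).exists
    refine ⟨n, fun w hw _ => le_trans ?_ hn.le⟩
    have := h.abs_deriv_cyl_le w x0
    rw [hw] at this
    gcongr
  classical
  obtain ⟨n, hn, hmin⟩ : ∃ n, Q n ∧ ∀ l < n, ¬ Q l :=
    ⟨Nat.find hQ, Nat.find_spec hQ, fun l hl => Nat.find_min hQ hl⟩
  cases n with
  | zero =>
    exfalso
    have := hn [] rfl (by simpa [cyl] using hx)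
    simp [cyl] at this
    linarith
  | succ n =>
    have hnn := hmin n (Nat.lt_succ_self n)
    simp only [Q, not_forall, not_le] at hnn
    obtain ⟨w, hw, hxw, hlt⟩ := hnn
    obtain ⟨y, hy, rfl⟩ := hxw
    have hyU := hy
    rw [h.inv] at hyU
    obtain ⟨i, y', hy', rfl⟩ := mem_iUnion.1 hyU
    have h1 := hn (w ++ [i]) (by simp [hw]) ⟨y', hy', by rw [cyl_append]; rfl⟩
    have h2 := hm w i
    have hball : ∀ᵐ z ∂μ, z ∈ closedBall (cyl g w (g i y')) ρ → z ∈ cyl g w '' X := by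
      filter_upwards [h.ae_mem hμ] with z hz hzb
      by_contra hzw
      have h3 := h.cyl_sep w hy hz hzw hx0
      rw [mem_closedBall, dist_comm, Real.dist_eq] at hzb
      rw [← hK] at h3
      have h4 : δ * |deriv (cyl g w) x0| = K ^ 2 * (2 * (q * |deriv (cyl g w) x0|)) := by
        rw [hq]; field_simp
      rw [h4] at h3
      have h5 := le_of_mul_le_mul_left h3 (by positivity)
      have h6 : 0 < q * |deriv (cyl g w) x0| :=
        mul_pos hq0 (abs_pos.2 (h.deriv_cyl_ne _ _))
      linarith
    calc μ (closedBall (cyl g w (g i y')) ρ) ≤ μ (cyl g w '' X) := measure_mono_ae hball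
      _ ≤ ENNReal.ofReal ((K * |deriv (cyl g w) x0|) ^ s) := h.measure_cyl_le hs hμ w hx0
      _ ≤ _ := by
        refine ENNReal.ofReal_le_ofReal ?_
        have h3 : (K * |deriv (cyl g w) x0|) ^ s ≤ (K / (q * m)) ^ s * ρ ^ s := by
          rw [← Real.mul_rpow (by positivity) hρ.le]
          refine Real.rpow_le_rpow (by positivity) ?_ hs.le
          rw [div_mul_eq_mul_div, le_div_iff₀ (by positivity)]
          calc K * |deriv (cyl g w) x0| * (q * m) = K * (q * (m * |deriv (cyl g w) x0|)) := by ring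
            _ ≤ K * ρ := by gcongr; exact le_trans (by gcongr) h1
        have h4 : 0 ≤ (1 / q) ^ s * ρ ^ s := by positivity
        linarith

end ConformalIFS

/-- Changing base point and scale by bounded factors changes the energy by a bounded amount. -/
lemma exists_rieszEnergy_sub_le {μ : Measure ℝ} [IsFiniteMeasure μ] {s C : ℝ} {X : Set ℝ}
    (hs : 0 < s) (h : UpperRegular μ s X C) {M : ℝ} (hM : 1 ≤ M) :
    ∃ B : ℝ, 0 ≤ B ∧ ∀ x ∈ X, ∀ x' ∈ X, ∀ t t' : ℝ, 0 < t → 0 < t' → t ≤ M * t' → t' ≤ M * t →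
      |x - x'| ≤ M * t → |rieszEnergy μ s x t - rieszEnergy μ s x' t'| ≤ B := by
  have hC := h.1
  have hM0 : 0 < M := one_pos.trans_le hM
  have scale : ∀ x ∈ X, ∀ t t' : ℝ, 0 < t → 0 < t' → t ≤ M * t' →
      rieszEnergy μ s x t' - rieszEnergy μ s x t ≤ C * M ^ s := by
    intro x hx t t' ht ht' htt
    have hpos : 0 ≤ C * M ^ s := by positivity
    rcases le_total t t' with hle | hle
    · linarith [rieszEnergy_anti μ hs.le ht hle x]
    · refine (rieszEnergy_scale_le μ hs ht' hle).trans ?_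
      calc t' ^ (-s) * μ.real (closedBall x t) ≤ t' ^ (-s) * (C * (M * t') ^ s) := by
            gcongr
            exact (h.real_le hx ht).trans (by gcongr)
        _ = C * M ^ s := by
            rw [Real.mul_rpow hM0.le ht'.le, Real.rpow_neg ht'.le]
            have : t' ^ s ≠ 0 := (Real.rpow_pos_of_pos ht' s).ne'
            field_simp
  refine ⟨C * M ^ s + s * M * (2 * (C * 2 ^ s)), by positivity,
    fun x hx x' hx' t t' ht ht' h1 h2 h3 => ?_⟩
  have e1 := rieszEnergy_sub_le hs h hx ht hM0.le h3
  have e2 := rieszEnergy_sub_le hs h hx' ht hM0.le ((abs_sub_comm x' x).trans_le h3)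
  have e3 := scale x' hx' t t' ht ht' h1
  have e4 := scale x' hx' t' t ht' ht h2
  rw [abs_le]
  constructor <;> linarith

lemma rpow_exp_le {s a b η : ℝ} (hs : 0 ≤ s) (ha : 0 < a) (hb : 0 < b)
    (h : a ≤ Real.exp η * b) : b ^ (-s) ≤ Real.exp (s * η) * a ^ (-s) := by
  rw [Real.rpow_neg hb.le, Real.rpow_neg ha.le, ← div_eq_mul_inv, inv_eq_one_div,
    div_le_div_iff₀ (by positivity) (by positivity), one_mul, mul_comm s, Real.exp_mul,
    ← Real.mul_rpow (by positivity) hb.le]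
  exact Real.rpow_le_rpow ha.le h hs

lemma abs_sub_le_of_exp_ratio {a b η : ℝ} (hb : 0 ≤ b) (hη : 0 ≤ η)
    (h1 : a ≤ Real.exp η * b) (h2 : b ≤ Real.exp η * a) : |a - b| ≤ η * Real.exp η * b := by
  have e0 := Real.add_one_le_exp η
  have e1 : Real.exp η - 1 ≤ η * Real.exp η := by
    have := Real.add_one_le_exp (-η)
    have h3 : Real.exp η * Real.exp (-η) = 1 := by rw [← Real.exp_add]; simp
    nlinarith [Real.exp_pos η]
  rw [abs_le]
  constructor
  · have h4 : Real.exp (-η) * b ≤ a := by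
      have h3 : Real.exp (-η) * Real.exp η = 1 := by rw [← Real.exp_add]; simp
      calc _ ≤ Real.exp (-η) * (Real.exp η * a) := by gcongr
        _ = a := by rw [← mul_assoc, h3, one_mul]
    have h5 := Real.add_one_le_exp (-η)
    have h6 : 1 ≤ Real.exp η := by linarith
    have h7 : (-η + 1) * b ≤ Real.exp (-η) * b := by gcongr
    have h8 : η * b ≤ η * Real.exp η * b := by
      gcongr; exact le_mul_of_one_le_right hη h6
    linarith
  · have : (Real.exp η - 1) * b ≤ η * Real.exp η * b := by gcongr
    linarith

namespace ConformalIFS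

variable {ι : Type*} {g : ι → ℝ → ℝ} {X J : Set ℝ} {R θ ε Cg δ s : ℝ} {k : ℝ≥0} {μ : Measure ℝ}

lemma abs_deriv_cyl_pos (h : ConformalIFS g X J R θ ε Cg δ) (w : List ι) (x : ℝ) :
    0 < |deriv (cyl g w) x| := abs_pos.2 (h.deriv_cyl_ne w x)

/-- Pointwise comparison of the transported Riesz kernel. -/
lemma kernel_cyl_sub_le (h : ConformalIFS g X J R θ ε Cg δ) (hs : 0 < s) (w : List ι) {x y t : ℝ}
    (hx : x ∈ J) (hy : y ∈ J) (ht : 0 < t) :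
    |(max (|deriv (cyl g w) x| * t) |cyl g w x - cyl g w y|) ^ (-s) * |deriv (cyl g w) y| ^ s
        - (max t |x - y|) ^ (-s)| ≤
      2 * s * distConst θ ε Cg * Real.exp (2 * s * distConst θ ε Cg * R ^ ε) *
        (|x - y| ^ ε * (max t |x - y|) ^ (-s)) := by
  have := h.ordConnected
  obtain ⟨ξ, hξ, hξx, he⟩ := exists_deriv_mul_eq (h.cyl_differentiable w) hx hy
  set D := |deriv (cyl g w) x| with hD
  have hD0 : 0 < D := h.abs_deriv_cyl_pos w x
  have hC := h.distConst_nonneg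
  have hε := h.ε_pos
  set η := distConst θ ε Cg * |x - y| ^ ε with hη
  have hη0 : 0 ≤ η := by positivity
  have hη1 : η ≤ distConst θ ε Cg * R ^ ε := by
    have := h.bounded x hx y hy
    rw [hη]; gcongr
  have hexp : 1 ≤ Real.exp η := Real.one_le_exp hη0
  have b1 : |deriv (cyl g w) ξ| ≤ Real.exp η * D := by
    refine (h.cyl_dist w hξ hx).trans ?_
    rw [hη]; gcongr
  have b2 : D ≤ Real.exp η * |deriv (cyl g w) ξ| := by
    refine (h.cyl_dist w hx hξ).trans ?_
    rw [hη, abs_sub_comm x ξ]; gcongr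
  have b3 : |deriv (cyl g w) y| ≤ Real.exp η * D := by
    have := h.cyl_dist w hy hx
    rwa [abs_sub_comm y x] at this
  have b4 : D ≤ Real.exp η * |deriv (cyl g w) y| := h.cyl_dist w hx hy
  set m := max t |x - y| with hm
  have hm0 : 0 < m := lt_max_of_lt_left ht
  set M := max (D * t) |cyl g w x - cyl g w y| with hMdef
  have hM0 : 0 < M := lt_max_of_lt_left (by positivity)
  have c1 : M ≤ Real.exp η * (D * m) := by
    refine max_le ?_ ?_
    · calc D * t ≤ D * m := by gcongr; exact le_max_left _ _
        _ ≤ Real.exp η * (D * m) := le_mul_of_one_le_left (by positivity) hexp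
    · rw [he]
      calc |deriv (cyl g w) ξ| * |x - y| ≤ (Real.exp η * D) * m := by
            gcongr; exact le_max_right _ _
        _ = _ := by ring
  have c2 : D * m ≤ Real.exp η * M := by
    rw [hm, mul_max_of_nonneg _ _ hD0.le]
    refine max_le ?_ ?_
    · calc D * t ≤ M := le_max_left _ _
        _ ≤ _ := le_mul_of_one_le_left hM0.le hexp
    · calc D * |x - y| ≤ (Real.exp η * |deriv (cyl g w) ξ|) * |x - y| := by gcongr
        _ = Real.exp η * |cyl g w x - cyl g w y| := by rw [he]; ring
        _ ≤ _ := by gcongr; exact le_max_right _ _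
  have hDy : 0 < |deriv (cyl g w) y| := h.abs_deriv_cyl_pos w y
  have hDm : (D * m) ^ (-s) * D ^ s = m ^ (-s) := by
    rw [Real.mul_rpow hD0.le hm0.le, Real.rpow_neg hD0.le]
    have : D ^ s ≠ 0 := (Real.rpow_pos_of_pos hD0 s).ne'
    field_simp
  have p1 : |deriv (cyl g w) y| ^ s ≤ Real.exp (s * η) * D ^ s := by
    rw [mul_comm s, Real.exp_mul, ← Real.mul_rpow (by positivity) hD0.le]
    exact Real.rpow_le_rpow hDy.le b3 hs.le
  have p2 : D ^ s ≤ Real.exp (s * η) * |deriv (cyl g w) y| ^ s := by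
    rw [mul_comm s, Real.exp_mul, ← Real.mul_rpow (by positivity) hDy.le]
    exact Real.rpow_le_rpow hD0.le b4 hs.le
  have q1 : M ^ (-s) ≤ Real.exp (s * η) * (D * m) ^ (-s) :=
    rpow_exp_le hs.le (by positivity) hM0 c2
  have q2 : (D * m) ^ (-s) ≤ Real.exp (s * η) * M ^ (-s) :=
    rpow_exp_le hs.le hM0 (by positivity) c1
  have hee : Real.exp (2 * s * η) = Real.exp (s * η) * Real.exp (s * η) := by
    rw [← Real.exp_add]; ring_nf
  have r1 : M ^ (-s) * |deriv (cyl g w) y| ^ s ≤ Real.exp (2 * s * η) * m ^ (-s) := by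
    rw [← hDm, hee]
    calc _ ≤ (Real.exp (s * η) * (D * m) ^ (-s)) * (Real.exp (s * η) * D ^ s) := by gcongr
      _ = _ := by ring
  have r2 : m ^ (-s) ≤ Real.exp (2 * s * η) * (M ^ (-s) * |deriv (cyl g w) y| ^ s) := by
    rw [← hDm, hee]
    calc _ ≤ (Real.exp (s * η) * M ^ (-s)) * (Real.exp (s * η) * |deriv (cyl g w) y| ^ s) := by
          gcongr
      _ = _ := by ring
  refine (abs_sub_le_of_exp_ratio (by positivity) (by positivity) r1 r2).trans ?_
  calc 2 * s * η * Real.exp (2 * s * η) * m ^ (-s)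
      ≤ 2 * s * η * Real.exp (2 * s * (distConst θ ε Cg * R ^ ε)) * m ^ (-s) := by gcongr
    _ = _ := by rw [hη]; ring_nf

/-- Transport of the truncated energy by a cylinder map. -/
lemma exists_rieszEnergy_cyl [IsProbabilityMeasure μ] 
    (h : ConformalIFS g X J R θ ε Cg δ) (hs : 0 < s) (hμ : μ = k • (μH[s]).restrict X) {C : ℝ}
    (hC : UpperRegular μ s X C) :
    ∃ B : ℝ, 0 ≤ B ∧ ∀ (w : List ι), ∀ x ∈ X, ∀ t : ℝ, 0 < t → t ≤ 1 →
      |rieszEnergy μ s (cyl g w x) (|deriv (cyl g w) x| * t)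
        - rieszEnergy μ s (cyl g w x) |deriv (cyl g w) x| - rieszEnergy μ s x t| ≤ B := by
  obtain ⟨B, hB0, hB⟩ := exists_integral_weighted_kernel_le h.ε_pos hs h.R_pos hC
    (fun x hx => (h.ae_mem hμ).mono fun y hy => h.bounded x (h.subset hx) y (h.subset hy))
  set K := ratioConst R θ ε Cg with hK
  have hK1 : 1 ≤ K := h.one_le_ratioConst
  have hK0 : 0 < K := one_pos.trans_le hK1
  have hδ := h.δ_pos
  have hd := h.distConst_nonneg
  have hC0 := hC.1
  set E := 2 * s * distConst θ ε Cg * Real.exp (2 * s * distConst θ ε Cg * R ^ ε) with hE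
  have hE0 : 0 ≤ E := by positivity
  refine ⟨E * B + K ^ s + (δ / K ^ 2) ^ (-s) * C, by positivity, fun w x hx t ht ht1 => ?_⟩
  set D := |deriv (cyl g w) x| with hD
  have hD0 : 0 < D := h.abs_deriv_cyl_pos w x
  have hDt : 0 < D * t := by positivity
  set z := cyl g w x with hz
  have hzX : z ∈ X := h.cyl_mapsTo w hx
  set S := cyl g w '' X with hS
  have hSm : MeasurableSet S := (h.isCompact_cyl w).measurableSet
  have i1 := integrable_riesz_kernel μ hs.le hDt z
  have i2 := integrable_riesz_kernel μ hs.le hD0 z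
  have i3 := integrable_riesz_kernel μ hs.le ht x
  have hmono : ∀ y, (max D |z - y|) ^ (-s) ≤ (max (D * t) |z - y|) ^ (-s) := fun y =>
    Real.rpow_le_rpow_of_nonpos (lt_max_of_lt_left hDt)
      (max_le_max_right _ (mul_le_of_le_one_right hD0.le ht1)) (by linarith)
  have inside : |∫ y in S, (max (D * t) |z - y|) ^ (-s) ∂μ - rieszEnergy μ s x t| ≤ E * B := by
    have hc := (h.cyl_contDiff w).continuous.measurable
    have hdm := h.measurable_deriv_cyl w
    rw [h.setIntegral_cyl hs hμ w (by fun_prop)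
      (fun y => Real.rpow_nonneg (hDt.le.trans (le_max_left _ _)) _), rieszEnergy]
    have hle : ∀ᵐ y ∂μ, |(max (D * t) |z - cyl g w y|) ^ (-s) * |deriv (cyl g w) y| ^ s
        - (max t |x - y|) ^ (-s)| ≤ E * (|x - y| ^ ε * (max t |x - y|) ^ (-s)) := by
      filter_upwards [h.ae_mem hμ] with y hy
      exact h.kernel_cyl_sub_le hs w (h.subset hx) (h.subset hy) ht
    obtain ⟨j1, j2⟩ := hB x hx t ht
    have i4 : Integrable (fun y => (max (D * t) |z - cyl g w y|) ^ (-s) *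
        |deriv (cyl g w) y| ^ s - (max t |x - y|) ^ (-s)) μ := by
      refine (j1.const_mul E).mono' (Measurable.aestronglyMeasurable (by fun_prop)) hle
    have i5 : Integrable (fun y => (max (D * t) |z - cyl g w y|) ^ (-s) *
        |deriv (cyl g w) y| ^ s) μ := by
      refine (i4.add i3).congr (ae_of_all _ fun y => ?_)
      simp
    rw [← integral_sub i5 i3]
    refine abs_integral_le_integral_abs.trans ?_
    refine (integral_mono_ae i4.abs (j1.const_mul E) hle).trans ?_
    rw [integral_const_mul]
    gcongr
  have insideD : |∫ y in S, (max D |z - y|) ^ (-s) ∂μ| ≤ K ^ s := by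
    rw [abs_of_nonneg (integral_nonneg fun y =>
      Real.rpow_nonneg (hD0.le.trans (le_max_left _ _)) _)]
    calc ∫ y in S, (max D |z - y|) ^ (-s) ∂μ ≤ ∫ _ in S, D ^ (-s) ∂μ := by
          refine integral_mono i2.integrableOn (integrable_const _) fun y => ?_
          exact Real.rpow_le_rpow_of_nonpos hD0 (le_max_left _ _) (by linarith)
      _ = μ.real S * D ^ (-s) := by simp
      _ ≤ (K * D) ^ s * D ^ (-s) := by
          gcongr
          exact ENNReal.toReal_le_of_le_ofReal (by positivity) (h.measure_cyl_le hs hμ w hx)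
      _ = K ^ s := by
          rw [Real.mul_rpow hK0.le hD0.le, mul_assoc, ← Real.rpow_add hD0]; simp
  have outside : |∫ y in Sᶜ, ((max (D * t) |z - y|) ^ (-s) - (max D |z - y|) ^ (-s)) ∂μ| ≤
      (δ / K ^ 2) ^ (-s) * C := by
    rw [abs_of_nonneg (integral_nonneg fun y => sub_nonneg.2 (hmono y))]
    have hcb : MeasurableSet (closedBall z D) := measurableSet_closedBall
    have hae : ∀ᵐ y ∂(μ.restrict Sᶜ), (max (D * t) |z - y|) ^ (-s) - (max D |z - y|) ^ (-s) ≤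
        (closedBall z D).indicator (fun _ => (δ / K ^ 2 * D) ^ (-s)) y := by
      filter_upwards [ae_restrict_mem hSm.compl, ae_restrict_of_ae (h.ae_mem hμ)] with y hyS hy
      by_cases hyD : y ∈ closedBall z D
      · rw [indicator_of_mem hyD]
        have h0 : 0 ≤ (max D |z - y|) ^ (-s) := Real.rpow_nonneg (hD0.le.trans (le_max_left _ _)) _
        have h1 : δ / K ^ 2 * D ≤ |z - y| := by
          rw [div_mul_eq_mul_div, div_le_iff₀' (by positivity)]
          exact h.cyl_sep w hx hy hyS hx
        have h2 : (max (D * t) |z - y|) ^ (-s) ≤ (δ / K ^ 2 * D) ^ (-s) :=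
          Real.rpow_le_rpow_of_nonpos (by positivity) (h1.trans (le_max_right _ _)) (by linarith)
        linarith
      · rw [indicator_of_notMem hyD]
        rw [mem_closedBall, not_le, dist_comm, Real.dist_eq] at hyD
        have h3 : D * t ≤ |z - y| := (mul_le_of_le_one_right hD0.le ht1).trans hyD.le
        rw [max_eq_right h3, max_eq_right hyD.le, sub_self]
    calc _ ≤ ∫ y in Sᶜ, (closedBall z D).indicator (fun _ => (δ / K ^ 2 * D) ^ (-s)) y ∂μ := by
          refine integral_mono_ae (i1.sub i2).integrableOn ?_ hae
          exact ((integrable_const _).indicator hcb).integrableOn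
      _ ≤ ∫ y, (closedBall z D).indicator (fun _ => (δ / K ^ 2 * D) ^ (-s)) y ∂μ := by
          refine setIntegral_le_integral ((integrable_const _).indicator hcb) (ae_of_all _ fun y => ?_)
          exact indicator_nonneg (fun _ _ => by positivity) y
      _ = μ.real (closedBall z D) * (δ / K ^ 2 * D) ^ (-s) := by
          rw [integral_indicator hcb]; simp
      _ ≤ (C * D ^ s) * (δ / K ^ 2 * D) ^ (-s) := by
          gcongr
          exact hC.real_le hzX hD0
      _ = _ := by
          rw [Real.mul_rpow (by positivity) hD0.le]
          have : D ^ s * D ^ (-s) = 1 := by rw [← Real.rpow_add hD0]; simp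
          linear_combination (C * (δ / K ^ 2) ^ (-s)) * this
  have split : rieszEnergy μ s z (D * t) - rieszEnergy μ s z D - rieszEnergy μ s x t =
      (∫ y in S, (max (D * t) |z - y|) ^ (-s) ∂μ - rieszEnergy μ s x t)
      - ∫ y in S, (max D |z - y|) ^ (-s) ∂μ
      + ∫ y in Sᶜ, ((max (D * t) |z - y|) ^ (-s) - (max D |z - y|) ^ (-s)) ∂μ := by
    rw [integral_sub i1.integrableOn i2.integrableOn]
    have e1 := integral_add_compl hSm i1
    have e2 := integral_add_compl hSm i2
    simp only [rieszEnergy] at *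
    linarith
  rw [split]
  have t1 := abs_add_le ((∫ y in S, (max (D * t) |z - y|) ^ (-s) ∂μ - rieszEnergy μ s x t)
      - ∫ y in S, (max D |z - y|) ^ (-s) ∂μ)
    (∫ y in Sᶜ, ((max (D * t) |z - y|) ^ (-s) - (max D |z - y|) ^ (-s)) ∂μ)
  have t2 := abs_sub (∫ y in S, (max (D * t) |z - y|) ^ (-s) ∂μ - rieszEnergy μ s x t)
      (∫ y in S, (max D |z - y|) ^ (-s) ∂μ)
  linarith

end ConformalIFS

/-- A measure on a compact set `X` coded by a tree of cylinders `cl w` with base points `pt w` and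
sizes `d w`, along which the truncated Riesz energy is almost additive. -/
structure CodedMeasure {ι : Type} (X : Set ℝ) (μ : Measure ℝ) (s : ℝ) (pt : List ι → ℝ)
    (cl : List ι → Set ℝ) (d : List ι → ℝ) (C θ κ D : ℝ) : Prop where
  isCompact : IsCompact X
  s_pos : 0 < s
  cl_nil : cl [] = X
  cl_append_subset : ∀ u v, cl (u ++ v) ⊆ cl u
  isCompact_cl : ∀ w, IsCompact (cl w)
  pt_mem : ∀ w, pt w ∈ cl w
  cover : ∀ n, ∀ x ∈ X, ∃ w : List ι, w.length = n ∧ x ∈ cl w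
  disjoint : ∀ u v, u.length = v.length → u ≠ v → Disjoint (cl u) (cl v)
  one_le_C : 1 ≤ C
  θ_pos : 0 < θ
  θ_lt : θ < 1
  κ_pos : 0 < κ
  d_pos : ∀ w, 0 < d w
  d_nil : d [] = 1
  d_append_le : ∀ u v, d (u ++ v) ≤ C * (d u * d v)
  le_d_append : ∀ u v, d u * d v ≤ C * d (u ++ v)
  d_le : ∀ w, d w ≤ θ ^ w.length
  diam : ∀ w, ∀ x ∈ cl w, ∀ y ∈ cl w, |x - y| ≤ C * d w
  sep : ∀ w, ∀ x ∈ cl w, ∀ y ∈ X, y ∉ cl w → κ * d w ≤ |x - y|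
  upper : UpperRegular μ s X C
  ae_mem : ∀ᵐ y ∂μ, y ∈ X
  D_nonneg : 0 ≤ D
  additive : ∀ u v, |rieszEnergy μ s (pt (u ++ v)) (d (u ++ v)) - rieszEnergy μ s (pt u) (d u)
    - rieszEnergy μ s (pt v) (d v)| ≤ D
  energy : ∀ w, ∀ x ∈ cl w, |rieszEnergy μ s x (d w) - rieszEnergy μ s (pt w) (d w)| ≤ D

namespace ConformalIFS

variable {ι : Type} {g : ι → ℝ → ℝ} {X J : Set ℝ} {R θ ε Cg δ s : ℝ} {k : ℝ≥0} {μ : Measure ℝ}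

lemma exists_codedMeasure [Fintype ι] [Nonempty ι] [IsProbabilityMeasure μ]
    (h : ConformalIFS g X J R θ ε Cg δ) (hs : 0 < s) (hμ : μ = k • (μH[s]).restrict X) {x0 : ℝ}
    (hx0 : x0 ∈ X) :
    ∃ C κ D, CodedMeasure X μ s (fun w => cyl g w x0) (fun w => cyl g w '' X)
      (fun w => |deriv (cyl g w) x0|) C θ κ D := by
  obtain ⟨C0, hC0⟩ := h.exists_upperRegular hs hμ
  obtain ⟨B, hB0, hB⟩ := h.exists_rieszEnergy_cyl hs hμ hC0
  set K := ratioConst R θ ε Cg with hK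
  have hK1 : 1 ≤ K := h.one_le_ratioConst
  have hK0 : 0 < K := one_pos.trans_le hK1
  have hR := h.R_pos
  have hM : 1 ≤ K * (R + 1) := by nlinarith
  obtain ⟨B', hB'0, hB'⟩ := exists_rieszEnergy_sub_le hs hC0 hM
  have hKM : K ≤ K * (R + 1) := le_mul_of_one_le_right hK0.le (by linarith)
  have hKR : K * R ≤ K * (R + 1) := by gcongr; linarith
  have hdiam : ∀ w, ∀ x ∈ X, ∀ y ∈ X, |cyl g w x - cyl g w y| ≤
      K * (R + 1) * |deriv (cyl g w) x0| := by
    intro w x hx y hy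
    calc _ ≤ K * |deriv (cyl g w) x0| * |x - y| :=
          h.cyl_le w (h.subset hx) (h.subset hy) (h.subset hx0)
      _ ≤ K * |deriv (cyl g w) x0| * R := by
          gcongr; exact h.bounded x (h.subset hx) y (h.subset hy)
      _ = K * R * |deriv (cyl g w) x0| := by ring
      _ ≤ _ := by gcongr
  refine ⟨K * (R + 1) + C0, δ / K ^ 2, B + B', ?_⟩
  have hC00 := hC0.1
  have hδ := h.δ_pos
  have hpos := fun w => h.abs_deriv_cyl_pos w x0
  exact
    { isCompact := h.isCompact
      s_pos := hs
      cl_nil := by simp [cyl]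
      cl_append_subset := fun u v => by
        rw [cyl_append, image_comp]
        exact image_mono (h.cyl_mapsTo v).image_subset
      isCompact_cl := h.isCompact_cyl
      pt_mem := fun w => mem_image_of_mem _ hx0
      cover := fun n x hx => h.exists_cyl_eq n hx
      disjoint := fun u v => h.cyl_disjoint
      one_le_C := by linarith
      θ_pos := h.θ_pos
      θ_lt := h.θ_lt
      κ_pos := by positivity
      d_pos := hpos
      d_nil := by simp [cyl]
      d_append_le := fun u v => by
        have h1 := h.cyl_ratio u (h.subset (h.cyl_mapsTo v hx0)) (h.subset hx0)
        rw [h.deriv_cyl_append, abs_mul, ← mul_assoc]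
        have : K ≤ K * (R + 1) + C0 := by linarith
        gcongr
        exact h1.trans (by gcongr)
      le_d_append := fun u v => by
        have h1 := h.cyl_ratio u (h.subset hx0) (h.subset (h.cyl_mapsTo v hx0))
        rw [h.deriv_cyl_append, abs_mul, ← mul_assoc]
        have : K ≤ K * (R + 1) + C0 := by linarith
        gcongr
        exact h1.trans (by gcongr)
      d_le := fun w => h.abs_deriv_cyl_le w x0
      diam := by
        rintro w _ ⟨x, hx, rfl⟩ _ ⟨y, hy, rfl⟩
        refine (hdiam w x hx y hy).trans ?_
        gcongr
        linarith
      sep := by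
        rintro w _ ⟨x, hx, rfl⟩ y hy hyw
        rw [div_mul_eq_mul_div, div_le_iff₀' (by positivity)]
        exact h.cyl_sep w hx hy hyw hx0
      upper := by
        refine ⟨by positivity, fun x hx ρ hρ => (hC0.2 x hx ρ hρ).trans ?_⟩
        gcongr
        have : 0 < K * (R + 1) := by positivity
        linarith
      ae_mem := h.ae_mem hμ
      D_nonneg := by positivity
      additive := by
        intro u v
        set y := cyl g v x0 with hy
        have hyX : y ∈ X := h.cyl_mapsTo v hx0
        have e1 := hB u y hyX |deriv (cyl g v) x0| (hpos v)
          ((h.abs_deriv_cyl_le v x0).trans (pow_le_one₀ h.θ_pos.le h.θ_lt.le))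
        have e2 : |deriv (cyl g u) y| * |deriv (cyl g v) x0| = |deriv (cyl g (u ++ v)) x0| := by
          rw [h.deriv_cyl_append, abs_mul]
        have e3 : cyl g u y = cyl g (u ++ v) x0 := by rw [cyl_append]; rfl
        rw [e2] at e1
        have h1 := h.cyl_ratio u (h.subset hyX) (h.subset hx0)
        have h2 := h.cyl_ratio u (h.subset hx0) (h.subset hyX)
        have e4 := hB' (cyl g u x0) (h.cyl_mapsTo u hx0) (cyl g u y) (h.cyl_mapsTo u hyX)
          |deriv (cyl g u) x0| |deriv (cyl g u) y| (hpos u) (h.abs_deriv_cyl_pos _ _)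
          (h2.trans (by gcongr)) (h1.trans (by gcongr)) (hdiam u _ hx0 _ hyX)
        rw [e3] at e1 e4
        rw [abs_le] at e1 e4 ⊢
        constructor <;> linarith [e1.1, e1.2, e4.1, e4.2]
      energy := by
        rintro w _ ⟨x, hx, rfl⟩
        have hd := hpos w
        have e4 := hB' (cyl g w x) (h.cyl_mapsTo w hx) (cyl g w x0) (h.cyl_mapsTo w hx0)
          |deriv (cyl g w) x0| |deriv (cyl g w) x0| hd hd
          (le_mul_of_one_le_left hd.le hM) (le_mul_of_one_le_left hd.le hM) (hdiam w _ hx _ hx0)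
        linarith }

lemma exists_length_le_energy [IsProbabilityMeasure μ]
    (h : ConformalIFS g X J R θ ε Cg δ) (hs : 0 < s) (hμ : μ = k • (μH[s]).restrict X) {x0 : ℝ}
    (hx0 : x0 ∈ X) (A : ℝ) : ∃ n : ℕ, 1 ≤ n ∧ ∀ w : List ι, w.length = n →
      A ≤ rieszEnergy μ s (cyl g w x0) |deriv (cyl g w) x0| := by
  set K := ratioConst R θ ε Cg with hK
  have hK1 : 1 ≤ K := h.one_le_ratioConst
  have hK0 : 0 < K := one_pos.trans_le hK1
  have hR := h.R_pos
  have hθ := h.θ_pos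
  set M := K * (R + 1) with hMdef
  have hM : 1 ≤ M := by nlinarith
  have hM0 : 0 < M := one_pos.trans_le hM
  have hKR : K * R ≤ M := by rw [hMdef]; gcongr; linarith
  obtain ⟨j, hj1, hj⟩ : ∃ j : ℕ, 1 ≤ j ∧ K * θ ^ j ≤ 1 / 2 := by
    have h1 : Tendsto (fun n => K * θ ^ n) atTop (𝓝 (K * 0)) :=
      (tendsto_pow_atTop_nhds_zero_of_lt_one hθ.le h.θ_lt).const_mul K
    rw [mul_zero] at h1
    obtain ⟨j, hj, hj'⟩ := ((h1.eventually_lt_const (by norm_num : (0:ℝ) < 1 / 2)).and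
      (eventually_ge_atTop 1)).exists
    exact ⟨j, hj', hj.le⟩
  set c := (1 - (2:ℝ) ^ (-s)) * (M * K) ^ (-s) with hc
  have h2s : (2:ℝ) ^ (-s) < 1 := Real.rpow_lt_one_of_one_lt_of_neg one_lt_two (by linarith)
  have hc0 : 0 < c := mul_pos (by linarith) (by positivity)
  have key : ∀ (m : ℕ) (w : List ι), w.length = j * m → ∀ x ∈ cyl g w '' X,
      c * m ≤ rieszEnergy μ s x (M * |deriv (cyl g w) x0|) := by
    intro m
    induction m with
    | zero =>
      intro w _ x _
      simp only [Nat.cast_zero, mul_zero]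
      exact integral_nonneg fun y => Real.rpow_nonneg ((abs_nonneg _).trans (le_max_right _ _)) _
    | succ m ih =>
      intro w hw x hx
      obtain ⟨u, v, rfl, hu, hv⟩ : ∃ u v : List ι, w = u ++ v ∧ u.length = j * m ∧
          v.length = j :=
        ⟨w.take (j * m), w.drop (j * m), (List.take_append_drop _ _).symm,
          by rw [List.length_take, hw]; exact min_eq_left (by gcongr; omega),
          by rw [List.length_drop, hw, mul_add]; omega⟩
      have hxu : x ∈ cyl g u '' X := by
        rw [cyl_append, image_comp] at hx
        exact image_mono (h.cyl_mapsTo v).image_subset hx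
      have i1 := ih u hu x hxu
      set t := |deriv (cyl g (u ++ v)) x0| with ht
      have ht0 : 0 < t := h.abs_deriv_cyl_pos _ _
      have htu : 2 * t ≤ |deriv (cyl g u) x0| := by
        have h1 := h.cyl_ratio u (h.subset (h.cyl_mapsTo v hx0)) (h.subset hx0)
        have h2 := h.abs_deriv_cyl_le v x0
        rw [hv] at h2
        have h3 : t ≤ (K * θ ^ j) * |deriv (cyl g u) x0| := by
          rw [ht, h.deriv_cyl_append, abs_mul]
          calc _ ≤ (K * |deriv (cyl g u) x0|) * θ ^ j := by gcongr
            _ = _ := by ring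
        have h4 : (K * θ ^ j) * |deriv (cyl g u) x0| ≤ 1 / 2 * |deriv (cyl g u) x0| := by gcongr
        linarith
      have i2 := le_rieszEnergy_scale μ (x := x) hs (mul_pos hM0 ht0)
        (t := M * |deriv (cyl g u) x0|) (by gcongr; linarith)
      have i3 : ENNReal.ofReal ((t / K) ^ s) ≤ μ (closedBall x (M * t)) := by
        refine (h.le_measure_cyl hs hμ (u ++ v) hx0).trans (measure_mono ?_)
        obtain ⟨y, hy, rfl⟩ := hx
        rintro _ ⟨z, hz, rfl⟩
        rw [mem_closedBall, Real.dist_eq]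
        calc _ ≤ K * t * |z - y| := h.cyl_le _ (h.subset hz) (h.subset hy) (h.subset hx0)
          _ ≤ K * t * R := by gcongr; exact h.bounded _ (h.subset hz) _ (h.subset hy)
          _ = K * R * t := by ring
          _ ≤ _ := by gcongr
      have i4 : (t / K) ^ s ≤ μ.real (closedBall x (M * t)) :=
        (ENNReal.ofReal_le_iff_le_toReal (measure_ne_top _ _)).1 i3
      have i5 : (M * |deriv (cyl g u) x0|) ^ (-s) ≤ (2:ℝ) ^ (-s) * (M * t) ^ (-s) := by
        rw [← Real.mul_rpow (by norm_num) (by positivity)]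
        refine Real.rpow_le_rpow_of_nonpos (by positivity) ?_ (by linarith)
        calc 2 * (M * t) = M * (2 * t) := by ring
          _ ≤ _ := by gcongr
      have i6 : c ≤ ((M * t) ^ (-s) - (M * |deriv (cyl g u) x0|) ^ (-s)) *
          μ.real (closedBall x (M * t)) := by
        calc c = ((1 - (2:ℝ) ^ (-s)) * (M * t) ^ (-s)) * (t / K) ^ s := by
              rw [hc, Real.mul_rpow hM0.le hK0.le, Real.mul_rpow hM0.le ht0.le,
                Real.div_rpow ht0.le hK0.le, Real.rpow_neg ht0.le, Real.rpow_neg hK0.le]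
              have : t ^ s ≠ 0 := (Real.rpow_pos_of_pos ht0 s).ne'
              field_simp
          _ ≤ _ := by
              have : 0 ≤ (1 - (2:ℝ) ^ (-s)) * (M * t) ^ (-s) :=
                mul_nonneg (by linarith) (by positivity)
              exact mul_le_mul (by linarith) i4 (by positivity) (by linarith)
      push_cast
      linarith
  obtain ⟨m, hm⟩ := exists_nat_ge (A / c)
  refine ⟨j * (m + 1), Nat.mul_pos hj1 (Nat.succ_pos m), fun w hw => ?_⟩
  have i1 := key (m + 1) w hw (cyl g w x0) (mem_image_of_mem _ hx0)
  have hd := h.abs_deriv_cyl_pos w x0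
  have i2 := rieszEnergy_anti μ hs.le hd (le_mul_of_one_le_left hd.le hM) (cyl g w x0)
  rw [div_le_iff₀ hc0] at hm
  push_cast at i1
  nlinarith

end ConformalIFS

lemma flatMap_ofFn_injOn {ι : Type} {n : ℕ} : ∀ {u v : List (Fin n → ι)}, u.length = v.length →
    u.flatMap List.ofFn = v.flatMap List.ofFn → u = v
  | [], [], _, _ => rfl
  | [], _ :: _, h, _ => by simp at h
  | _ :: _, [], h, _ => by simp at h
  | a :: u, b :: v, h, e => by
    rw [List.flatMap_cons, List.flatMap_cons] at e
    obtain ⟨e1, e2⟩ := List.append_inj e (by simp)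
    rw [List.ofFn_injective e1, flatMap_ofFn_injOn (by simpa using h) e2]

lemma length_flatMap_ofFn {ι : Type} {n : ℕ} (u : List (Fin n → ι)) :
    (u.flatMap List.ofFn).length = u.length * n := by
  induction u with
  | nil => simp
  | cons a u ih =>
    rw [List.flatMap_cons, List.length_append, ih, List.length_ofFn, List.length_cons]; ring

lemma exists_flatMap_ofFn_eq {ι : Type} {n : ℕ} (m : ℕ) (w : List ι) (hw : w.length = m * n) :
    ∃ u : List (Fin n → ι), u.length = m ∧ u.flatMap List.ofFn = w := by
  induction m generalizing w with
  | zero => exact ⟨[], rfl, by simp at hw; simp [hw]⟩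
  | succ m ih =>
    obtain ⟨u, hu, hu'⟩ := ih (w.drop n) (by rw [List.length_drop, hw, add_mul]; omega)
    have hl : (w.take n).length = n := by
      rw [List.length_take, hw, add_mul]; omega
    refine ⟨(fun i => (w.take n).get (i.cast hl.symm)) :: u, by simp [hu], ?_⟩
    rw [List.flatMap_cons, hu']
    conv_rhs => rw [← List.take_append_drop n w]
    congr 1
    refine List.ext_getElem (by simp [hl]) fun i h1 h2 => ?_
    simp

/-- Grouping letters into blocks of length `n`. -/
lemma CodedMeasure.iterate {ι : Type} {X : Set ℝ} {μ : Measure ℝ} {s : ℝ} {pt : List ι → ℝ}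
    {cl : List ι → Set ℝ} {d : List ι → ℝ} {C θ κ D : ℝ}
    (h : CodedMeasure X μ s pt cl d C θ κ D) {n : ℕ} (hn : 1 ≤ n) :
    CodedMeasure X μ s (fun u : List (Fin n → ι) => pt (u.flatMap List.ofFn))
      (fun u => cl (u.flatMap List.ofFn)) (fun u => d (u.flatMap List.ofFn)) C θ κ D where
  isCompact := h.isCompact
  s_pos := h.s_pos
  cl_nil := h.cl_nil
  cl_append_subset u v := by rw [List.flatMap_append]; exact h.cl_append_subset _ _
  isCompact_cl w := h.isCompact_cl _
  pt_mem w := h.pt_mem _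
  cover m x hx := by
    obtain ⟨w, hw, hxw⟩ := h.cover (m * n) x hx
    obtain ⟨u, hu, rfl⟩ := exists_flatMap_ofFn_eq m w hw
    exact ⟨u, hu, hxw⟩
  disjoint u v hl huv := h.disjoint _ _ (by simp only [length_flatMap_ofFn, hl])
    fun e => huv (flatMap_ofFn_injOn hl e)
  one_le_C := h.one_le_C
  θ_pos := h.θ_pos
  θ_lt := h.θ_lt
  κ_pos := h.κ_pos
  d_pos w := h.d_pos _
  d_nil := h.d_nil
  d_append_le u v := by rw [List.flatMap_append]; exact h.d_append_le _ _
  le_d_append u v := by rw [List.flatMap_append]; exact h.le_d_append _ _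
  d_le u := (h.d_le _).trans (by
    rw [length_flatMap_ofFn]
    exact pow_le_pow_of_le_one h.θ_pos.le h.θ_lt.le (Nat.le_mul_of_pos_right _ hn))
  diam u := h.diam _
  sep u := h.sep _
  upper := h.upper
  ae_mem := h.ae_mem
  D_nonneg := h.D_nonneg
  additive u v := by rw [List.flatMap_append]; exact h.additive _ _
  energy u := h.energy _

lemma sum_words_succ {ι M : Type*} [Fintype ι] [AddCommMonoid M] (φ : List ι → M) (m : ℕ) :
    ∑ w : Fin (m + 1) → ι, φ (List.ofFn w) =
      ∑ i, ∑ w : Fin m → ι, φ (i :: List.ofFn w) := by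
  rw [← Fintype.sum_prod_type', ← (Fin.consEquiv (fun _ : Fin (m + 1) => ι)).sum_comp]
  refine Fintype.sum_congr _ _ fun x => ?_
  simp [Fin.consEquiv]

lemma exists_sum_exp_eq_one {ι : Type*} [Fintype ι] (hcard : 1 < Fintype.card ι) {b : ι → ℝ}
    (hb : ∀ i, 0 < b i) : ∃ q : ℝ, 0 < q ∧ ∑ i, Real.exp (-q * b i) = 1 := by
  set f : ℝ → ℝ := fun q => ∑ i, Real.exp (-q * b i) with hf
  have hfc : Continuous f := by fun_prop
  have h0 : 1 < f 0 := by simp [hf]; exact hcard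
  have hlim : Tendsto f atTop (𝓝 (∑ _i : ι, 0)) := by
    refine tendsto_finsetSum _ fun i _ => ?_
    have : Tendsto (fun q : ℝ => -(q * b i)) atTop atBot :=
      tendsto_neg_atTop_atBot.comp (tendsto_id.atTop_mul_const (hb i))
    refine (Real.tendsto_exp_atBot.comp this).congr fun q => ?_
    simp [neg_mul]
  rw [Finset.sum_const_zero] at hlim
  obtain ⟨Q, hQ1, hQ0⟩ := ((hlim.eventually_lt_const one_pos).and (eventually_ge_atTop 0)).exists
  obtain ⟨q, hq, hq1⟩ := intermediate_value_Icc' hQ0 hfc.continuousOn ⟨hQ1.le, h0.le⟩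
  refine ⟨q, lt_of_le_of_ne hq.1 ?_, hq1⟩
  rintro rfl
  exact h0.ne' hq1

/-- Exponential decay of the partition functions above the critical parameter. -/
lemma tendsto_sum_exp {ι : Type*} [Fintype ι] {a : List ι → ℝ} {D A q₀ q : ℝ}
    (hadd : ∀ u v, |a (u ++ v) - a u - a v| ≤ D) (hA0 : 0 < A)
    (hA : ∀ i, A ≤ a [i]) (hq0 : 0 < q) (hsum : ∑ i, Real.exp (-q₀ * a [i]) = 1)
    (hq : q₀ * A < q * (A - D)) :
    Tendsto (fun m => ∑ w : Fin m → ι, Real.exp (-q * a (List.ofFn w))) atTop (𝓝 0) := by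
  have hD : 0 ≤ D := (abs_nonneg _).trans (hadd [] [])
  have hqq : q₀ < q := by
    by_contra! hle
    nlinarith [mul_nonneg hq0.le hD, mul_le_mul_of_nonneg_right hle hA0.le]
  set ρ := Real.exp (-(q - q₀) * A + q * D) with hρ
  have hρ1 : ρ < 1 := by
    rw [hρ, Real.exp_lt_one_iff]; nlinarith
  have hone : ∑ i, Real.exp (-q * (a [i] - D)) ≤ ρ := by
    calc ∑ i, Real.exp (-q * (a [i] - D)) ≤ ∑ i, ρ * Real.exp (-q₀ * a [i]) := by
          refine Finset.sum_le_sum fun i _ => ?_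
          rw [hρ, ← Real.exp_add]
          refine Real.exp_le_exp.2 ?_
          have := mul_le_mul_of_nonneg_left (hA i) (sub_pos.2 hqq).le
          linarith
      _ = ρ := by rw [← Finset.mul_sum, hsum, mul_one]
  have hstep : ∀ m, ∑ w : Fin (m + 1) → ι, Real.exp (-q * a (List.ofFn w)) ≤
      ρ * ∑ w : Fin m → ι, Real.exp (-q * a (List.ofFn w)) := by
    intro m
    rw [sum_words_succ (fun w => Real.exp (-q * a w))]
    calc _ ≤ ∑ i, ∑ w : Fin m → ι, Real.exp (-q * (a [i] - D)) *
          Real.exp (-q * a (List.ofFn w)) := by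
          refine Finset.sum_le_sum fun i _ => Finset.sum_le_sum fun w _ => ?_
          rw [← Real.exp_add]
          refine Real.exp_le_exp.2 ?_
          have h1 := (abs_le.1 (hadd [i] (List.ofFn w))).1
          rw [List.singleton_append] at h1
          nlinarith
      _ = (∑ i, Real.exp (-q * (a [i] - D))) *
          ∑ w : Fin m → ι, Real.exp (-q * a (List.ofFn w)) := by
          rw [Finset.sum_mul_sum]
      _ ≤ _ := by gcongr
  have hbound : ∀ m, ∑ w : Fin m → ι, Real.exp (-q * a (List.ofFn w)) ≤
      ρ ^ m * Real.exp (-q * a []) := by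
    intro m
    induction m with
    | zero => simp
    | succ m ih =>
      refine (hstep m).trans ?_
      rw [pow_succ', mul_assoc]
      gcongr
  refine squeeze_zero (fun m => by positivity) hbound ?_
  have := (tendsto_pow_atTop_nhds_zero_of_lt_one (Real.exp_pos _).le hρ1).mul_const
    (Real.exp (-q * a []))
  rwa [zero_mul] at this

lemma lt_radius_iff {c s u : ℝ} (hc : 0 < c) (hs : 0 < s) (hu : 0 < u) (n : ℕ) :
    u < c * ((n + 1 : ℕ) : ℝ) ^ (-(1 / s)) ↔ ((n + 1 : ℕ) : ℝ) < (c / u) ^ s := by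
  have hn : (0:ℝ) < ((n + 1 : ℕ) : ℝ) := by positivity
  rw [Real.rpow_neg hn.le, ← div_eq_mul_inv, lt_div_iff₀ (by positivity), mul_comm,
    ← lt_div_iff₀ hu]
  conv_lhs => rw [← Real.rpow_lt_rpow_iff (by positivity) (by positivity) hs]
  rw [← Real.rpow_mul hn.le, one_div_mul_cancel hs.ne', Real.rpow_one]

lemma count_radius_ge {c s v d' : ℝ} (hc : 0 < c) (hs : 0 < s) (hd : 0 < d') (hv : 0 ≤ v)
    (k : ℕ) : c ^ s * (v + d') ^ (-s) - 1 - k ≤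
      ∑ n ∈ Finset.Ico k ⌈(c / d') ^ s⌉₊,
        if v < c * ((n + 1 : ℕ) : ℝ) ^ (-(1 / s)) - d' then (1:ℝ) else 0 := by
  have hu : 0 < v + d' := by positivity
  set T := (c / (v + d')) ^ s with hT
  have hTT : c ^ s * (v + d') ^ (-s) = T := by
    rw [hT, Real.div_rpow hc.le hu.le, Real.rpow_neg hu.le]; rfl
  rw [hTT, ← Finset.sum_filter, Finset.sum_const, nsmul_one]
  have hsub : Finset.Ico k (⌈T⌉₊ - 1) ⊆ (Finset.Ico k ⌈(c / d') ^ s⌉₊).filter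
      (fun n => v < c * ((n + 1 : ℕ) : ℝ) ^ (-(1 / s)) - d') := by
    intro n hn
    rw [Finset.mem_Ico] at hn
    have h1 : n + 1 < ⌈T⌉₊ := by omega
    have h2 : T ≤ (c / d') ^ s := by
      rw [hT]
      refine Real.rpow_le_rpow (by positivity) ?_ hs.le
      gcongr; linarith
    rw [Finset.mem_filter, Finset.mem_Ico]
    refine ⟨⟨hn.1, ?_⟩, ?_⟩
    · have := Nat.ceil_mono h2; omega
    · rw [lt_sub_iff_add_lt, lt_radius_iff hc hs hu]
      exact Nat.lt_ceil.1 h1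
  have hcard : (((Finset.Ico k (⌈T⌉₊ - 1)).card : ℕ) : ℝ) ≤ _ :=
    Nat.cast_le.2 (Finset.card_le_card hsub)
  refine le_trans ?_ hcard
  rw [Nat.card_Ico]
  have h3 : T ≤ ⌈T⌉₊ := Nat.le_ceil T
  have h4 : (⌈T⌉₊ : ℝ) ≤ ((⌈T⌉₊ - 1 - k : ℕ) : ℝ) + 1 + k := by
    exact_mod_cast (by omega : ⌈T⌉₊ ≤ ⌈T⌉₊ - 1 - k + 1 + k)
  linarith

/-- The total mass of the shrunken balls is at least the energy at the shrinking scale. -/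
lemma sum_measure_ball_ge {μ : Measure ℝ} [IsProbabilityMeasure μ] {s C : ℝ} {X : Set ℝ}
    (hs : 0 < s) (h : UpperRegular μ s X C) {c d' x : ℝ} (hc : 0 < c) (hd : 0 < d') (hx : x ∈ X)
    (k : ℕ) :
    c ^ s * (rieszEnergy μ s x d' - s * (2 * (C * 2 ^ s))) - 1 - k ≤
      ∑ n ∈ Finset.Ico k ⌈(c / d') ^ s⌉₊,
        μ.real (ball x (c * ((n + 1 : ℕ) : ℝ) ^ (-(1 / s)) - d')) := by
  obtain ⟨h1, h2⟩ := rieszEnergy_sub_integral_add_le hs h hx hd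
  have hcs : 0 < c ^ s := by positivity
  set N := ⌈(c / d') ^ s⌉₊
  have hind : ∀ (n : ℕ) (y : ℝ),
      (if |x - y| < c * ((n + 1 : ℕ) : ℝ) ^ (-(1 / s)) - d' then (1:ℝ) else 0) =
      (ball x (c * ((n + 1 : ℕ) : ℝ) ^ (-(1 / s)) - d')).indicator 1 y := by
    intro n y
    simp only [indicator, mem_ball, Real.dist_eq, abs_sub_comm y x, Pi.one_apply]
  have hinteg : ∀ n : ℕ, Integrable
      ((ball x (c * ((n + 1 : ℕ) : ℝ) ^ (-(1 / s)) - d')).indicator (1 : ℝ → ℝ)) μ :=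
    fun n => (integrable_const 1).indicator measurableSet_ball
  calc c ^ s * (rieszEnergy μ s x d' - s * (2 * (C * 2 ^ s))) - 1 - k
      ≤ c ^ s * ∫ y, (|x - y| + d') ^ (-s) ∂μ - 1 - k := by gcongr; linarith
    _ = ∫ y, (c ^ s * (|x - y| + d') ^ (-s) - 1 - k) ∂μ := by
        have h3 : Integrable (fun y => c ^ s * (|x - y| + d') ^ (-s)) μ := h1.const_mul _
        have h4 : Integrable (fun y => c ^ s * (|x - y| + d') ^ (-s) - 1) μ :=
          h3.sub (integrable_const _)
        rw [integral_sub h4 (integrable_const _), integral_sub h3 (integrable_const _),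
          integral_const_mul]
        simp
    _ ≤ ∫ y, ∑ n ∈ Finset.Ico k N,
          (ball x (c * ((n + 1 : ℕ) : ℝ) ^ (-(1 / s)) - d')).indicator 1 y ∂μ := by
        refine integral_mono (((h1.const_mul _).sub (integrable_const _)).sub
          (integrable_const _)) (integrable_finsetSum _ fun n _ => hinteg n) fun y => ?_
        simp only [← hind]
        exact count_radius_ge hc hs hd (abs_nonneg _) k
    _ = _ := by
        rw [integral_finsetSum _ fun n _ => hinteg n]
        exact Finset.sum_congr rfl fun n _ => integral_indicator_one measurableSet_ball

namespace CodedMeasure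

variable {ι : Type} {X : Set ℝ} {μ : Measure ℝ} {s : ℝ} {pt : List ι → ℝ} {cl : List ι → Set ℝ}
  {d : List ι → ℝ} {C θ κ D : ℝ}

lemma cl_subset (h : CodedMeasure X μ s pt cl d C θ κ D) (w : List ι) : cl w ⊆ X := by
  have := h.cl_append_subset [] w
  rwa [List.nil_append, h.cl_nil] at this

lemma pt_mem_attractor (h : CodedMeasure X μ s pt cl d C θ κ D) (w : List ι) : pt w ∈ X :=
  h.cl_subset w (h.pt_mem w)

/-- The covering part: if the partition functions at parameter `c ^ s` tend to zero then `X` is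
almost surely covered. -/
lemma measure_cover_eq_one [Fintype ι] [IsProbabilityMeasure μ]
    (h : CodedMeasure X μ s pt cl d C θ κ D)
    {P : Measure (ℕ → ℝ)}
    (hP : ∀ (I : Finset ℕ) (f : ℕ → Set ℝ), (∀ n, MeasurableSet (f n)) →
      P {ω | ∀ n ∈ I, ω n ∈ f n} = ∏ n ∈ I, μ (f n))
    {c : ℝ} (hc : 0 < c) {r : ℕ → ℝ} (hr : ∀ n : ℕ, r n = c * ((n + 1 : ℕ) : ℝ) ^ (-(1 / s)))
    (hZ : Tendsto (fun m => ∑ w : Fin m → ι, Real.exp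
      (-(c ^ s) * rieszEnergy μ s (pt (List.ofFn w)) (d (List.ofFn w)))) atTop (𝓝 0)) :
    P {ω | X ⊆ coverSet r ω} = 1 := by
  have hs := h.s_pos
  have hC := zero_lt_one.trans_le h.one_le_C
  have hcs : 0 < c ^ s := by positivity
  have hP1 : P univ = 1 := by simpa using hP ∅ (fun _ => ∅) (fun _ => MeasurableSet.empty)
  have hPprob : IsProbabilityMeasure P := ⟨hP1⟩
  have hnull : ∀ k : ℕ, P {ω | ¬ X ⊆ ⋃ n, ⋃ (_ : k ≤ n), ball (ω n) (r n)} = 0 := by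
    intro k
    set E : ℝ := c ^ s * (C * C ^ s + s * (2 * (C * 2 ^ s))) + 1 + k with hE
    have hw : ∀ w : List ι, P {ω | ¬ cl w ⊆ ⋃ n, ⋃ (_ : k ≤ n), ball (ω n) (r n)} ≤
        ENNReal.ofReal (Real.exp E * Real.exp (-(c ^ s) * rieszEnergy μ s (pt w) (d w))) := by
      intro w
      have hd := h.d_pos w
      set d' := C * d w with hd'
      have hd'0 : 0 < d' := by positivity
      set N := ⌈(c / d') ^ s⌉₊ with hN
      have hsum := sum_measure_ball_ge hs h.upper hc hd'0 (h.pt_mem_attractor w) k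
      have hen := rieszEnergy_scale_le μ (x := pt w) hs hd (t := d')
        (le_mul_of_one_le_left hd.le h.one_le_C)
      have hup := h.upper.real_le (h.pt_mem_attractor w) hd'0
      have hsub : {ω : ℕ → ℝ | ¬ cl w ⊆ ⋃ n, ⋃ (_ : k ≤ n), ball (ω n) (r n)} ⊆
          {ω | ∀ n ∈ Finset.Ico k N, ω n ∈ (ball (pt w) (r n - d'))ᶜ} := by
        intro ω hω n hn hmem
        refine hω fun y hy => ?_
        refine mem_iUnion.2 ⟨n, mem_iUnion.2 ⟨(Finset.mem_Ico.1 hn).1, ?_⟩⟩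
        rw [mem_ball, Real.dist_eq] at hmem ⊢
        have h1 := h.diam w y hy (pt w) (h.pt_mem w)
        have h2 := abs_sub_le y (pt w) (ω n)
        rw [abs_sub_comm (pt w) (ω n)] at h2
        linarith
      refine (measure_mono hsub).trans ?_
      rw [hP _ (fun n => (ball (pt w) (r n - d'))ᶜ) fun n => measurableSet_ball.compl]
      have hterm : ∀ n, μ (ball (pt w) (r n - d'))ᶜ ≤
          ENNReal.ofReal (Real.exp (-μ.real (ball (pt w) (r n - d')))) := by
        intro n
        rw [← ofReal_measureReal, probReal_compl_eq_one_sub measurableSet_ball]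
        refine ENNReal.ofReal_le_ofReal ?_
        have := Real.add_one_le_exp (-μ.real (ball (pt w) (r n - d')))
        linarith
      refine (Finset.prod_le_prod' fun n _ => hterm n).trans ?_
      rw [← ENNReal.ofReal_prod_of_nonneg fun n _ => (Real.exp_pos _).le, ← Real.exp_sum,
        ← Real.exp_add]
      refine ENNReal.ofReal_le_ofReal (Real.exp_le_exp.2 ?_)
      simp only [← hr] at hsum
      rw [Finset.sum_neg_distrib]
      have h3 : d w ^ (-s) * μ.real (closedBall (pt w) d') ≤ C * C ^ s := by
        calc _ ≤ d w ^ (-s) * (C * d' ^ s) := by gcongr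
          _ = _ := by
            rw [hd', Real.mul_rpow hC.le hd.le, Real.rpow_neg hd.le]
            have : d w ^ s ≠ 0 := (Real.rpow_pos_of_pos hd s).ne'
            field_simp
      have h4 : rieszEnergy μ s (pt w) (d w) - C * C ^ s ≤ rieszEnergy μ s (pt w) d' := by
        linarith
      have h5 := mul_le_mul_of_nonneg_left h4 hcs.le
      rw [hE]
      linarith
    have hm : ∀ m : ℕ, P {ω | ¬ X ⊆ ⋃ n, ⋃ (_ : k ≤ n), ball (ω n) (r n)} ≤
        ENNReal.ofReal (Real.exp E * ∑ w : Fin m → ι, Real.exp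
          (-(c ^ s) * rieszEnergy μ s (pt (List.ofFn w)) (d (List.ofFn w)))) := by
      intro m
      have hsub : {ω : ℕ → ℝ | ¬ X ⊆ ⋃ n, ⋃ (_ : k ≤ n), ball (ω n) (r n)} ⊆
          ⋃ w : Fin m → ι, {ω | ¬ cl (List.ofFn w) ⊆ ⋃ n, ⋃ (_ : k ≤ n), ball (ω n) (r n)} := by
        intro ω hω
        by_contra hcon
        simp only [mem_iUnion, Set.mem_ofPred_eq, not_exists, not_not] at hcon
        refine hω fun x hx => ?_
        obtain ⟨w, hwm, hxw⟩ := h.cover m x hx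
        subst hwm
        have := hcon w.get
        rw [List.ofFn_get] at this
        exact this hxw
      refine (measure_mono hsub).trans ((measure_iUnion_fintype_le P _).trans ?_)
      rw [Finset.mul_sum, ENNReal.ofReal_sum_of_nonneg fun w _ => by positivity]
      exact Finset.sum_le_sum fun w _ => hw _
    have hlim := (ENNReal.tendsto_ofReal (hZ.const_mul (Real.exp E)))
    rw [mul_zero, ENNReal.ofReal_zero] at hlim
    exact le_antisymm (ge_of_tendsto' hlim hm) zero_le
  have hbad : P {ω | ¬ X ⊆ coverSet r ω} = 0 := by
    refine measure_mono_null ?_ (measure_iUnion_null hnull)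
    intro ω hω
    by_contra hcon
    simp only [mem_iUnion, Set.mem_ofPred_eq, not_exists, not_not] at hcon
    exact hω (subset_iInter hcon)
  refine le_antisymm prob_le_one ?_
  calc 1 = P univ := hP1.symm
    _ ≤ P ({ω | X ⊆ coverSet r ω} ∪ {ω | ¬ X ⊆ coverSet r ω}) :=
        measure_mono fun ω _ => em (X ⊆ coverSet r ω)
    _ ≤ _ := measure_union_le _ _
    _ = _ := by rw [hbad, add_zero]

end CodedMeasure

lemma tendsto_neg_log_nhdsGT_zero : Tendsto (fun t => -Real.log t) (𝓝[>] 0) atTop :=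
  tendsto_neg_atBot_atTop.comp Real.tendsto_log_nhdsGT_zero

lemma avgA_eq {μ : Measure ℝ} [IsProbabilityMeasure μ] {s : ℝ} (hs : 0 < s) (x : ℝ) :
    ∀ᶠ t in 𝓝[>] (0:ℝ), 0 < -Real.log t ∧
      avgA μ s x t = (rieszEnergy μ s x t - rieszEnergy μ s x 1) / s / (-Real.log t) := by
  filter_upwards [tendsto_neg_log_nhdsGT_zero.eventually_gt_atTop 0, Ioo_mem_nhdsGT one_pos]
    with t h1 h2
  refine ⟨h1, ?_⟩
  rw [avgA, integral_ball_eq_rieszEnergy μ hs h2.1 h2.2.le, one_div, div_eq_inv_mul _ (-Real.log t)]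

lemma eventually_rieszEnergy_le {μ : Measure ℝ} [IsProbabilityMeasure μ] {s : ℝ} (hs : 0 < s)
    {x α η : ℝ} (hα : 0 < α) (h : upperAvg μ s x = α) (hη : 0 < η) :
    ∀ᶠ t in 𝓝[>] (0:ℝ), rieszEnergy μ s x t ≤ (s * α + η) * (-Real.log t) := by
  have hbdd : IsBoundedUnder (· ≤ ·) (𝓝[>] (0:ℝ)) fun t => avgA μ s x t := by
    by_contra hcon
    have hempty : {a | ∀ᶠ t in 𝓝[>] (0:ℝ), avgA μ s x t ≤ a} = ∅ := by
      refine eq_empty_of_forall_notMem fun a ha => hcon ⟨a, ?_⟩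
      simpa using ha
    rw [upperAvg, limsup_eq, hempty, Real.sInf_empty] at h
    exact hα.ne h
  have hlt : limsup (fun t => avgA μ s x t) (𝓝[>] (0:ℝ)) < α + η / (2 * s) := by
    change upperAvg μ s x < _
    rw [h]; linarith [show 0 < η / (2 * s) by positivity]
  filter_upwards [eventually_lt_of_limsup_lt hlt hbdd, avgA_eq (μ := μ) hs x,
    tendsto_neg_log_nhdsGT_zero.eventually_ge_atTop (2 * rieszEnergy μ s x 1 / η)] with t h1 h2 h3
  rw [h2.2, div_lt_iff₀ h2.1, div_lt_iff₀ hs] at h1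
  rw [div_le_iff₀ hη] at h3
  have : (α + η / (2 * s)) * -Real.log t * s = (s * α + η / 2) * -Real.log t := by field_simp
  linarith

lemma avg_eq_of_tendsto {μ : Measure ℝ} [IsProbabilityMeasure μ] {s : ℝ} (hs : 0 < s)
    {x β : ℝ} (h : Tendsto (fun t => rieszEnergy μ s x t / (-Real.log t)) (𝓝[>] 0) (𝓝 β)) :
    upperAvg μ s x = β / s ∧ lowerAvg μ s x = β / s := by
  have h1 : Tendsto (fun t => rieszEnergy μ s x t / (-Real.log t) / s
      - rieszEnergy μ s x 1 / s / (-Real.log t)) (𝓝[>] 0) (𝓝 (β / s - 0)) :=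
    (h.div_const s).sub (tendsto_const_nhds.div_atTop tendsto_neg_log_nhdsGT_zero)
  rw [sub_zero] at h1
  have h2 : Tendsto (fun t => avgA μ s x t) (𝓝[>] 0) (𝓝 (β / s)) := by
    refine h1.congr' ?_
    filter_upwards [avgA_eq (μ := μ) hs x] with t ht
    rw [ht.2]
    ring
  exact ⟨h2.limsup_eq, h2.liminf_eq⟩

namespace CodedMeasure

variable {ι : Type} {X : Set ℝ} {μ : Measure ℝ} {s : ℝ} {pt : List ι → ℝ} {cl : List ι → Set ℝ}
  {d : List ι → ℝ} {C θ κ D : ℝ}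

lemma ediam_cl_le (h : CodedMeasure X μ s pt cl d C θ κ D) (w : List ι) :
    Metric.ediam (cl w) ≤ ENNReal.ofReal (C * d w) := by
  refine Metric.ediam_le fun x hx y hy => ?_
  rw [edist_dist, Real.dist_eq]
  exact ENNReal.ofReal_le_ofReal (h.diam w x hx y hy)

lemma dimH_le_of_energy_le [Fintype ι] [IsProbabilityMeasure μ]
    (h : CodedMeasure X μ s pt cl d C θ κ D) {q β t₀ : ℝ} (hq : 0 < q) (hβ : 0 < β) (ht₀ : 0 < t₀)
    (hZ : Tendsto (fun m => ∑ w : Fin m → ι, Real.exp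
      (-q * rieszEnergy μ s (pt (List.ofFn w)) (d (List.ofFn w)))) atTop (𝓝 0)) :
    dimH {x ∈ X | ∀ t, 0 < t → t < t₀ → rieszEnergy μ s x t ≤ β * (-Real.log t)} ≤
      ENNReal.ofReal (q * β) := by
  classical
  set Y := {x ∈ X | ∀ t, 0 < t → t < t₀ → rieszEnergy μ s x t ≤ β * (-Real.log t)}
  have hC := zero_lt_one.trans_le h.one_le_C
  have hσ : 0 < q * β := by positivity
  have hpow := tendsto_pow_atTop_nhds_zero_of_lt_one h.θ_pos.le h.θ_lt
  set U : ∀ m : ℕ, (Fin m → ι) → Set ℝ := fun m w =>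
    if (cl (List.ofFn w) ∩ Y).Nonempty then cl (List.ofFn w) else ∅ with hU
  have hmain : μH[q * β] Y ≤ liminf (fun m => ∑ w, Metric.ediam (U m w) ^ (q * β)) atTop := by
    refine Measure.hausdorffMeasure_le_liminf_sum (q * β) Y
      (fun m : ℕ => ENNReal.ofReal (C * θ ^ m)) ?_ U ?_ ?_
    · have := ENNReal.tendsto_ofReal (hpow.const_mul C)
      rwa [mul_zero, ENNReal.ofReal_zero] at this
    · refine Eventually.of_forall fun m w => ?_
      simp only [hU]
      split_ifs
      · refine (h.ediam_cl_le _).trans (ENNReal.ofReal_le_ofReal ?_)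
        have := h.d_le (List.ofFn w)
        rw [List.length_ofFn] at this
        gcongr
      · simp
    · refine Eventually.of_forall fun m x hx => ?_
      obtain ⟨w, hwm, hxw⟩ := h.cover m x hx.1
      subst hwm
      refine mem_iUnion.2 ⟨w.get, ?_⟩
      simp only [hU, List.ofFn_get]
      rwa [if_pos ⟨x, hxw, hx⟩]
  have hlim := ENNReal.tendsto_ofReal (hZ.const_mul (C ^ (q * β) * Real.exp (q * D)))
  rw [mul_zero, ENNReal.ofReal_zero] at hlim
  have hle : ∀ᶠ m in atTop, ∑ w, Metric.ediam (U m w) ^ (q * β) ≤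
      ENNReal.ofReal (C ^ (q * β) * Real.exp (q * D) * ∑ w : Fin m → ι, Real.exp
      (-q * rieszEnergy μ s (pt (List.ofFn w)) (d (List.ofFn w)))) := by
    filter_upwards [hpow.eventually_lt_const ht₀] with m hm
    rw [Finset.mul_sum, ENNReal.ofReal_sum_of_nonneg fun w _ => by positivity]
    refine Finset.sum_le_sum fun w _ => ?_
    by_cases hne : (cl (List.ofFn w) ∩ Y).Nonempty
    · obtain ⟨x, hxw, hxX, hxY⟩ := hne
      have hd := h.d_pos (List.ofFn w)
      have hdle := h.d_le (List.ofFn w)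
      rw [List.length_ofFn] at hdle
      have h1 := hxY _ hd (hdle.trans_lt hm)
      have h2 := (abs_le.1 (h.energy _ x hxw)).1
      simp only [hU]
      rw [if_pos ⟨x, hxw, hxX, hxY⟩]
      refine (ENNReal.rpow_le_rpow (h.ediam_cl_le _) hσ.le).trans ?_
      rw [ENNReal.ofReal_rpow_of_nonneg (by positivity) hσ.le]
      refine ENNReal.ofReal_le_ofReal ?_
      rw [Real.mul_rpow hC.le hd.le, mul_assoc, ← Real.exp_add]
      gcongr
      rw [Real.rpow_def_of_pos hd]
      refine Real.exp_le_exp.2 ?_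
      have := mul_le_mul_of_nonneg_left (h2.trans' (by linarith) : -D ≤ _) hq.le
      nlinarith
    · simp only [hU]
      rw [if_neg hne, Metric.ediam_empty, ENNReal.zero_rpow_of_pos hσ]
      exact zero_le
  have hzero : μH[q * β] Y = 0 := by
    refine le_antisymm (hmain.trans ?_) zero_le
    exact (liminf_le_liminf hle).trans hlim.liminf_eq.le
  refine dimH_le_of_hausdorffMeasure_ne_top (d := ⟨q * β, hσ.le⟩) ?_ |>.trans ?_
  · change μH[q * β] Y ≠ ⊤
    rw [hzero]; exact ENNReal.zero_ne_top
  · rw [ENNReal.ofReal, Real.toNNReal_of_nonneg hσ.le]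
    exact le_rfl

/-- Upper bound for the multifractal spectrum of the average density. -/
lemma dimH_avg_le [Fintype ι] [IsProbabilityMeasure μ]
    (h : CodedMeasure X μ s pt cl d C θ κ D) {q α : ℝ} (hq : 0 < q) (hα : 0 < α)
    (hZ : Tendsto (fun m => ∑ w : Fin m → ι, Real.exp
      (-q * rieszEnergy μ s (pt (List.ofFn w)) (d (List.ofFn w)))) atTop (𝓝 0)) :
    dimH {x ∈ X | upperAvg μ s x = α ∧ lowerAvg μ s x = α} ≤ ENNReal.ofReal (q * (s * α)) := by
  have hs := h.s_pos
  have key : ∀ η : ℝ, 0 < η → dimH {x ∈ X | upperAvg μ s x = α ∧ lowerAvg μ s x = α} ≤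
      ENNReal.ofReal (q * (s * α + η)) := by
    intro η hη
    have hsub : {x ∈ X | upperAvg μ s x = α ∧ lowerAvg μ s x = α} ⊆ ⋃ M : ℕ,
        {x ∈ X | ∀ t, 0 < t → t < 1 / ((M : ℝ) + 1) →
          rieszEnergy μ s x t ≤ (s * α + η) * (-Real.log t)} := by
      rintro x ⟨hxX, hxu, -⟩
      obtain ⟨u, hu, hsub⟩ := mem_nhdsGT_iff_exists_Ioo_subset.1
        (eventually_rieszEnergy_le (μ := μ) hs hα hxu hη)
      obtain ⟨M, hM⟩ := exists_nat_one_div_lt (mem_Ioi.1 hu)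
      exact mem_iUnion.2 ⟨M, hxX, fun t h0 h1 => hsub ⟨h0, h1.trans hM⟩⟩
    refine (dimH_mono hsub).trans ?_
    rw [dimH_iUnion]
    exact iSup_le fun M => h.dimH_le_of_energy_le hq (by positivity) (by positivity) hZ
  have hlim : Tendsto (fun η => ENNReal.ofReal (q * (s * α + η))) (𝓝[>] 0)
      (𝓝 (ENNReal.ofReal (q * (s * α + 0)))) := by
    refine ENNReal.tendsto_ofReal (Tendsto.mono_left ?_ nhdsWithin_le_nhds)
    exact Continuous.tendsto (by fun_prop) 0
  rw [add_zero] at hlim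
  exact ge_of_tendsto hlim (eventually_mem_nhdsWithin.mono key)

end CodedMeasure

/-- The initial segment of length `k` of an infinite word. -/
def prefixWord {ι : Type} (ω : ℕ → ι) (k : ℕ) : List ι := (List.range k).map ω

section PrefixWord

variable {ι : Type}

@[simp] lemma length_prefixWord (ω : ℕ → ι) (k : ℕ) : (prefixWord ω k).length = k := by
  simp [prefixWord]

@[simp] lemma prefixWord_zero (ω : ℕ → ι) : prefixWord ω 0 = [] := rfl

lemma prefixWord_succ (ω : ℕ → ι) (k : ℕ) : prefixWord ω (k + 1) = prefixWord ω k ++ [ω k] := by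
  simp [prefixWord, List.range_succ]

lemma prefixWord_add (ω : ℕ → ι) (j k : ℕ) :
    prefixWord ω (j + k) = prefixWord ω j ++ prefixWord (fun n => ω (j + n)) k := by
  simp [prefixWord, List.range_add, Function.comp_def]

lemma eq_of_prefixWord_eq {ω ω' : ℕ → ι} {k : ℕ} (h : prefixWord ω k = prefixWord ω' k) :
    ∀ i < k, ω i = ω' i := fun i hi =>
  List.map_inj_left.1 h i (List.mem_range.2 hi)

lemma abs_le_of_almost_additive [Fintype ι] {ψ : List ι → ℝ} {D : ℝ}
    (h : ∀ u v, |ψ (u ++ v) - ψ u - ψ v| ≤ D) (w : List ι) :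
    |ψ w| ≤ w.length * (∑ i, |ψ [i]| + D) + D := by
  induction w with
  | nil =>
    have := h [] []
    rw [List.append_nil, sub_self, zero_sub, abs_neg] at this
    simpa using this
  | cons i w ih =>
    have h1 := h [i] w
    have h2 : |ψ [i]| ≤ ∑ i, |ψ [i]| :=
      Finset.single_le_sum (f := fun i => |ψ [i]|) (fun i _ => abs_nonneg _) (Finset.mem_univ i)
    rw [List.singleton_append] at h1
    rw [List.length_cons]
    push_cast
    have h3 := abs_add_le (ψ (i :: w) - ψ [i] - ψ w) (ψ [i] + ψ w)
    have h4 := abs_add_le (ψ [i]) (ψ w)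
    rw [show ψ (i :: w) - ψ [i] - ψ w + (ψ [i] + ψ w) = ψ (i :: w) by ring] at h3
    linarith

lemma abs_sub_sum_blocks_le {ψ : List ι → ℝ} {D : ℝ} (h : ∀ u v, |ψ (u ++ v) - ψ u - ψ v| ≤ D)
    (ω : ℕ → ι) (m n : ℕ) :
    |ψ (prefixWord ω (n * m)) -
      ∑ j ∈ Finset.range n, ψ (prefixWord (fun i => ω (j * m + i)) m)| ≤ (n + 1) * D := by
  induction n with
  | zero =>
    have := h [] []
    rw [List.append_nil, sub_self, zero_sub, abs_neg] at this
    simpa using this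
  | succ n ih =>
    rw [Finset.sum_range_succ, Nat.succ_mul, prefixWord_add]
    have h1 := h (prefixWord ω (n * m)) (prefixWord (fun i => ω (n * m + i)) m)
    rw [abs_le] at *
    push_cast
    constructor <;> linarith

lemma tendsto_div_div_atTop {m : ℕ} (hm : 0 < m) :
    Tendsto (fun k : ℕ => ((k / m : ℕ) : ℝ) / k) atTop (𝓝 (1 / m)) := by
  have h := (tendsto_nat_floor_mul_div_atTop (R := ℝ) (a := 1 / m) (by positivity)).comp
    tendsto_natCast_atTop_atTop
  refine h.congr fun k => ?_
  simp only [Function.comp]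
  rw [one_div_mul_eq_div, Nat.floor_div_eq_div]

lemma eventually_abs_sub_le_of_blocks [Fintype ι] {ψ : List ι → ℝ} {D : ℝ}
    (h : ∀ u v, |ψ (u ++ v) - ψ u - ψ v| ≤ D) {ω : ℕ → ι} {m : ℕ} (hm : 0 < m) {e : ℝ}
    (he : Tendsto (fun n : ℕ => (∑ j ∈ Finset.range n,
      ψ (prefixWord (fun i => ω (j * m + i)) m)) / n) atTop (𝓝 e)) :
    ∀ᶠ k : ℕ in atTop, |ψ (prefixWord ω k) / k - e / m| ≤ (D + 1) / m := by
  have hD : 0 ≤ D := (abs_nonneg _).trans (h [] [])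
  set B := m * (∑ i, |ψ [i]| + D) + D
  set S : ℕ → ℝ := fun n => ∑ j ∈ Finset.range n, ψ (prefixWord (fun i => ω (j * m + i)) m)
  have hdiv : Tendsto (fun k : ℕ => k / m) atTop atTop := Nat.tendsto_div_const_atTop hm.ne'
  have h1 : Tendsto (fun k : ℕ => S (k / m) / k) atTop (𝓝 (e / m)) := by
    have := (he.comp hdiv).mul (tendsto_div_div_atTop hm)
    rw [mul_one_div] at this
    refine this.congr' ?_
    filter_upwards [hdiv.eventually_gt_atTop 0] with k hk
    have : ((k / m : ℕ) : ℝ) ≠ 0 := by positivity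
    simp only [Function.comp]
    field_simp
    rfl
  have h2 : Tendsto (fun k : ℕ => ((k / m : ℕ) : ℝ) / k * D + (2 * D + B) / k) atTop
      (𝓝 (1 / m * D + 0)) :=
    ((tendsto_div_div_atTop hm).mul_const D).add
      (tendsto_const_nhds.div_atTop tendsto_natCast_atTop_atTop)
  have h3 := h2.add (tendsto_iff_dist_tendsto_zero.1 h1)
  have hm' : (0:ℝ) < m := by exact_mod_cast hm
  have hlt : 1 / (m:ℝ) * D + 0 + 0 < (D + 1) / m := by
    rw [add_zero, add_zero, one_div_mul_eq_div]; gcongr; linarith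
  filter_upwards [h3.eventually_lt_const hlt, eventually_gt_atTop 0] with k hk hk0
  have hk0' : (0:ℝ) < k := by exact_mod_cast hk0
  have h4 := abs_sub_sum_blocks_le h ω m (k / m)
  have h5 := h (prefixWord ω (k / m * m)) (prefixWord (fun i => ω (k / m * m + i)) (k % m))
  rw [← prefixWord_add, Nat.div_add_mod' k m] at h5
  have h6 := abs_le_of_almost_additive h (prefixWord (fun i => ω (k / m * m + i)) (k % m))
  rw [length_prefixWord] at h6
  have h7 : ((k % m : ℕ) : ℝ) * (∑ i, |ψ [i]| + D) ≤ m * (∑ i, |ψ [i]| + D) := by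
    have : 0 ≤ ∑ i, |ψ [i]| := Finset.sum_nonneg fun i _ => abs_nonneg _
    have h8 : ((k % m : ℕ) : ℝ) ≤ m := by exact_mod_cast (Nat.mod_lt k hm).le
    gcongr
  have h9 : |ψ (prefixWord ω k) - S (k / m)| ≤ ((k / m : ℕ) : ℝ) * D + (2 * D + B) := by
    rw [abs_le] at h4 h5 h6 ⊢
    constructor <;> simp only [S, B] <;> linarith
  have h10 : |ψ (prefixWord ω k) / k - S (k / m) / k| ≤
      ((k / m : ℕ) : ℝ) / k * D + (2 * D + B) / k := by
    rw [← sub_div, abs_div, abs_of_pos hk0', div_le_iff₀ hk0']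
    refine h9.trans (le_of_eq ?_)
    field_simp
  rw [Real.dist_eq] at hk
  exact (abs_sub_le _ (S (k / m) / k) _).trans (by linarith)

lemma exists_tendsto_of_blocks [Fintype ι] {ψ : List ι → ℝ} {D : ℝ}
    (h : ∀ u v, |ψ (u ++ v) - ψ u - ψ v| ≤ D) {e : ℕ → ℝ} {Ω : Set (ℕ → ι)} (hΩ : Ω.Nonempty)
    (he : ∀ ω ∈ Ω, ∀ m, 0 < m → Tendsto (fun n : ℕ => (∑ j ∈ Finset.range n,
      ψ (prefixWord (fun i => ω (j * m + i)) m)) / n) atTop (𝓝 (e m))) :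
    ∃ ℓ, ∀ ω ∈ Ω, Tendsto (fun k : ℕ => ψ (prefixWord ω k) / k) atTop (𝓝 ℓ) := by
  have hD : 0 ≤ D := (abs_nonneg _).trans (h [] [])
  have key : ∀ η > 0, ∃ c, ∀ ω ∈ Ω, ∀ᶠ k : ℕ in atTop, |ψ (prefixWord ω k) / k - c| ≤ η := by
    intro η hη
    obtain ⟨m, hm⟩ := exists_nat_gt ((D + 1) / η)
    have hm0' : (0:ℝ) < m := lt_of_le_of_lt (by positivity) hm
    have hm0 : 0 < m := by exact_mod_cast hm0'
    refine ⟨e m / m, fun ω hω => ?_⟩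
    filter_upwards [eventually_abs_sub_le_of_blocks h hm0 (he ω hω m hm0)] with k hk
    refine hk.trans ?_
    rw [div_le_iff₀ hm0']
    rw [div_lt_iff₀ hη] at hm
    linarith
  obtain ⟨ω₀, hω₀⟩ := hΩ
  have hcau : CauchySeq fun k : ℕ => ψ (prefixWord ω₀ k) / k := by
    refine Metric.cauchySeq_iff.2 fun η hη => ?_
    obtain ⟨c, hc⟩ := key (η / 3) (by positivity)
    obtain ⟨N, hN⟩ := eventually_atTop.1 (hc ω₀ hω₀)
    refine ⟨N, fun a ha b hb => ?_⟩
    rw [Real.dist_eq]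
    have h1 := abs_le.1 (hN a ha)
    have h2 := abs_le.1 (hN b hb)
    rw [abs_lt]
    constructor <;> linarith
  obtain ⟨ℓ, hℓ⟩ := cauchySeq_tendsto_of_complete hcau
  refine ⟨ℓ, fun ω hω => Metric.tendsto_atTop.2 fun η hη => ?_⟩
  obtain ⟨c, hc⟩ := key (η / 4) (by positivity)
  have h1 : |ℓ - c| ≤ η / 4 := by
    have : Tendsto (fun k : ℕ => |ψ (prefixWord ω₀ k) / k - c|) atTop (𝓝 |ℓ - c|) :=
      (hℓ.sub_const c).abs
    exact le_of_tendsto this (hc ω₀ hω₀)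
  obtain ⟨N, hN⟩ := eventually_atTop.1 (hc ω hω)
  refine ⟨N, fun k hk => ?_⟩
  have h2 := abs_le.1 (hN k hk)
  have h3 := abs_le.1 h1
  rw [Real.dist_eq, abs_lt]
  constructor <;> linarith

section Measure

variable [MeasurableSpace ι]

lemma measurePreserving_shift (p : Measure ι) [IsProbabilityMeasure p] (a : ℕ) :
    MeasurePreserving (fun (ω : ℕ → ι) n => ω (a + n)) (Measure.infinitePi fun _ => p)
      (Measure.infinitePi fun _ => p) := by
  have hmeas : Measurable fun (ω : ℕ → ι) n => ω (a + n) :=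
    measurable_pi_iff.2 fun n => measurable_pi_apply _
  refine ⟨hmeas, Measure.eq_infinitePi _ fun S t ht => ?_⟩
  rw [Measure.map_apply hmeas (MeasurableSet.pi S.countable_toSet fun i _ => ht i)]
  have : (fun (ω : ℕ → ι) n => ω (a + n)) ⁻¹' Set.pi S t =
      Set.pi (S.map (addLeftEmbedding a)) fun n => t (n - a) := by
    ext ω
    simp [Set.mem_pi]
  rw [this, Measure.infinitePi_pi _ fun i _ => ht _]
  simp

variable [Fintype ι] [DiscreteMeasurableSpace ι]

lemma measurable_comp_prefixWord {β : Type*} [MeasurableSpace β] (ψ : List ι → β) (k : ℕ) :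
    Measurable fun ω : ℕ → ι => ψ (prefixWord ω k) := by
  have h1 : Measurable fun (ω : ℕ → ι) (i : Fin k) => ω i :=
    measurable_pi_iff.2 fun n => measurable_pi_apply _
  have h2 : Measurable fun w : Fin k → ι => ψ (List.ofFn w) := .of_discrete
  convert h2.comp h1 using 2 with ω
  simp only [Function.comp]
  congr 1
  refine List.ext_getElem (by simp) fun i h1 h2 => ?_
  simp [prefixWord]

lemma indepFun_blocks (p : Measure ι) [IsProbabilityMeasure p] (ψ : List ι → ℝ) (m : ℕ)
    {a b : ℕ} (hab : a + m ≤ b) :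
    ProbabilityTheory.IndepFun (fun ω : ℕ → ι => ψ (prefixWord (fun i => ω (a + i)) m))
      (fun ω : ℕ → ι => ψ (prefixWord (fun i => ω (b + i)) m)) (Measure.infinitePi fun _ => p) := by
  have hind := ProbabilityTheory.iIndepFun_infinitePi (P := fun _ : ℕ => p)
    (X := fun _ : ℕ => (id : ι → ι)) fun _ => measurable_id
  have hdisj : Disjoint (Finset.Ico a (a + m)) (Finset.Ico b (b + m)) := by
    refine Finset.disjoint_left.2 fun x hx hx' => ?_
    rw [Finset.mem_Ico] at hx hx'
    omega
  have h := hind.indepFun_finset _ _ hdisj fun i => measurable_pi_apply i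
  have hF : ∀ c, ∃ F : (Finset.Ico c (c + m) → ι) → ℝ, ∀ ω : ℕ → ι,
      ψ (prefixWord (fun i => ω (c + i)) m) = F fun i => ω i := by
    intro c
    refine ⟨fun z => ψ (List.ofFn fun i : Fin m =>
      z ⟨c + i, Finset.mem_Ico.2 ⟨by omega, by omega⟩⟩), fun ω => ?_⟩
    congr 1
    refine List.ext_getElem (by simp) fun i h1 h2 => ?_
    simp [prefixWord]
  obtain ⟨F, hF1⟩ := hF a
  obtain ⟨G, hG1⟩ := hF b
  have hFG := h.comp (φ := F) (ψ := G) .of_discrete .of_discrete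
  simp only [Function.comp_def, id] at hFG
  simpa only [hF1, hG1] using hFG

lemma ae_tendsto_blocks (p : Measure ι) [IsProbabilityMeasure p] (ψ : List ι → ℝ) {m : ℕ} :
    ∀ᵐ ω ∂(Measure.infinitePi fun _ : ℕ => p), Tendsto (fun n : ℕ => (∑ j ∈ Finset.range n,
      ψ (prefixWord (fun i => ω (j * m + i)) m)) / n) atTop
      (𝓝 (∫ ω, ψ (prefixWord ω m) ∂(Measure.infinitePi fun _ : ℕ => p))) := by
  have hmeas := measurable_comp_prefixWord ψ m
  have h := ProbabilityTheory.strong_law_ae_real (μ := Measure.infinitePi fun _ : ℕ => p)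
    (fun j ω => ψ (prefixWord (fun i => ω (j * m + i)) m)) ?_ ?_ ?_
  · simpa using h
  · simp only [zero_mul, zero_add]
    refine Integrable.of_bound hmeas.aestronglyMeasurable
      (∑ w : Fin m → ι, |ψ (List.ofFn w)|) (ae_of_all _ fun ω => ?_)
    have : prefixWord ω m = List.ofFn fun i : Fin m => ω i := by
      refine List.ext_getElem (by simp) fun i h1 h2 => ?_
      simp [prefixWord]
    rw [this, Real.norm_eq_abs]
    exact Finset.single_le_sum (f := fun w : Fin m → ι => |ψ (List.ofFn w)|)
      (fun _ _ => abs_nonneg _) (Finset.mem_univ _)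
  · intro i j hij
    rcases lt_or_gt_of_ne hij with hij | hij
    · exact indepFun_blocks p ψ m (by nlinarith)
    · exact (indepFun_blocks p ψ m (by nlinarith)).symm
  · intro j
    simp only [zero_mul, zero_add]
    have h1 := (measurePreserving_shift p (j * m))
    refine ⟨(hmeas.comp h1.measurable).aemeasurable, hmeas.aemeasurable, ?_⟩
    change Measure.map ((fun ω => ψ (prefixWord ω m)) ∘ fun (ω : ℕ → ι) n => ω (j * m + n)) _ = _
    rw [← Measure.map_map hmeas h1.measurable, h1.map_eq]

/-- Almost additive functions of words grow linearly along almost every infinite word. -/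
lemma exists_ae_tendsto_of_almost_additive (p : Measure ι) [IsProbabilityMeasure p]
    {ψ : List ι → ℝ} {D : ℝ} (h : ∀ u v, |ψ (u ++ v) - ψ u - ψ v| ≤ D) :
    ∃ ℓ, ∀ᵐ ω ∂(Measure.infinitePi fun _ : ℕ => p),
      Tendsto (fun k : ℕ => ψ (prefixWord ω k) / k) atTop (𝓝 ℓ) := by
  have hae := ae_all_iff.2 fun m : ℕ => ae_tendsto_blocks p ψ (m := m)
  obtain ⟨ℓ, hℓ⟩ := exists_tendsto_of_blocks h hae.exists fun ω hω m _ => hω m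
  exact ⟨ℓ, hae.mono hℓ⟩

end Measure

end PrefixWord

lemma tendsto_shift_div {A : ℕ → ℝ} {a : ℝ} (h : Tendsto (fun k : ℕ => A k / k) atTop (𝓝 a)) :
    Tendsto (fun k : ℕ => A (k + 1) / k) atTop (𝓝 a) := by
  have h1 := (h.comp (tendsto_add_atTop_nat 1)).mul
    (tendsto_const_nhds.add (tendsto_one_div_atTop_nhds_zero_nat (𝕜 := ℝ)) :
      Tendsto (fun k : ℕ => (1:ℝ) + 1 / k) atTop _)
  rw [add_zero, mul_one] at h1
  refine h1.congr' ?_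
  filter_upwards [eventually_gt_atTop 0] with k hk
  have : (k:ℝ) ≠ 0 := by positivity
  simp only [Function.comp]
  push_cast
  field_simp

lemma tendsto_const_add_div {A : ℕ → ℝ} {a : ℝ} (h : Tendsto (fun k : ℕ => A k / k) atTop (𝓝 a))
    (D : ℝ) : Tendsto (fun k : ℕ => (A k + D) / k) atTop (𝓝 a) := by
  have := h.add ((tendsto_const_nhds (x := D)).div_atTop tendsto_natCast_atTop_atTop)
  rw [add_zero] at this
  exact this.congr fun k => (add_div _ _ _).symm

lemma tendsto_div_of_div {A L : ℕ → ℝ} {a l : ℝ}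
    (hA : Tendsto (fun k : ℕ => A k / k) atTop (𝓝 a))
    (hL : Tendsto (fun k : ℕ => L k / k) atTop (𝓝 l)) (hl : l ≠ 0) :
    Tendsto (fun k => A k / L k) atTop (𝓝 (a / l)) := by
  refine (hA.div hL hl).congr' ?_
  filter_upwards [eventually_gt_atTop 0] with k hk
  have : (k:ℝ) ≠ 0 := by positivity
  simp only [Pi.div_apply]
  exact div_div_div_cancel_right₀ this _ _

lemma eventually_exists_scale {δ : ℕ → ℝ} (hpos : ∀ k, 0 < δ k)
    (hδ : Tendsto δ atTop (𝓝 0)) (N : ℕ) :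
    ∀ᶠ t in 𝓝[>] (0:ℝ), ∃ k, N ≤ k ∧ δ (k + 1) < t ∧ t ≤ δ k := by
  classical
  have hev : ∀ᶠ t in 𝓝[>] (0:ℝ), ∀ k ∈ Finset.range (N + 1), t < δ k :=
    (Filter.eventually_all_finset _).2 fun k _ =>
      mem_of_superset (Ioo_mem_nhdsGT (hpos k)) fun t ht => ht.2
  filter_upwards [hev, self_mem_nhdsWithin] with t ht ht0
  have hex : ∃ k, δ k < t := (hδ.eventually_lt_const (mem_Ioi.1 ht0)).exists
  have hlt : N < Nat.find hex := by
    by_contra! hle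
    exact (Nat.find_spec hex).not_gt (ht _ (Finset.mem_range.2 (by omega)))
  refine ⟨Nat.find hex - 1, by omega, ?_, ?_⟩
  · rw [Nat.sub_add_cancel (by omega)]
    exact Nat.find_spec hex
  · exact not_lt.1 (Nat.find_min hex (by omega))

/-- Interpolation of the growth of an antitone function from a sequence of scales. -/
lemma tendsto_div_neg_log {F : ℝ → ℝ} (hF : ∀ t t', 0 < t → t ≤ t' → F t' ≤ F t) {δ : ℕ → ℝ}
    (hpos : ∀ k, 0 < δ k) (hδ : Tendsto δ atTop (𝓝 0)) {A : ℕ → ℝ} {D a l : ℝ}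
    (hFA : ∀ k, |F (δ k) - A k| ≤ D) (ha : 0 < a) (hl : 0 < l)
    (hA : Tendsto (fun k : ℕ => A k / k) atTop (𝓝 a))
    (hL : Tendsto (fun k : ℕ => -Real.log (δ k) / k) atTop (𝓝 l)) :
    Tendsto (fun t => F t / (-Real.log t)) (𝓝[>] 0) (𝓝 (a / l)) := by
  have h1 : Tendsto (fun k => (A (k + 1) + D) / -Real.log (δ k)) atTop (𝓝 (a / l)) :=
    tendsto_div_of_div (tendsto_const_add_div (tendsto_shift_div hA) D) hL hl.ne'
  have h2 : Tendsto (fun k => (A k + -D) / -Real.log (δ (k + 1))) atTop (𝓝 (a / l)) :=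
    tendsto_div_of_div (tendsto_const_add_div hA (-D)) (tendsto_shift_div hL) hl.ne'
  have h3 : ∀ᶠ k : ℕ in atTop, 0 < A k + -D := by
    filter_upwards [(tendsto_const_add_div hA (-D)).eventually_const_lt ha,
      eventually_gt_atTop 0] with k hk hk0
    exact (div_pos_iff_of_pos_right (by exact_mod_cast hk0)).1 hk
  have h4 : ∀ᶠ k : ℕ in atTop, 0 < -Real.log (δ k) := by
    filter_upwards [hL.eventually_const_lt hl, eventually_gt_atTop 0] with k hk hk0
    exact (div_pos_iff_of_pos_right (by exact_mod_cast hk0)).1 hk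
  have key : ∀ p : ℕ → Prop, (∀ᶠ k in atTop, p k) → ∀ᶠ t in 𝓝[>] (0:ℝ), ∃ k, p k ∧
      (A k + -D) / -Real.log (δ (k + 1)) ≤ F t / (-Real.log t) ∧
      F t / (-Real.log t) ≤ (A (k + 1) + D) / -Real.log (δ k) := by
    intro p hp
    obtain ⟨N, hN⟩ := eventually_atTop.1 (hp.and (h3.and h4))
    filter_upwards [eventually_exists_scale hpos hδ N, self_mem_nhdsWithin] with t ht ht0
    obtain ⟨k, hNk, hk1, hk2⟩ := ht
    rw [mem_Ioi] at ht0
    obtain ⟨hpk, hk3, hk4⟩ := hN k hNk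
    have h5 := Real.log_le_log ht0 hk2
    have h6 := Real.log_le_log (hpos _) hk1.le
    have h7 := (abs_le.1 (hFA k)).1
    have h8 := (abs_le.1 (hFA (k + 1))).2
    have h9 := hF _ _ ht0 hk2
    have h10 := hF _ _ (hpos _) hk1.le
    refine ⟨k, hpk, ?_, ?_⟩
    · exact div_le_div₀ (by linarith) (by linarith) (by linarith) (by linarith)
    · exact div_le_div₀ (by linarith) (by linarith) (by linarith) (by linarith)
  refine tendsto_order.2 ⟨fun b hb => ?_, fun b hb => ?_⟩
  · filter_upwards [key _ (h2.eventually_const_lt hb)] with t ht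
    obtain ⟨k, hk1, hk2, -⟩ := ht
    exact hk1.trans_le hk2
  · filter_upwards [key _ (h1.eventually_lt_const hb)] with t ht
    obtain ⟨k, hk1, -, hk2⟩ := ht
    exact hk2.trans_lt hk1

namespace CodedMeasure

variable {ι : Type} {X : Set ℝ} {μ : Measure ℝ} {s : ℝ} {pt : List ι → ℝ} {cl : List ι → Set ℝ}
  {d : List ι → ℝ} {C θ κ D : ℝ}

lemma cl_prefixWord_subset (h : CodedMeasure X μ s pt cl d C θ κ D) (ω : ℕ → ι) {j k : ℕ}
    (hjk : j ≤ k) : cl (prefixWord ω k) ⊆ cl (prefixWord ω j) := by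
  obtain ⟨i, rfl⟩ := Nat.exists_eq_add_of_le hjk
  rw [prefixWord_add]
  exact h.cl_append_subset _ _

lemma tendsto_d_prefixWord (h : CodedMeasure X μ s pt cl d C θ κ D) (ω : ℕ → ι) :
    Tendsto (fun k => d (prefixWord ω k)) atTop (𝓝 0) := by
  refine squeeze_zero (fun k => (h.d_pos _).le) (fun k => ?_)
    (tendsto_pow_atTop_nhds_zero_of_lt_one h.θ_pos.le h.θ_lt)
  simpa using h.d_le (prefixWord ω k)

/-- The coding map. -/
lemma exists_coding [Fintype ι] [MeasurableSpace ι] [DiscreteMeasurableSpace ι]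
    (h : CodedMeasure X μ s pt cl d C θ κ D) :
    ∃ π : (ℕ → ι) → ℝ, Measurable π ∧ ∀ ω k, π ω ∈ cl (prefixWord ω k) := by
  have hmem : ∀ (ω : ℕ → ι) (j k : ℕ), j ≤ k → pt (prefixWord ω k) ∈ cl (prefixWord ω j) :=
    fun ω j k hjk => h.cl_prefixWord_subset ω hjk (h.pt_mem _)
  have hcau : ∀ ω : ℕ → ι, ∃ x, Tendsto (fun k => pt (prefixWord ω k)) atTop (𝓝 x) := by
    intro ω
    refine cauchySeq_tendsto_of_complete
      (cauchySeq_of_le_tendsto_0 (fun k => C * d (prefixWord ω k)) (fun n m N hn hm => ?_) ?_)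
    · exact h.diam _ _ (hmem ω N n hn) _ (hmem ω N m hm)
    · simpa using (h.tendsto_d_prefixWord ω).const_mul C
  choose π hπ using hcau
  refine ⟨π, measurable_of_tendsto_metrizable (fun k => measurable_comp_prefixWord pt k)
    (tendsto_pi_nhds.2 hπ), fun ω k => ?_⟩
  refine (h.isCompact_cl _).isClosed.mem_of_tendsto (hπ ω) ?_
  filter_upwards [eventually_ge_atTop k] with j hj using hmem ω k j hj

lemma prefixWord_eq_of_abs_lt (h : CodedMeasure X μ s pt cl d C θ κ D) {π : (ℕ → ι) → ℝ}
    (hπ : ∀ ω k, π ω ∈ cl (prefixWord ω k)) {ω ω' : ℕ → ι} {k : ℕ}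
    (hlt : |π ω - π ω'| < κ * d (prefixWord ω k)) : prefixWord ω k = prefixWord ω' k := by
  have hmem : π ω' ∈ cl (prefixWord ω k) := by
    by_contra hcon
    exact hlt.not_ge (h.sep _ _ (hπ ω k) _ (h.cl_subset _ (hπ ω' k)) hcon)
  by_contra hne
  exact disjoint_left.1 (h.disjoint _ _ (by simp) hne) hmem (hπ ω' k)

/-- A lower bound for the dimension of sets carrying a Bernoulli measure. -/
lemma le_dimH_of_bernoulli [Fintype ι] [MeasurableSpace ι] [DiscreteMeasurableSpace ι]
    [Nonempty ι]
    (h : CodedMeasure X μ s pt cl d C θ κ D) {π : (ℕ → ι) → ℝ} (hπm : Measurable π)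
    (hπ : ∀ ω k, π ω ∈ cl (prefixWord ω k)) (p : Measure ι) [IsProbabilityMeasure p]
    {φ : ι → ℝ} (hφ : ∀ i, p {i} = ENNReal.ofReal (Real.exp (-φ i))) {G : Set (ℕ → ι)} {l η : ℝ}
    (hl : 0 < l) (hη : 0 < η)
    (hG0 : (Measure.infinitePi fun _ : ℕ => p) G ≠ 0)
    (hGφ : ∀ ω ∈ G, Tendsto (fun k : ℕ => (∑ i ∈ Finset.range k, φ (ω i)) / k) atTop (𝓝 η))
    (hGd : ∀ ω ∈ G, Tendsto (fun k : ℕ => -Real.log (d (prefixWord ω k)) / k) atTop (𝓝 l))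
    {E : Set ℝ} (hE : ∀ ω ∈ G, π ω ∈ E) : ENNReal.ofReal (η / l) ≤ dimH E := by
  classical
  set ν := Measure.infinitePi fun _ : ℕ => p with hν
  have hcyl : ∀ (ω : ℕ → ι) k, ν {ω' | prefixWord ω k = prefixWord ω' k} ≤
      ENNReal.ofReal (Real.exp (-∑ i ∈ Finset.range k, φ (ω i))) := by
    intro ω k
    have hsub : {ω' | prefixWord ω k = prefixWord ω' k} ⊆
        Set.pi (Finset.range k) fun i => {ω i} := by
      intro ω' hω' i hi
      rw [Finset.mem_coe, Finset.mem_range] at hi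
      exact (eq_of_prefixWord_eq hω' i hi).symm
    refine (measure_mono hsub).trans_eq ?_
    rw [hν, Measure.infinitePi_pi _ fun i _ => .of_discrete]
    simp only [hφ]
    rw [← ENNReal.ofReal_prod_of_nonneg fun i _ => (Real.exp_pos _).le, ← Real.exp_sum,
      Finset.sum_neg_distrib]
  have hκ := h.κ_pos
  have hd := h.d_pos
  have key : ∀ σ : ℝ, 0 < σ → σ < η / l → ENNReal.ofReal σ ≤ dimH E := by
    intro σ hσ hσl
    rw [lt_div_iff₀ hl] at hσl
    have hev : ∀ ω ∈ G, ∀ᶠ k in atTop, Real.exp (-∑ i ∈ Finset.range k, φ (ω i)) ≤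
        (κ * d (prefixWord ω (k + 1))) ^ σ := by
      intro ω hω
      have h1 := (tendsto_const_add_div (tendsto_shift_div (hGd ω hω)) (-Real.log κ)).const_mul σ
      filter_upwards [h1.eventually_lt (hGφ ω hω) (by linarith), eventually_gt_atTop 0]
        with k h2 hk
      have hk' : (0:ℝ) < k := by exact_mod_cast hk
      rw [mul_div_assoc', div_lt_div_iff_of_pos_right hk'] at h2
      rw [Real.rpow_def_of_pos (mul_pos hκ (hd _)), Real.log_mul hκ.ne' (hd _).ne']
      refine Real.exp_le_exp.2 ?_
      linarith
    set GN : ℕ → Set (ℕ → ι) := fun N => {ω ∈ G | ∀ k, N ≤ k →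
      Real.exp (-∑ i ∈ Finset.range k, φ (ω i)) ≤ (κ * d (prefixWord ω (k + 1))) ^ σ} with hGN
    obtain ⟨N, hN⟩ : ∃ N, ν (GN N) ≠ 0 := by
      by_contra! hcon
      refine hG0 (measure_mono_null ?_ (measure_iUnion_null hcon))
      intro ω hω
      obtain ⟨N, hN⟩ := eventually_atTop.1 (hev ω hω)
      exact mem_iUnion.2 ⟨N, hω, hN⟩
    obtain ⟨w₀, hw₀⟩ := Finite.exists_min fun w : Fin N → ι => d (List.ofFn w)
    have hmin : ∀ ω : ℕ → ι, d (List.ofFn w₀) ≤ d (prefixWord ω N) := by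
      intro ω
      have : prefixWord ω N = List.ofFn fun i : Fin N => ω i := by
        refine List.ext_getElem (by simp) fun i h1 h2 => ?_
        simp [prefixWord]
      rw [this]
      exact hw₀ _
    set m' := (ν.restrict (GN N)).map π with hm'
    have hκd : 0 < κ * d (List.ofFn w₀) := mul_pos hκ (hd _)
    have hle : m' ≤ μH[σ] := by
      refine Measure.le_hausdorffMeasure σ m' (ENNReal.ofReal (κ * d (List.ofFn w₀) / 2))
        (ENNReal.ofReal_pos.2 (by positivity)) fun T hT => ?_
      refine (measure_mono subset_closure).trans ?_
      rw [← Metric.ediam_closure] at hT ⊢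
      have hTtop : Metric.ediam (closure T) ≠ ⊤ := (hT.trans_lt ENNReal.ofReal_lt_top).ne
      rw [hm', Measure.map_apply hπm isClosed_closure.measurableSet,
        Measure.restrict_apply (hπm isClosed_closure.measurableSet)]
      rcases (π ⁻¹' closure T ∩ GN N).eq_empty_or_nonempty with hemp | ⟨ω, hωT, hωN⟩
      · rw [hemp, measure_empty]; exact zero_le
      set ρ := (Metric.ediam (closure T)).toReal with hρ
      have hρ0 : 0 ≤ ρ := ENNReal.toReal_nonneg
      have hρlt : ρ < κ * d (List.ofFn w₀) := by
        have := ENNReal.toReal_le_of_le_ofReal (by positivity) hT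
        linarith
      have hbound : ∀ k, N ≤ k → ρ < κ * d (prefixWord ω k) →
          ν (π ⁻¹' closure T ∩ GN N) ≤ ENNReal.ofReal ((κ * d (prefixWord ω (k + 1))) ^ σ) := by
        intro k hNk hk
        refine (measure_mono ?_).trans ((hcyl ω k).trans (ENNReal.ofReal_le_ofReal (hωN.2 k hNk)))
        intro ω' hω'
        refine h.prefixWord_eq_of_abs_lt hπ (lt_of_le_of_lt ?_ hk)
        have h1 : edist (π ω) (π ω') ≤ Metric.ediam (closure T) :=
          Metric.edist_le_ediam_of_mem hωT hω'.1
        rw [← Real.dist_eq, dist_edist]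
        exact ENNReal.toReal_mono hTtop h1
      have hlim : Tendsto (fun k => κ * d (prefixWord ω k)) atTop (𝓝 0) := by
        simpa using (h.tendsto_d_prefixWord ω).const_mul κ
      rw [← ENNReal.ofReal_toReal hTtop, ← hρ, ENNReal.ofReal_rpow_of_nonneg hρ0 hσ.le]
      rcases hρ0.eq_or_lt with h0 | h0
      · rw [← h0, Real.zero_rpow hσ.ne', ENNReal.ofReal_zero]
        have h1 : Tendsto (fun k => ENNReal.ofReal ((κ * d (prefixWord ω (k + 1))) ^ σ)) atTop
            (𝓝 0) := by
          have h2 := ((hlim.comp (tendsto_add_atTop_nat 1)).rpow_const (p := σ) (Or.inr hσ.le))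
          rw [Real.zero_rpow hσ.ne'] at h2
          simpa using ENNReal.tendsto_ofReal h2
        refine ge_of_tendsto h1 ?_
        filter_upwards [eventually_ge_atTop N] with k hk
        refine hbound k hk ?_
        rw [← h0]
        exact mul_pos hκ (hd _)
      · have hex : ∃ k, N ≤ k ∧ κ * d (prefixWord ω (k + 1)) ≤ ρ :=
          ((eventually_ge_atTop N).and ((hlim.comp (tendsto_add_atTop_nat 1)).eventually_le_const
            h0)).exists
        obtain ⟨hk1, hk2⟩ := Nat.find_spec hex
        refine (hbound _ hk1 ?_).trans (ENNReal.ofReal_le_ofReal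
          (Real.rpow_le_rpow (mul_pos hκ (hd _)).le hk2 hσ.le))
        rcases hk1.eq_or_lt with hk | hk
        · rw [← hk]
          exact hρlt.trans_le (mul_le_mul_of_nonneg_left (hmin ω) hκ.le)
        · have := Nat.find_min hex (m := Nat.find hex - 1) (by omega)
          rw [not_and, not_le, Nat.sub_add_cancel (by omega)] at this
          exact this (by omega)
    have hpos : μH[σ] E ≠ 0 := by
      intro h0
      refine hN ?_
      have h1 : m' E = 0 := le_antisymm ((hle E).trans_eq h0) zero_le
      have h2 := (Measure.le_restrict_apply (μ := ν) (GN N) (π ⁻¹' E)).trans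
        (Measure.le_map_apply hπm.aemeasurable E)
      refine measure_mono_null ?_ (le_antisymm (h2.trans_eq h1) zero_le)
      exact fun ω hω => ⟨hE ω hω.1, hω⟩
    have := le_dimH_of_hausdorffMeasure_ne_zero (d := ⟨σ, hσ.le⟩) hpos
    refine le_trans ?_ this
    rw [ENNReal.ofReal, Real.toNNReal_of_nonneg hσ.le]
    exact le_rfl
  have hlim : Tendsto (fun σ => ENNReal.ofReal σ) (𝓝[<] (η / l)) (𝓝 (ENNReal.ofReal (η / l))) :=
    ENNReal.tendsto_ofReal (tendsto_id.mono_left nhdsWithin_le_nhds)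
  refine le_of_tendsto hlim ?_
  filter_upwards [Ioo_mem_nhdsLT (div_pos hη hl)] with σ hσ using key σ hσ.1 hσ.2

end CodedMeasure

namespace CodedMeasure

variable {ι : Type} {X : Set ℝ} {μ : Measure ℝ} {s : ℝ} {pt : List ι → ℝ} {cl : List ι → Set ℝ}
  {d : List ι → ℝ} {C θ κ D : ℝ}

lemma abs_energy_sub_sum_le (h : CodedMeasure X μ s pt cl d C θ κ D) (ω : ℕ → ι) (k : ℕ) :
    |rieszEnergy μ s (pt (prefixWord ω k)) (d (prefixWord ω k)) - ∑ i ∈ Finset.range k,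
      rieszEnergy μ s (pt [ω i]) (d [ω i])| ≤ k * D + D := by
  induction k with
  | zero =>
    have := h.additive [] []
    rw [List.append_nil, sub_self, zero_sub, abs_neg] at this
    simpa using this
  | succ k ih =>
    have h1 := h.additive (prefixWord ω k) [ω k]
    rw [← prefixWord_succ] at h1
    rw [Finset.sum_range_succ]
    rw [abs_le] at *
    push_cast
    constructor <;> linarith

/-- Lower bound for the multifractal spectrum of the average density. -/
lemma exists_le_dimH_avg [Fintype ι] [IsProbabilityMeasure μ]
    (h : CodedMeasure X μ s pt cl d C θ κ D) {q A : ℝ} (hq : 0 < q) (hDA : D < A)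
    (hA : ∀ i, A ≤ rieszEnergy μ s (pt [i]) (d [i]))
    (hsum : ∑ i, Real.exp (-q * rieszEnergy μ s (pt [i]) (d [i])) = 1) :
    ∃ α, 0 < α ∧ ENNReal.ofReal (q * A / (A + D) * (s * α)) ≤
      dimH {x ∈ X | upperAvg μ s x = α ∧ lowerAvg μ s x = α} := by
  have hs := h.s_pos
  have hD := h.D_nonneg
  have hA0 : 0 < A := hD.trans_lt hDA
  let _ : MeasurableSpace ι := ⊤
  set a : List ι → ℝ := fun w => rieszEnergy μ s (pt w) (d w) with ha
  have hne : Nonempty ι := by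
    by_contra hcon
    rw [not_nonempty_iff] at hcon
    simp at hsum
  have hsum' : ∑ i, ENNReal.ofReal (Real.exp (-q * a [i])) = 1 := by
    rw [← ENNReal.ofReal_sum_of_nonneg fun i _ => (Real.exp_pos _).le, hsum, ENNReal.ofReal_one]
  set p : Measure ι := (PMF.ofFintype _ hsum').toMeasure with hp
  have hpi : ∀ i, p {i} = ENNReal.ofReal (Real.exp (-(q * a [i]))) := by
    intro i
    rw [hp, PMF.toMeasure_apply_singleton _ _ .of_discrete, PMF.ofFintype_apply, neg_mul]
  have : IsProbabilityMeasure p := PMF.toMeasure.isProbabilityMeasure _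
  obtain ⟨π, hπm, hπ⟩ := h.exists_coding
  obtain ⟨ā, hā⟩ := exists_ae_tendsto_of_almost_additive p (ψ := a) h.additive
  obtain ⟨e, he⟩ := exists_ae_tendsto_of_almost_additive p
    (ψ := fun w => (w.map fun i => a [i]).sum) (D := 0) (by intro u v; simp)
  have hlog : ∀ u v, |-Real.log (d (u ++ v)) - -Real.log (d u) - -Real.log (d v)| ≤
      Real.log C := by
    intro u v
    have hC := zero_lt_one.trans_le h.one_le_C
    have hu := h.d_pos u
    have hv := h.d_pos v
    have huv := h.d_pos (u ++ v)
    have h1 := Real.log_le_log huv (h.d_append_le u v)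
    have h2 := Real.log_le_log (mul_pos hu hv) (h.le_d_append u v)
    rw [Real.log_mul hC.ne' (mul_pos hu hv).ne', Real.log_mul hu.ne' hv.ne'] at h1
    rw [Real.log_mul hC.ne' huv.ne', Real.log_mul hu.ne' hv.ne'] at h2
    rw [abs_le]
    constructor <;> linarith
  obtain ⟨l, hl⟩ := exists_ae_tendsto_of_almost_additive p (ψ := fun w => -Real.log (d w)) hlog
  have hsumω : ∀ (ω : ℕ → ι) (k : ℕ), ((prefixWord ω k).map fun i => a [i]).sum =
      ∑ i ∈ Finset.range k, a [ω i] := by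
    intro ω k
    induction k with
    | zero => simp
    | succ k ih => rw [prefixWord_succ, List.map_append, List.sum_append, ih,
        Finset.sum_range_succ]; simp
  simp only [hsumω] at he
  set G : Set (ℕ → ι) := {ω | Tendsto (fun k : ℕ => a (prefixWord ω k) / k) atTop (𝓝 ā) ∧
    Tendsto (fun k : ℕ => (∑ i ∈ Finset.range k, a [ω i]) / k) atTop (𝓝 e) ∧
    Tendsto (fun k : ℕ => -Real.log (d (prefixWord ω k)) / k) atTop (𝓝 l)} with hG
  have hGae : ∀ᵐ ω ∂(Measure.infinitePi fun _ : ℕ => p), ω ∈ G := by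
    filter_upwards [hā, he, hl] with ω h1 h2 h3 using ⟨h1, h2, h3⟩
  have hG0 : (Measure.infinitePi fun _ : ℕ => p) G ≠ 0 := by
    intro h0
    have h1 := measure_mono_null (s := univ) (fun ω _ => em (ω ∈ G)) (measure_union_null h0 hGae)
    rw [measure_univ] at h1
    exact one_ne_zero h1
  obtain ⟨ω₀, hω₀⟩ := hGae.exists
  have hle : A ≤ e := by
    refine ge_of_tendsto hω₀.2.1 ?_
    filter_upwards [eventually_gt_atTop 0] with k hk
    rw [le_div_iff₀ (by exact_mod_cast hk)]
    calc A * k = ∑ i ∈ Finset.range k, A := by simp [mul_comm]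
      _ ≤ _ := Finset.sum_le_sum fun i _ => hA _
  have hl0 : 0 < l := by
    have h1 : 0 < -Real.log θ := neg_pos.2 (Real.log_neg h.θ_pos h.θ_lt)
    refine h1.trans_le (ge_of_tendsto hω₀.2.2 ?_)
    filter_upwards [eventually_gt_atTop 0] with k hk
    rw [le_div_iff₀ (by exact_mod_cast hk)]
    have h2 := Real.log_le_log (h.d_pos _) (h.d_le (prefixWord ω₀ k))
    rw [Real.log_pow, length_prefixWord] at h2
    linarith
  have hae : |ā - e| ≤ D := by
    have h1 : Tendsto (fun k : ℕ => ((k : ℝ) + 1) / k * D) atTop (𝓝 (1 * D)) := by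
      refine Tendsto.mul_const D ?_
      have : Tendsto (fun k : ℕ => (1 : ℝ) + 1 / k) atTop (𝓝 (1 + 0)) :=
        tendsto_const_nhds.add tendsto_one_div_atTop_nhds_zero_nat
      rw [add_zero] at this
      refine this.congr' ?_
      filter_upwards [eventually_gt_atTop 0] with k hk
      have : (k:ℝ) ≠ 0 := by positivity
      field_simp
    rw [one_mul] at h1
    refine le_of_tendsto_of_tendsto (hω₀.1.sub hω₀.2.1).abs h1 ?_
    filter_upwards [eventually_gt_atTop 0] with k hk
    have hk' : (0:ℝ) < k := by exact_mod_cast hk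
    rw [← sub_div, abs_div, abs_of_pos hk', div_mul_eq_mul_div]
    gcongr
    have := h.abs_energy_sub_sum_le ω₀ k
    linarith
  rw [abs_le] at hae
  have hā0 : 0 < ā := by linarith
  have hdim := h.le_dimH_of_bernoulli hπm hπ p (φ := fun i => q * a [i]) hpi (η := q * e) hl0
    (mul_pos hq (hA0.trans_le hle)) hG0
    (fun ω hω => by
      refine (hω.2.1.const_mul q).congr fun k => ?_
      rw [← Finset.mul_sum, mul_div_assoc])
    (fun ω hω => hω.2.2)
    (E := {x ∈ X | upperAvg μ s x = ā / l / s ∧ lowerAvg μ s x = ā / l / s})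
    (fun ω hω => ?_)
  · refine ⟨ā / l / s, by positivity, le_trans (ENNReal.ofReal_le_ofReal ?_) hdim⟩
    have h1 : A * ā ≤ e * (A + D) := by nlinarith
    rw [mul_div_cancel₀ _ hs.ne', div_mul_div_comm, div_le_div_iff₀ (by positivity) hl0]
    have := mul_le_mul_of_nonneg_left h1 (mul_pos hq hl0).le
    linarith
  · refine ⟨h.cl_subset _ (hπ ω 0), avg_eq_of_tendsto hs ?_⟩
    exact tendsto_div_neg_log (fun t t' h0 ht => rieszEnergy_anti μ hs.le h0 ht _)
      (fun k => h.d_pos _) (h.tendsto_d_prefixWord ω)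
      (fun k => h.energy _ _ (hπ ω k)) hā0 hl0 hω.1 hω.2.2

end CodedMeasure

/-- A second moment bound for the probability of a finite union. -/
lemma two_sub_le_measureReal_iUnion {Ω U : Type*} [MeasurableSpace Ω] [Fintype U] (P : Measure Ω)
    [IsProbabilityMeasure P] {F : U → Set Ω} (hF : ∀ u, MeasurableSet (F u)) {c : U → ℝ}
    (hc : ∑ u, c u * P.real (F u) = 1) :
    2 - ∑ u, ∑ v, c u * c v * P.real (F u ∩ F v) ≤ P.real (⋃ u, F u) := by
  classical
  set M : Ω → ℝ := fun ω => ∑ u, c u * (F u).indicator 1 ω with hM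
  have hU : MeasurableSet (⋃ u, F u) := MeasurableSet.iUnion hF
  have hinteg : ∀ S : Set Ω, MeasurableSet S → Integrable (S.indicator (1 : Ω → ℝ)) P :=
    fun S hS => (integrable_const 1).indicator hS
  have hM1 : Integrable M P := integrable_finsetSum _ fun u _ => (hinteg _ (hF u)).const_mul _
  have hMM : ∀ ω, M ω * M ω = ∑ u, ∑ v, c u * c v * (F u ∩ F v).indicator 1 ω := by
    intro ω
    rw [hM, Finset.sum_mul_sum]
    refine Finset.sum_congr rfl fun u _ => Finset.sum_congr rfl fun v _ => ?_
    rw [Set.inter_indicator_one]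
    simp only [Pi.mul_apply]
    ring
  have hI2 : ∀ u v, Integrable (fun ω => c u * c v * (F u ∩ F v).indicator (1 : Ω → ℝ) ω) P :=
    fun u v => (hinteg _ ((hF u).inter (hF v))).const_mul _
  have hM2 : Integrable (fun ω => M ω * M ω) P := by
    simp only [hMM]
    exact integrable_finsetSum _ fun u _ => integrable_finsetSum _ fun v _ => hI2 u v
  have hptw : ∀ ω, 2 * M ω - M ω * M ω ≤ (⋃ u, F u).indicator 1 ω := by
    intro ω
    by_cases hω : ω ∈ ⋃ u, F u
    · rw [Set.indicator_of_mem hω, Pi.one_apply]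
      nlinarith [sq_nonneg (M ω - 1)]
    · have : M ω = 0 := Finset.sum_eq_zero fun u _ => by
        rw [Set.indicator_of_notMem (fun h => hω (mem_iUnion.2 ⟨u, h⟩)), mul_zero]
      rw [Set.indicator_of_notMem hω, this]
      simp
  have h1 := integral_mono ((hM1.const_mul 2).sub hM2) (hinteg _ hU) hptw
  simp only [Pi.sub_apply] at h1
  rw [integral_indicator_one hU, integral_sub (hM1.const_mul 2) hM2, integral_const_mul] at h1
  have h2 : ∫ ω, M ω ∂P = 1 := by
    rw [hM, integral_finsetSum _ fun u _ => (hinteg _ (hF u)).const_mul _, ← hc]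
    refine Finset.sum_congr rfl fun u _ => ?_
    rw [integral_const_mul, integral_indicator_one (hF u)]
  have h3 : ∫ ω, M ω * M ω ∂P = ∑ u, ∑ v, c u * c v * P.real (F u ∩ F v) := by
    simp only [hMM]
    rw [integral_finsetSum _ fun u _ => integrable_finsetSum _ fun v _ => hI2 u v]
    refine Finset.sum_congr rfl fun u _ => ?_
    rw [integral_finsetSum _ fun v _ => hI2 u v]
    refine Finset.sum_congr rfl fun v _ => ?_
    rw [integral_const_mul, integral_indicator_one ((hF u).inter (hF v))]
  rw [h2, h3] at h1
  linarith

lemma measureReal_compl_union_le {μ : Measure ℝ} [IsProbabilityMeasure μ] {S T : Set ℝ}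
    (hS : MeasurableSet S) (hT : MeasurableSet T) {η : ℝ} (hη : η < 1) (hSη : μ.real S ≤ η)
    (hTη : μ.real T ≤ η) :
    μ.real (S ∪ T)ᶜ ≤ μ.real Sᶜ * μ.real Tᶜ *
      Real.exp (((1 - η) ^ 2)⁻¹ * μ.real (S ∩ T)) := by
  rw [probReal_compl_eq_one_sub (hS.union hT), probReal_compl_eq_one_sub hS,
    probReal_compl_eq_one_sub hT]
  have h1 := measureReal_union_add_inter (μ := μ) (s := S) hT
  have hη' : 0 < 1 - η := by linarith
  have hst : (1 - η) ^ 2 ≤ (1 - μ.real S) * (1 - μ.real T) := by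
    rw [sq]; exact mul_le_mul (by linarith) (by linarith) hη'.le (by linarith)
  have hpos : 0 < (1 - μ.real S) * (1 - μ.real T) := by
    refine lt_of_lt_of_le (by positivity) hst
  have h2 := Real.add_one_le_exp (((1 - η) ^ 2)⁻¹ * μ.real (S ∩ T))
  have h3 : 0 ≤ μ.real (S ∩ T) := measureReal_nonneg
  have h4 : 0 ≤ μ.real S := measureReal_nonneg
  have h5 : 0 ≤ μ.real T := measureReal_nonneg
  have h6 : μ.real (S ∩ T) ≤ (1 - μ.real S) * (1 - μ.real T) *
      (((1 - η) ^ 2)⁻¹ * μ.real (S ∩ T)) := by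
    have : 1 ≤ (1 - μ.real S) * (1 - μ.real T) * ((1 - η) ^ 2)⁻¹ := by
      rw [← div_eq_mul_inv, one_le_div (by positivity)]; exact hst
    rw [← mul_assoc]
    exact le_mul_of_one_le_left h3 this
  have h7 := mul_le_mul_of_nonneg_left h2 hpos.le
  have h8 := mul_nonneg h4 h5
  linarith

/-- The total mass of the pairwise intersections is at most the energy. -/
lemma sum_measure_inter_le {μ : Measure ℝ} [IsProbabilityMeasure μ] {s c t x y : ℝ} (hs : 0 < s)
    (hc : 0 < c) (ht : 0 < t) (hxy : 2 * t ≤ |x - y|) (S : Finset ℕ) :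
    ∑ n ∈ S, μ.real (ball x (c * ((n + 1 : ℕ) : ℝ) ^ (-(1 / s))) ∩
      ball y (c * ((n + 1 : ℕ) : ℝ) ^ (-(1 / s)))) ≤ c ^ s * rieszEnergy μ s x t := by
  set B : ℕ → Set ℝ := fun n => ball x (c * ((n + 1 : ℕ) : ℝ) ^ (-(1 / s))) ∩
      ball y (c * ((n + 1 : ℕ) : ℝ) ^ (-(1 / s)))
  have hB : ∀ n, MeasurableSet (B n) := fun n => measurableSet_ball.inter measurableSet_ball
  have hinteg : ∀ n, Integrable ((B n).indicator (1 : ℝ → ℝ)) μ :=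
    fun n => (integrable_const 1).indicator (hB n)
  calc ∑ n ∈ S, μ.real (B n) = ∫ z, ∑ n ∈ S, (B n).indicator 1 z ∂μ := by
        rw [integral_finsetSum _ fun n _ => hinteg n]
        exact Finset.sum_congr rfl fun n _ => (integral_indicator_one (hB n)).symm
    _ ≤ ∫ z, c ^ s * (max t |x - z|) ^ (-s) ∂μ := by
        refine integral_mono (integrable_finsetSum _ fun n _ => hinteg n)
          ((integrable_riesz_kernel μ hs.le ht x).const_mul _) fun z => ?_
        set v := max t |x - z| with hv
        have hv0 : 0 < v := lt_max_of_lt_left ht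
        have hle : ∀ n ∈ S, (B n).indicator (1 : ℝ → ℝ) z ≤
            if ((n + 1 : ℕ) : ℝ) < (c / v) ^ s then 1 else 0 := by
          intro n _
          by_cases hz : z ∈ B n
          · have h1 := hz.1
            have h2 := hz.2
            rw [mem_ball, Real.dist_eq] at h1 h2
            have h3 := abs_sub_le x z y
            rw [abs_sub_comm z x] at h1
            rw [Set.indicator_of_mem hz, Pi.one_apply,
              if_pos ((lt_radius_iff hc hs hv0 n).1 (max_lt (by linarith) h1))]
          · rw [Set.indicator_of_notMem hz]; split_ifs <;> simp
        have hT : c ^ s * v ^ (-s) = (c / v) ^ s := by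
          rw [Real.div_rpow hc.le hv0.le, Real.rpow_neg hv0.le]; rfl
        simp only [hT]
        refine (Finset.sum_le_sum hle).trans ?_
        rw [← Finset.sum_filter, Finset.sum_const, nsmul_one]
        have hsub : S.filter (fun n => ((n + 1 : ℕ) : ℝ) < (c / v) ^ s) ⊆
            Finset.range ⌊(c / v) ^ s⌋₊ := by
          intro n hn
          rw [Finset.mem_range]
          exact Nat.le_floor (Finset.mem_filter.1 hn).2.le
        refine le_trans (Nat.cast_le.2 (Finset.card_le_card hsub)) ?_
        rw [Finset.card_range]
        exact Nat.floor_le (by positivity)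
    _ = c ^ s * rieszEnergy μ s x t := integral_const_mul _ _

section Words

variable {ι : Type}

/-- The Bernoulli weight of a finite word. -/
def wordWeight (p : ι → ℝ) (w : List ι) : ℝ := (w.map p).prod

lemma wordWeight_cons (p : ι → ℝ) (i : ι) (w : List ι) :
    wordWeight p (i :: w) = p i * wordWeight p w := by simp [wordWeight]

lemma wordWeight_nil (p : ι → ℝ) : wordWeight p [] = 1 := by simp [wordWeight]

lemma wordWeight_nonneg {p : ι → ℝ} (hp : ∀ i, 0 ≤ p i) (w : List ι) : 0 ≤ wordWeight p w := by
  induction w with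
  | nil => simp [wordWeight_nil]
  | cons i w ih => rw [wordWeight_cons]; exact mul_nonneg (hp i) ih

variable [Fintype ι]

lemma sum_wordWeight_mul_take {p : ι → ℝ} (hp : ∑ i, p i = 1) {j m : ℕ} (hjm : j ≤ m)
    (G : List ι → ℝ) :
    ∑ u : Fin m → ι, wordWeight p (List.ofFn u) * G ((List.ofFn u).take j) =
      ∑ w : Fin j → ι, wordWeight p (List.ofFn w) * G (List.ofFn w) := by
  induction m generalizing j G with
  | zero =>
    obtain rfl : j = 0 := by omega
    simp
  | succ m ih =>
    rw [sum_words_succ (fun w => wordWeight p w * G (w.take j))]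
    rcases j with - | j
    · have h1 := fun (i : ι) => ih (Nat.zero_le m) (fun _ => p i * G [])
      simp only [wordWeight_cons, List.take_zero]
      simp only [mul_left_comm (wordWeight p _)] at h1
      simp only [mul_assoc, h1]
      simp [wordWeight_nil, ← Finset.sum_mul, hp]
    · rw [sum_words_succ (fun w => wordWeight p w * G w)]
      refine Finset.sum_congr rfl fun i _ => ?_
      simp only [wordWeight_cons, List.take_succ_cons, mul_assoc, ← Finset.mul_sum]
      rw [ih (by omega) fun w => G (i :: w)]

lemma sum_wordWeight {p : ι → ℝ} (hp : ∑ i, p i = 1) (m : ℕ) :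
    ∑ u : Fin m → ι, wordWeight p (List.ofFn u) = 1 := by
  have := sum_wordWeight_mul_take hp (Nat.zero_le m) (fun _ => 1)
  simpa [wordWeight_nil] using this

lemma sum_wordWeight_sq (p : ι → ℝ) (m : ℕ) :
    ∑ u : Fin m → ι, wordWeight p (List.ofFn u) ^ 2 = (∑ i, p i ^ 2) ^ m := by
  induction m with
  | zero => simp [wordWeight_nil]
  | succ m ih =>
    rw [sum_words_succ (fun w => wordWeight p w ^ 2), pow_succ', ← ih, Finset.sum_mul_sum]
    simp only [wordWeight_cons, mul_pow]

open Classical in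
lemma sum_wordWeight_take_eq {p : ι → ℝ} (hp : ∑ i, p i = 1) {j m : ℕ} (hjm : j ≤ m)
    {w : List ι} (hw : w.length = j) :
    ∑ u : Fin m → ι, wordWeight p (List.ofFn u) * (if w = (List.ofFn u).take j then 1 else 0) =
      wordWeight p w := by
  rw [sum_wordWeight_mul_take hp hjm fun z => if w = z then 1 else 0]
  subst hw
  rw [Finset.sum_eq_single w.get]
  · simp
  · intro z _ hz
    rw [if_neg, mul_zero]
    rintro hcon
    refine hz (List.ofFn_injective ?_)
    rw [List.ofFn_get, ← hcon]
  · simp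

lemma sum_wordWeight_pair_le {p : ι → ℝ} (hp : ∀ i, 0 ≤ p i) {a : List ι → ℝ} {D q : ℝ}
    (hq : 0 ≤ q) (hadd : ∀ u v, |a (u ++ v) - a u - a v| ≤ D) (j : ℕ) :
    ∑ w : Fin (j + 1) → ι, wordWeight p (List.ofFn w) *
      (wordWeight p ((List.ofFn w).take j) * Real.exp (q * a (List.ofFn w))) ≤
      (∑ i, p i ^ 2 * Real.exp (q * (a [i] + D))) ^ j * ∑ i, p i * Real.exp (q * a [i]) := by
  set ρ := ∑ i, p i ^ 2 * Real.exp (q * (a [i] + D)) with hρ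
  have hρ0 : 0 ≤ ρ := Finset.sum_nonneg fun i _ => by positivity
  induction j with
  | zero =>
    rw [sum_words_succ (fun w => wordWeight p w * (wordWeight p (w.take 0) * Real.exp (q * a w)))]
    simp [wordWeight]
  | succ j ih =>
    rw [sum_words_succ
      (fun w => wordWeight p w * (wordWeight p (w.take (j + 1)) * Real.exp (q * a w))),
      pow_succ', mul_assoc]
    refine le_trans ?_ (mul_le_mul_of_nonneg_left ih hρ0)
    rw [hρ, Finset.sum_mul_sum]
    refine Finset.sum_le_sum fun i _ => Finset.sum_le_sum fun w _ => ?_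
    rw [wordWeight_cons, List.take_succ_cons, wordWeight_cons]
    have h1 := (abs_le.1 (hadd [i] (List.ofFn w))).2
    rw [List.singleton_append] at h1
    have h2 : Real.exp (q * a (i :: List.ofFn w)) ≤
        Real.exp (q * (a [i] + D)) * Real.exp (q * a (List.ofFn w)) := by
      rw [← Real.exp_add, ← mul_add]
      exact Real.exp_le_exp.2 (mul_le_mul_of_nonneg_left (by linarith) hq)
    have h3 := wordWeight_nonneg hp (List.ofFn w)
    have h4 := wordWeight_nonneg hp ((List.ofFn w).take j)
    have h5 := mul_le_mul_of_nonneg_left h2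
      (mul_nonneg (mul_nonneg (sq_nonneg (p i)) h3) h4)
    linarith

open Classical in
lemma sum_wordWeight_double_le {p : ι → ℝ} (hp0 : ∀ i, 0 ≤ p i) (hp : ∑ i, p i = 1)
    {a : List ι → ℝ} {D q B : ℝ}
    (hq : 0 ≤ q) (hadd : ∀ u v, |a (u ++ v) - a u - a v| ≤ D) {j m : ℕ} (hjm : j < m) :
    ∑ u : Fin m → ι, ∑ v : Fin m → ι, wordWeight p (List.ofFn u) * wordWeight p (List.ofFn v) *
      (if (List.ofFn u).take j = (List.ofFn v).take j then
        Real.exp (q * (a ((List.ofFn u).take (j + 1)) + B)) else 0) ≤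
      (∑ i, p i ^ 2 * Real.exp (q * (a [i] + D))) ^ j *
        (Real.exp (q * B) * ∑ i, p i * Real.exp (q * a [i])) := by
  have h1 : ∀ u : Fin m → ι, ∑ v : Fin m → ι,
      wordWeight p (List.ofFn u) * wordWeight p (List.ofFn v) *
      (if (List.ofFn u).take j = (List.ofFn v).take j then
        Real.exp (q * (a ((List.ofFn u).take (j + 1)) + B)) else 0) =
      wordWeight p (List.ofFn u) * (fun z : List ι => wordWeight p (z.take j) *
        Real.exp (q * (a z + B))) ((List.ofFn u).take (j + 1)) := by
    intro u
    have h2 := sum_wordWeight_take_eq hp hjm.le (w := (List.ofFn u).take j)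
      (by simp [hjm.le])
    simp only [List.take_take]
    rw [min_eq_left (by omega), ← h2, Finset.sum_mul, Finset.mul_sum]
    refine Finset.sum_congr rfl fun v _ => ?_
    split_ifs <;> ring
  simp only [h1]
  rw [sum_wordWeight_mul_take hp (by omega : j + 1 ≤ m)
    (fun z : List ι => wordWeight p (z.take j) * Real.exp (q * (a z + B)))]
  have h3 := mul_le_mul_of_nonneg_left (sum_wordWeight_pair_le hp0 hq hadd j)
    (Real.exp_pos (q * B)).le
  refine le_trans (le_of_eq ?_) (h3.trans (le_of_eq (by ring)))
  rw [Finset.mul_sum]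
  refine Finset.sum_congr rfl fun w _ => ?_
  rw [mul_add, Real.exp_add]
  ring

end Words

namespace CodedMeasure

variable {ι : Type} {X : Set ℝ} {μ : Measure ℝ} {s : ℝ} {pt : List ι → ℝ} {cl : List ι → Set ℝ}
  {d : List ι → ℝ} {C θ κ D : ℝ}

lemma energy_shrink_le [IsProbabilityMeasure μ] (h : CodedMeasure X μ s pt cl d C θ κ D)
    {w : List ι} {x lam : ℝ} (hx : x ∈ cl w) (hlam : 0 < lam) (hlam1 : lam ≤ 1) :
    rieszEnergy μ s x (lam * d w) ≤ rieszEnergy μ s (pt w) (d w) + (D + lam ^ (-s) * C) := by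
  have hd := h.d_pos w
  have h1 := rieszEnergy_scale_le μ (x := x) h.s_pos (mul_pos hlam hd)
    (mul_le_of_le_one_left hd.le hlam1)
  have h2 := h.upper.real_le (h.cl_subset w hx) hd
  have h3 := (abs_le.1 (h.energy w x hx)).2
  have h4 : (lam * d w) ^ (-s) * μ.real (closedBall x (d w)) ≤ lam ^ (-s) * C := by
    calc _ ≤ (lam * d w) ^ (-s) * (C * d w ^ s) := by gcongr
      _ = _ := by
        rw [Real.mul_rpow hlam.le hd.le, Real.rpow_neg hd.le]
        have : d w ^ s ≠ 0 := (Real.rpow_pos_of_pos hd s).ne'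
        field_simp
  linarith

/-- Two different words separate right after their longest common initial segment. -/
lemma exists_first_split (h : CodedMeasure X μ s pt cl d C θ κ D) {u v : List ι}
    (hlen : u.length = v.length) (hne : u ≠ v) :
    ∃ j < u.length, u.take j = v.take j ∧ pt u ∈ cl (u.take (j + 1)) ∧
      κ * d (u.take (j + 1)) ≤ |pt u - pt v| := by
  classical
  have hex : ∃ j, u.take j ≠ v.take j := by
    refine ⟨u.length, ?_⟩
    rw [List.take_length, hlen, List.take_length]
    exact hne
  have hmem : ∀ (w : List ι) (j : ℕ), pt w ∈ cl (w.take j) := by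
    intro w j
    refine h.cl_append_subset (w.take j) (w.drop j) ?_
    rw [List.take_append_drop]
    exact h.pt_mem w
  have hspec := Nat.find_spec hex
  have hmin := fun m => Nat.find_min hex (m := m)
  have hle : Nat.find hex ≤ u.length := Nat.find_min' hex (by
    rw [List.take_length, hlen, List.take_length]; exact hne)
  generalize Nat.find hex = j at hspec hmin hle
  rcases j with - | j
  · simp at hspec
  · refine ⟨j, by omega, not_not.1 (hmin j (Nat.lt_succ_self j)), hmem u _, ?_⟩
    refine h.sep _ _ (hmem u _) _ (h.pt_mem_attractor v) fun hcon => ?_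
    exact Set.disjoint_left.1 (h.disjoint _ _ (by simp [hlen]) hspec) hcon (hmem v _)

open Classical in
/-- A pointwise bound for the correlation kernel of two different words. -/
lemma exp_sum_inter_le [IsProbabilityMeasure μ] (h : CodedMeasure X μ s pt cl d C θ κ D)
    {c : ℝ} (hc : 0 < c) {r : ℕ → ℝ} (hr : ∀ n : ℕ, r n = c * ((n + 1 : ℕ) : ℝ) ^ (-(1 / s)))
    {lam H q : ℝ} (hlam : 0 < lam) (hlam1 : lam ≤ 1) (hlamκ : 2 * lam ≤ κ) (hH : 0 ≤ H)
    (hHq : H * c ^ s ≤ q) {k J : ℕ}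
    (hk : ∀ w : List ι, w.length ≤ J → ∀ n, k ≤ n → 2 * r n ≤ κ * d w) (N : ℕ)
    {u v : List ι} (hlen : u.length = v.length) (hne : u ≠ v) :
    Real.exp (H * ∑ n ∈ Finset.Ico k N, μ.real (ball (pt u) (r n) ∩ ball (pt v) (r n))) ≤
      1 + ∑ j ∈ Finset.Ico J u.length, if u.take j = v.take j then
        Real.exp (q * (rieszEnergy μ s (pt (u.take (j + 1))) (d (u.take (j + 1))) +
          (D + lam ^ (-s) * C))) else 0 := by
  obtain ⟨j, hj, hjeq, hmem, hdist⟩ := h.exists_first_split hlen hne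
  have hnn : ∀ j' ∈ Finset.Ico J u.length, (0:ℝ) ≤ if u.take j' = v.take j' then
        Real.exp (q * (rieszEnergy μ s (pt (u.take (j' + 1))) (d (u.take (j' + 1))) +
          (D + lam ^ (-s) * C))) else 0 := by
    intro j' _
    split_ifs
    · exact (Real.exp_pos _).le
    · exact le_rfl
  by_cases hJ : j < J
  · have hzero : ∑ n ∈ Finset.Ico k N, μ.real (ball (pt u) (r n) ∩ ball (pt v) (r n)) = 0 := by
      refine Finset.sum_eq_zero fun n hn => ?_
      have h1 := hk (u.take (j + 1)) (by rw [List.length_take]; omega) n (Finset.mem_Ico.1 hn).1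
      have h2 : Disjoint (ball (pt u) (r n)) (ball (pt v) (r n)) :=
        ball_disjoint_ball (by rw [Real.dist_eq]; linarith)
      rw [h2.inter_eq, measureReal_empty]
    rw [hzero, mul_zero, Real.exp_zero]
    exact le_add_of_nonneg_right (Finset.sum_nonneg hnn)
  · have hjm : j ∈ Finset.Ico J u.length := Finset.mem_Ico.2 ⟨by omega, hj⟩
    have hd := h.d_pos (u.take (j + 1))
    have h1 := sum_measure_inter_le (μ := μ) (x := pt u) (y := pt v)
      (t := lam * d (u.take (j + 1))) h.s_pos hc (mul_pos hlam hd)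
      (by nlinarith) (Finset.Ico k N)
    simp only [← hr] at h1
    have h2 := h.energy_shrink_le hmem hlam hlam1
    have h0 : 0 ≤ rieszEnergy μ s (pt u) (lam * d (u.take (j + 1))) :=
      integral_nonneg fun y => Real.rpow_nonneg (le_max_of_le_left (mul_pos hlam hd).le) _
    have hq : 0 ≤ q := le_trans (by positivity) hHq
    have h3 : H * ∑ n ∈ Finset.Ico k N, μ.real (ball (pt u) (r n) ∩ ball (pt v) (r n)) ≤
        q * (rieszEnergy μ s (pt (u.take (j + 1))) (d (u.take (j + 1))) +
          (D + lam ^ (-s) * C)) := by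
      calc _ ≤ H * (c ^ s * rieszEnergy μ s (pt u) (lam * d (u.take (j + 1)))) := by gcongr
        _ = H * c ^ s * rieszEnergy μ s (pt u) (lam * d (u.take (j + 1))) := by ring
        _ ≤ q * rieszEnergy μ s (pt u) (lam * d (u.take (j + 1))) := by gcongr
        _ ≤ _ := by gcongr
    have h4 := Finset.single_le_sum hnn hjm
    rw [if_pos hjeq] at h4
    have h5 := Real.exp_le_exp.2 h3
    linarith

/-- The second moment bound: with high probability some point of `X` avoids the balls with
indices in `[k, N)`. -/
lemma measure_cover_Ico_le [Fintype ι] [IsProbabilityMeasure μ]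
    (h : CodedMeasure X μ s pt cl d C θ κ D)
    {P : Measure (ℕ → ℝ)}
    (hP : ∀ (I : Finset ℕ) (f : ℕ → Set ℝ), (∀ n, MeasurableSet (f n)) →
      P {ω | ∀ n ∈ I, ω n ∈ f n} = ∏ n ∈ I, μ (f n))
    {c : ℝ} (hc : 0 < c) {r : ℕ → ℝ} (hr : ∀ n : ℕ, r n = c * ((n + 1 : ℕ) : ℝ) ^ (-(1 / s)))
    {p : ι → ℝ} (hp0 : ∀ i, 0 ≤ p i) (hp : ∑ i, p i = 1) (hp2 : ∑ i, p i ^ 2 < 1)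
    {η q lam : ℝ} (hη : η < 1) (hηq : ((1 - η) ^ 2)⁻¹ * c ^ s ≤ q)
    (hlam : 0 < lam) (hlam1 : lam ≤ 1) (hlamκ : 2 * lam ≤ κ)
    {ρ G ε : ℝ} (hρ : ρ = ∑ i, p i ^ 2 * Real.exp (q * (rieszEnergy μ s (pt [i]) (d [i]) + D)))
    (hρ1 : ρ < 1)
    (hG : G = Real.exp (q * (D + lam ^ (-s) * C)) *
      ∑ i, p i * Real.exp (q * rieszEnergy μ s (pt [i]) (d [i])))
    (hε : 0 < ε) {k J : ℕ} (hJ : ρ ^ J / (1 - ρ) * G ≤ ε / 2)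
    (hk : ∀ w : List ι, w.length ≤ J → ∀ n, k ≤ n → 2 * r n ≤ κ * d w)
    (hkη : ∀ n, k ≤ n → ∀ x ∈ X, μ.real (ball x (r n)) ≤ η) (N : ℕ) :
    P {ω | X ⊆ ⋃ n ∈ Finset.Ico k N, ball (ω n) (r n)} ≤ ENNReal.ofReal ε := by
  classical
  have hP1 : P univ = 1 := by simpa using hP ∅ (fun _ => ∅) (fun _ => MeasurableSet.empty)
  have hPprob : IsProbabilityMeasure P := ⟨hP1⟩
  set H := ((1 - η) ^ 2)⁻¹ with hH
  have hη' : 0 < 1 - η := by linarith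
  have hH0 : 0 ≤ H := by positivity
  have hq : 0 ≤ q := le_trans (by positivity) hηq
  set Λ := Real.exp (H * N) with hΛ
  have hsq0 : 0 ≤ ∑ i, p i ^ 2 := Finset.sum_nonneg fun i _ => sq_nonneg _
  obtain ⟨m, hm⟩ : ∃ m : ℕ, Λ * (∑ i, p i ^ 2) ^ m ≤ ε / 2 := by
    have h1 := (tendsto_pow_atTop_nhds_zero_of_lt_one hsq0 hp2).const_mul Λ
    rw [mul_zero] at h1
    obtain ⟨m, hm⟩ := (h1.eventually (ge_mem_nhds (half_pos hε))).exists
    exact ⟨m, hm⟩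
  set b : (Fin m → ι) → ℕ → Set ℝ := fun u n => ball (pt (List.ofFn u)) (r n) with hb
  have hbm : ∀ u n, MeasurableSet (b u n) := fun u n => measurableSet_ball
  set F : (Fin m → ι) → Set (ℕ → ℝ) := fun u => {ω | ∀ n ∈ Finset.Ico k N, ω n ∈ (b u n)ᶜ}
    with hFdef
  have hF : ∀ u, MeasurableSet (F u) := by
    intro u
    have : F u = ⋂ n ∈ Finset.Ico k N, (fun ω : ℕ → ℝ => ω n) ⁻¹' (b u n)ᶜ := by
      ext ω; simp [hFdef]
    rw [this]
    exact Finset.measurableSet_biInter _ fun n _ => measurable_pi_apply n (hbm u n).compl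
  have hPF : ∀ u, P.real (F u) = ∏ n ∈ Finset.Ico k N, μ.real (b u n)ᶜ := by
    intro u
    rw [measureReal_def, hP _ (fun n => (b u n)ᶜ) fun n => (hbm u n).compl, ENNReal.toReal_prod]
    rfl
  have hPFF : ∀ u v, P.real (F u ∩ F v) = ∏ n ∈ Finset.Ico k N, μ.real (b u n ∪ b v n)ᶜ := by
    intro u v
    have : F u ∩ F v = {ω | ∀ n ∈ Finset.Ico k N, ω n ∈ (b u n ∪ b v n)ᶜ} := by
      ext ω
      simp only [hFdef, Set.mem_inter_iff, Set.mem_ofPred_eq, Set.compl_union]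
      exact ⟨fun h n hn => ⟨h.1 n hn, h.2 n hn⟩,
        fun h => ⟨fun n hn => (h n hn).1, fun n hn => (h n hn).2⟩⟩
    rw [measureReal_def, this, hP _ (fun n => (b u n ∪ b v n)ᶜ)
      fun n => ((hbm u n).union (hbm v n)).compl, ENNReal.toReal_prod]
    rfl
  have hbη : ∀ u, ∀ n ∈ Finset.Ico k N, μ.real (b u n) ≤ η := fun u n hn =>
    hkη n (Finset.mem_Ico.1 hn).1 _ (h.pt_mem_attractor _)
  have hpos : ∀ u, 0 < P.real (F u) := by
    intro u
    rw [hPF]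
    refine Finset.prod_pos fun n hn => ?_
    rw [probReal_compl_eq_one_sub (hbm u n)]
    linarith [hbη u n hn]
  have hcorr : ∀ u v, P.real (F u ∩ F v) ≤ P.real (F u) * P.real (F v) *
      Real.exp (H * ∑ n ∈ Finset.Ico k N, μ.real (b u n ∩ b v n)) := by
    intro u v
    rw [hPFF, hPF, hPF, Finset.mul_sum, Real.exp_sum, ← Finset.prod_mul_distrib,
      ← Finset.prod_mul_distrib]
    refine Finset.prod_le_prod (fun n _ => measureReal_nonneg) fun n hn => ?_
    exact measureReal_compl_union_le (hbm u n) (hbm v n) hη (hbη u n hn) (hbη v n hn)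
  set W : (Fin m → ι) → ℝ := fun u => wordWeight p (List.ofFn u) with hW
  have hW0 : ∀ u, 0 ≤ W u := fun u => wordWeight_nonneg hp0 _
  have hW1 : ∑ u, W u = 1 := sum_wordWeight hp m
  have hsum1 : ∑ u, (W u / P.real (F u)) * P.real (F u) = 1 := by
    rw [← hW1]
    exact Finset.sum_congr rfl fun u _ => div_mul_cancel₀ _ (hpos u).ne'
  have hsecond := two_sub_le_measureReal_iUnion P hF hsum1
  set T : (Fin m → ι) → (Fin m → ι) → ℕ → ℝ := fun u v j =>
    if (List.ofFn u).take j = (List.ofFn v).take j then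
        Real.exp (q * (rieszEnergy μ s (pt ((List.ofFn u).take (j + 1)))
          (d ((List.ofFn u).take (j + 1))) + (D + lam ^ (-s) * C))) else 0 with hT
  have hT0 : ∀ u v j, 0 ≤ T u v j := by
    intro u v j
    simp only [hT]
    split_ifs
    · exact (Real.exp_pos _).le
    · exact le_rfl
  have hker : ∀ u v, Real.exp (H * ∑ n ∈ Finset.Ico k N, μ.real (b u n ∩ b v n)) ≤
      1 + ∑ j ∈ Finset.Ico J m, T u v j + if u = v then Λ else 0 := by
    intro u v
    by_cases huv : u = v
    · rw [if_pos huv]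
      have h1 : ∑ n ∈ Finset.Ico k N, μ.real (b u n ∩ b v n) ≤ N := by
        calc _ ≤ ∑ n ∈ Finset.Ico k N, (1:ℝ) := Finset.sum_le_sum fun n _ => measureReal_le_one
          _ ≤ N := by
            rw [Finset.sum_const, nsmul_one, Nat.card_Ico]
            exact_mod_cast Nat.sub_le N k
      have h2 : Real.exp (H * ∑ n ∈ Finset.Ico k N, μ.real (b u n ∩ b v n)) ≤ Λ :=
        Real.exp_le_exp.2 (mul_le_mul_of_nonneg_left h1 hH0)
      have h3 : 0 ≤ ∑ j ∈ Finset.Ico J m, T u v j := Finset.sum_nonneg fun j _ => hT0 u v j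
      linarith
    · rw [if_neg huv, add_zero]
      have := h.exp_sum_inter_le hc hr hlam hlam1 hlamκ hH0 hηq hk N (u := List.ofFn u)
        (v := List.ofFn v) (by simp) (fun hcon => huv (List.ofFn_injective hcon))
      simp only [List.length_ofFn] at this
      exact this
  have hTsum : ∑ u, ∑ v, W u * W v * ∑ j ∈ Finset.Ico J m, T u v j ≤ ε / 2 := by
    have hρ0 : 0 ≤ ρ := by
      rw [hρ]; exact Finset.sum_nonneg fun i _ => by positivity
    have hG0 : 0 ≤ G := by
      rw [hG]
      exact mul_nonneg (Real.exp_pos _).le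
        (Finset.sum_nonneg fun i _ => mul_nonneg (hp0 i) (Real.exp_pos _).le)
    calc ∑ u, ∑ v, W u * W v * ∑ j ∈ Finset.Ico J m, T u v j
        = ∑ j ∈ Finset.Ico J m, ∑ u, ∑ v, W u * W v * T u v j := by
          rw [Finset.sum_comm]
          simp only [Finset.mul_sum]
          rw [Finset.sum_comm]
          refine Eq.trans (Finset.sum_congr rfl fun u _ => Finset.sum_comm) ?_
          rw [Finset.sum_comm]
      _ ≤ ∑ j ∈ Finset.Ico J m, ρ ^ j * G := by
          refine Finset.sum_le_sum fun j hj => ?_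
          rw [hρ, hG]
          exact sum_wordWeight_double_le hp0 hp
            (a := fun w => rieszEnergy μ s (pt w) (d w)) hq h.additive (Finset.mem_Ico.1 hj).2
      _ = (∑ j ∈ Finset.Ico J m, ρ ^ j) * G := by rw [Finset.sum_mul]
      _ ≤ ρ ^ J / (1 - ρ) * G := by
          gcongr
          exact geom_sum_Ico_le_of_lt_one hρ0 hρ1
      _ ≤ _ := hJ
  have hdiag : ∑ u, ∑ v, W u * W v * (if u = v then Λ else 0) ≤ ε / 2 := by
    refine le_trans (le_of_eq ?_) hm
    rw [← sum_wordWeight_sq, Finset.mul_sum]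
    refine Finset.sum_congr rfl fun u _ => ?_
    simp only [mul_ite, mul_zero, Finset.sum_ite_eq, Finset.mem_univ, if_true]
    ring
  have hone : ∑ u, ∑ v, W u * W v = 1 := by
    rw [← Finset.sum_mul_sum, hW1, one_mul]
  have hQ : ∑ u, ∑ v, W u / P.real (F u) * (W v / P.real (F v)) * P.real (F u ∩ F v) ≤
      1 + ε := by
    calc _ ≤ ∑ u, ∑ v, W u * W v *
          (1 + ∑ j ∈ Finset.Ico J m, T u v j + if u = v then Λ else 0) := by
          refine Finset.sum_le_sum fun u _ => Finset.sum_le_sum fun v _ => ?_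
          have hu := hpos u
          have hv := hpos v
          calc _ ≤ W u / P.real (F u) * (W v / P.real (F v)) * (P.real (F u) * P.real (F v) *
                Real.exp (H * ∑ n ∈ Finset.Ico k N, μ.real (b u n ∩ b v n))) := by
                refine mul_le_mul_of_nonneg_left (hcorr u v) ?_
                exact mul_nonneg (div_nonneg (hW0 u) hu.le) (div_nonneg (hW0 v) hv.le)
            _ = W u * W v * Real.exp (H * ∑ n ∈ Finset.Ico k N, μ.real (b u n ∩ b v n)) := by
                field_simp
            _ ≤ _ := mul_le_mul_of_nonneg_left (hker u v) (mul_nonneg (hW0 u) (hW0 v))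
      _ = ∑ u, ∑ v, W u * W v + ∑ u, ∑ v, W u * W v * ∑ j ∈ Finset.Ico J m, T u v j +
          ∑ u, ∑ v, W u * W v * (if u = v then Λ else 0) := by
          simp only [mul_add, mul_one, Finset.sum_add_distrib]
      _ ≤ 1 + ε := by linarith
  have hFU : MeasurableSet (⋃ u, F u) := MeasurableSet.iUnion hF
  have hsub : {ω : ℕ → ℝ | X ⊆ ⋃ n ∈ Finset.Ico k N, ball (ω n) (r n)} ⊆ (⋃ u, F u)ᶜ := by
    intro ω hω hcon
    obtain ⟨u, hu⟩ := mem_iUnion.1 hcon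
    obtain ⟨n, hn⟩ := mem_iUnion.1 (hω (h.pt_mem_attractor (List.ofFn u)))
    obtain ⟨hn1, hn2⟩ := mem_iUnion.1 hn
    exact hu n hn1 (mem_ball_comm.1 hn2)
  refine (measure_mono hsub).trans ?_
  rw [← ofReal_measureReal, probReal_compl_eq_one_sub hFU]
  exact ENNReal.ofReal_le_ofReal (by linarith)

/-- The non-covering part: if the partition functions at parameter `c ^ s` grow exponentially
then `X` is almost surely not covered. -/
lemma measure_cover_eq_zero [Fintype ι] [IsProbabilityMeasure μ]
    (h : CodedMeasure X μ s pt cl d C θ κ D)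
    {P : Measure (ℕ → ℝ)}
    (hP : ∀ (I : Finset ℕ) (f : ℕ → Set ℝ), (∀ n, MeasurableSet (f n)) →
      P {ω | ∀ n ∈ I, ω n ∈ f n} = ∏ n ∈ I, μ (f n))
    {c : ℝ} (hc : 0 < c) {r : ℕ → ℝ} (hr : ∀ n : ℕ, r n = c * ((n + 1 : ℕ) : ℝ) ^ (-(1 / s)))
    {q A : ℝ} (hA0 : 0 < A)
    (hA : ∀ i, A ≤ rieszEnergy μ s (pt [i]) (d [i]))
    (hsum : ∑ i, Real.exp (-q * rieszEnergy μ s (pt [i]) (d [i])) = 1)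
    (hcq : c ^ s * (A + D) < q * A) :
    P {ω | X ⊆ coverSet r ω} = 0 := by
  classical
  have hs := h.s_pos
  have hC := zero_lt_one.trans_le h.one_le_C
  have hκ := h.κ_pos
  have hcs : 0 < c ^ s := by positivity
  have hD := h.D_nonneg
  have hAD : 0 < A + D := by linarith
  have hr0 : ∀ n, 0 < r n := fun n => by rw [hr]; positivity
  obtain ⟨q', hq'1, hq'2⟩ := exists_between ((lt_div_iff₀ hAD).2 hcq)
  have hq'0 : 0 < q' := hcs.trans hq'1
  rw [lt_div_iff₀ hAD] at hq'2
  have hqq : q' < q := by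
    by_contra! hle
    nlinarith [mul_nonneg hq'0.le hD, mul_le_mul_of_nonneg_right hle hA0.le]
  set a : ι → ℝ := fun i => rieszEnergy μ s (pt [i]) (d [i]) with ha
  set p : ι → ℝ := fun i => Real.exp (-q * a i) with hp
  have hp0 : ∀ i, 0 < p i := fun i => Real.exp_pos _
  have hratio : ∀ i, p i * Real.exp (q' * (a i + D)) ≤ Real.exp (q' * (A + D) - q * A) := by
    intro i
    rw [hp, ← Real.exp_add]
    refine Real.exp_le_exp.2 ?_
    have := mul_le_mul_of_nonneg_left (hA i) (sub_pos.2 hqq).le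
    simp only [ha]
    linarith
  set ρ := ∑ i, p i ^ 2 * Real.exp (q' * (a i + D)) with hρ
  have hρ1 : ρ < 1 := by
    calc ρ ≤ ∑ i, p i * Real.exp (q' * (A + D) - q * A) := by
          refine Finset.sum_le_sum fun i _ => ?_
          rw [sq, mul_assoc]
          exact mul_le_mul_of_nonneg_left (hratio i) (hp0 i).le
      _ = Real.exp (q' * (A + D) - q * A) := by rw [← Finset.sum_mul, hsum, one_mul]
      _ < 1 := Real.exp_lt_one_iff.2 (by linarith)
  have hρ0 : 0 ≤ ρ := Finset.sum_nonneg fun i _ => by positivity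
  have hp2 : ∑ i, p i ^ 2 < 1 := by
    refine lt_of_le_of_lt (Finset.sum_le_sum fun i _ => ?_) hρ1
    refine le_mul_of_one_le_right (sq_nonneg _) (Real.one_le_exp ?_)
    have := hA i
    refine mul_nonneg hq'0.le ?_
    simp only [ha]
    linarith
  set lam := min κ 1 / 2 with hlam
  have hlam0 : 0 < lam := by rw [hlam]; positivity
  have hlam1 : lam ≤ 1 := by have := min_le_right κ 1; rw [hlam]; linarith
  have hlamκ : 2 * lam ≤ κ := by have := min_le_left κ 1; rw [hlam]; linarith
  set G := Real.exp (q' * (D + lam ^ (-s) * C)) * ∑ i, p i * Real.exp (q' * a i) with hG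
  have hrlim : Tendsto r atTop (𝓝 0) := by
    have h1 : Tendsto (fun n : ℕ => ((n + 1 : ℕ) : ℝ)) atTop atTop :=
      tendsto_natCast_atTop_atTop.comp (tendsto_add_atTop_nat 1)
    have h2 := ((tendsto_rpow_neg_atTop (one_div_pos.2 hs)).comp h1).const_mul c
    rw [mul_zero] at h2
    exact h2.congr fun n => (hr n).symm
  have hrs : Tendsto (fun n => C * r n ^ s) atTop (𝓝 0) := by
    have h1 := ((Real.continuousAt_rpow_const 0 s (Or.inr hs.le)).tendsto.comp hrlim).const_mul C
    rw [Real.zero_rpow hs.ne', mul_zero] at h1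
    exact h1
  obtain ⟨η, hη0, hη1, hηq⟩ : ∃ η : ℝ, 0 < η ∧ η < 1 ∧ ((1 - η) ^ 2)⁻¹ * c ^ s ≤ q' := by
    have hcont : ContinuousAt (fun η : ℝ => ((1 - η) ^ 2)⁻¹ * c ^ s) 0 :=
      ContinuousAt.mul (ContinuousAt.inv₀ (by fun_prop) (by norm_num)) continuousAt_const
    have h1 : ∀ᶠ η : ℝ in 𝓝[>] 0, ((1 - η) ^ 2)⁻¹ * c ^ s < q' :=
      (hcont.eventually (gt_mem_nhds (by simpa using hq'1))).filter_mono nhdsWithin_le_nhds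
    have h2 : ∀ᶠ η : ℝ in 𝓝[>] 0, η < 1 :=
      (gt_mem_nhds one_pos : ∀ᶠ η : ℝ in 𝓝 0, η < 1).filter_mono nhdsWithin_le_nhds
    obtain ⟨η, ⟨h3, h4⟩, h5⟩ := ((h1.and h2).and self_mem_nhdsWithin).exists
    exact ⟨η, h5, h4, h3.le⟩
  have hε : ∀ ε : ℝ, 0 < ε → P {ω | X ⊆ coverSet r ω} ≤ ENNReal.ofReal ε := by
    intro ε hε
    obtain ⟨J, hJ⟩ : ∃ J : ℕ, ρ ^ J / (1 - ρ) * G ≤ ε / 2 := by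
      have h1 := ((tendsto_pow_atTop_nhds_zero_of_lt_one hρ0 hρ1).div_const (1 - ρ)).mul_const G
      rw [zero_div, zero_mul] at h1
      obtain ⟨J, hJ⟩ := (h1.eventually (ge_mem_nhds (half_pos hε))).exists
      exact ⟨J, hJ⟩
    have hev1 : ∀ᶠ n in atTop, ∀ w ∈ {w : List ι | w.length ≤ J}, 2 * r n ≤ κ * d w := by
      refine (Filter.eventually_all_finite (List.finite_length_le ι J)).2 fun w _ => ?_
      have h1 := hrlim.const_mul 2
      rw [mul_zero] at h1
      have h2 : 0 < κ * d w := mul_pos hκ (h.d_pos w)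
      exact (h1.eventually (gt_mem_nhds h2)).mono fun n hn => hn.le
    have hev2 : ∀ᶠ n in atTop, C * r n ^ s ≤ η :=
      (hrs.eventually (gt_mem_nhds hη0)).mono fun n hn => hn.le
    obtain ⟨k, hk⟩ := eventually_atTop.1 (hev1.and hev2)
    have hV := h.measure_cover_Ico_le hP hc hr (fun i => (hp0 i).le) hsum hp2 hη1 hηq hlam0 hlam1
      hlamκ hρ hρ1 hG hε hJ (fun w hw n hn => (hk n hn).1 w hw) (fun n hn x hx =>
        ((measureReal_mono ball_subset_closedBall).trans (h.upper.real_le hx (hr0 n))).trans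
          (hk n hn).2)
    have hmono : Monotone fun N => {ω : ℕ → ℝ | X ⊆ ⋃ n ∈ Finset.Ico k N, ball (ω n) (r n)} := by
      intro N N' hN ω hω
      refine Subset.trans hω (biUnion_subset_biUnion_left fun n hn => ?_)
      exact Finset.Ico_subset_Ico_right hN hn
    have hsub : {ω : ℕ → ℝ | X ⊆ coverSet r ω} ⊆
        ⋃ N, {ω | X ⊆ ⋃ n ∈ Finset.Ico k N, ball (ω n) (r n)} := by
      intro ω hω
      have h1 : X ⊆ ⋃ n, ⋃ (_ : k ≤ n), ball (ω n) (r n) := Subset.trans hω (iInter_subset _ k)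
      have h2 : ∀ n, IsOpen (⋃ (_ : k ≤ n), ball (ω n) (r n)) :=
        fun n => isOpen_iUnion fun _ => isOpen_ball
      obtain ⟨t, ht⟩ := h.isCompact.elim_finite_subcover _ h2 h1
      refine mem_iUnion.2 ⟨t.sup id + 1, fun x hx => ?_⟩
      obtain ⟨n, hn⟩ := mem_iUnion.1 (ht hx)
      obtain ⟨hnt, hn⟩ := mem_iUnion.1 hn
      obtain ⟨hkn, hn⟩ := mem_iUnion.1 hn
      refine mem_iUnion.2 ⟨n, mem_iUnion.2 ⟨Finset.mem_Ico.2 ⟨hkn, ?_⟩, hn⟩⟩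
      exact Nat.lt_succ_of_le (Finset.le_sup (f := id) hnt)
    refine (measure_mono hsub).trans ?_
    rw [hmono.measure_iUnion]
    exact iSup_le hV
  refine le_antisymm (ENNReal.le_of_forall_pos_le_add fun ε hε' _ => ?_) zero_le
  rw [zero_add]
  have := hε ε (by exact_mod_cast hε')
  rwa [ENNReal.ofReal_coe_nnreal] at this

end CodedMeasure

/-- The critical constant compared with the energies of the first level cylinders. -/
lemma CodedMeasure.cover_dichotomy {ι : Type} {X : Set ℝ} {μ : Measure ℝ} {s : ℝ}
    {pt : List ι → ℝ} {cl : List ι → Set ℝ} {d : List ι → ℝ} {C θ κ D : ℝ} [Fintype ι]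
    [IsProbabilityMeasure μ] (hcard : 1 < Fintype.card ι)
    (h : CodedMeasure X μ s pt cl d C θ κ D) (hdim : dimH X = ENNReal.ofReal s)
    {P : Measure (ℕ → ℝ)}
    (hP : ∀ (I : Finset ℕ) (f : ℕ → Set ℝ), (∀ n, MeasurableSet (f n)) →
      P {ω | ∀ n ∈ I, ω n ∈ f n} = ∏ n ∈ I, μ (f n))
    {c : ℝ} (hc : 0 < c) {r : ℕ → ℝ} (hr : ∀ n : ℕ, r n = c * ((n + 1 : ℕ) : ℝ) ^ (-(1 / s)))
    {K : ℝ}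
    (hK : K = sSup {v : ℝ | ∃ α : ℝ, 0 < α ∧
      v = (dimH {x ∈ X | upperAvg μ s x = α ∧ lowerAvg μ s x = α}).toReal / (s * α)})
    {A : ℝ} (hDA : D < A) (hA : ∀ i, A ≤ rieszEnergy μ s (pt [i]) (d [i])) :
    0 < K ∧ (c ^ s * (A + D) < K * (A - D) → P {ω | X ⊆ coverSet r ω} = 0) ∧
      (K * (A + D) < c ^ s * (A - D) → P {ω | X ⊆ coverSet r ω} = 1) := by
  have hs := h.s_pos
  have hD := h.D_nonneg
  have hA0 : 0 < A := hD.trans_lt hDA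
  have hAD : 0 < A + D := by linarith
  have hAD' : 0 < A - D := by linarith
  obtain ⟨q, hq, hsum⟩ := exists_sum_exp_eq_one hcard fun i => hA0.trans_le (hA i)
  have hlim : ∀ q', q * A / (A - D) < q' → Tendsto (fun m => ∑ w : Fin m → ι, Real.exp
      (-q' * rieszEnergy μ s (pt (List.ofFn w)) (d (List.ofFn w)))) atTop (𝓝 0) := by
    intro q' hq'
    have hq'0 : 0 < q' := lt_trans (by positivity) hq'
    exact tendsto_sum_exp (a := fun w => rieszEnergy μ s (pt w) (d w)) h.additive hA0 hA hq'0 hsum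
      ((div_lt_iff₀ hAD').1 hq')
  set S := {v : ℝ | ∃ α : ℝ, 0 < α ∧
      v = (dimH {x ∈ X | upperAvg μ s x = α ∧ lowerAvg μ s x = α}).toReal / (s * α)} with hS
  have hup : ∀ v ∈ S, v ≤ q * A / (A - D) := by
    rintro v ⟨α, hα, rfl⟩
    refine le_of_forall_gt_imp_ge_of_dense fun q' hq' => ?_
    have hq'0 : 0 < q' := lt_trans (by positivity) hq'
    rw [div_le_iff₀ (by positivity)]
    exact ENNReal.toReal_le_of_le_ofReal (by positivity) (h.dimH_avg_le hq'0 hα (hlim q' hq'))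
  obtain ⟨α, hα, hαdim⟩ := h.exists_le_dimH_avg hq hDA hA hsum
  have hmem : (dimH {x ∈ X | upperAvg μ s x = α ∧ lowerAvg μ s x = α}).toReal / (s * α) ∈ S :=
    ⟨α, hα, rfl⟩
  have hle : q * A / (A + D) ≤
      (dimH {x ∈ X | upperAvg μ s x = α ∧ lowerAvg μ s x = α}).toReal / (s * α) := by
    rw [le_div_iff₀ (by positivity)]
    refine (ENNReal.ofReal_le_iff_le_toReal ?_).1 hαdim
    refine ne_top_of_le_ne_top (b := ENNReal.ofReal s) ENNReal.ofReal_ne_top ?_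
    exact hdim ▸ dimH_mono fun x hx => hx.1
  have hK1 : q * A / (A + D) ≤ K := hK ▸ hle.trans (le_csSup ⟨_, hup⟩ hmem)
  have hK2 : K ≤ q * A / (A - D) := hK ▸ csSup_le ⟨_, hmem⟩ hup
  refine ⟨lt_of_lt_of_le (by positivity) hK1, fun hlt => ?_, fun hlt => ?_⟩
  · exact h.measure_cover_eq_zero hP hc hr hA0 hA hsum
      (hlt.trans_le ((le_div_iff₀ hAD').1 hK2))
  · refine h.measure_cover_eq_one hP hc hr (hlim _ ?_)
    rw [div_lt_iff₀ hAD']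
    exact lt_of_le_of_lt ((div_le_iff₀ hAD).1 hK1) hlt

/-- Dvoretzky covering problem for the natural measure on a strongly separated self-conformal
set `X ⊆ ℝ` with radii `r_n = c n^{-1/s}`: the critical constant is
`(max_α f(α)/(sα))^{1/s}` where `f` is the multifractal spectrum of the average density. -/
theorem selfConformal_critical_constant
    {ι : Type} [Fintype ι] (g : ι → ℝ → ℝ) (hcard : 1 < Fintype.card ι)
    (hreg : ∀ i, ContDiff ℝ 1 (g i) ∧
      ∃ (ε K : ℝ≥0), 0 < ε ∧ HolderWith K ε (deriv (g i)))
    (hcontr : ∀ i, ∃ L : ℝ≥0, L < 1 ∧ LipschitzWith L (g i))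
    (hder : ∀ i x, deriv (g i) x ≠ 0)
    (X : Set ℝ) (hXc : IsCompact X) (hXne : X.Nonempty)
    (hXinv : X = ⋃ i, g i '' X)
    (hsep : Pairwise fun i j => Disjoint (g i '' X) (g j '' X))
    (s : ℝ) (hs : dimH X = ENNReal.ofReal s) (hspos : 0 < s)
    (μ : Measure ℝ) (hμ : μ = (μH[s] X)⁻¹ • (μH[s]).restrict X)
    (P : Measure (ℕ → ℝ))
    (hP : ∀ (I : Finset ℕ) (f : ℕ → Set ℝ), (∀ n, MeasurableSet (f n)) →
      P {ω | ∀ n ∈ I, ω n ∈ f n} = ∏ n ∈ I, μ (f n))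
    (c : ℝ) (hc : 0 < c)
    (r : ℕ → ℝ) (hr : ∀ n : ℕ, r n = c * ((n + 1 : ℕ) : ℝ) ^ (-(1 / s)))
    (K : ℝ)
    (hK : K = sSup {v : ℝ | ∃ α : ℝ, 0 < α ∧
      v = (dimH {x ∈ X | upperAvg μ s x = α ∧ lowerAvg μ s x = α}).toReal / (s * α)}) :
    (c < K ^ (1 / s) → P {ω | X ⊆ coverSet r ω} = 0) ∧
    (K ^ (1 / s) < c → P {ω | X ⊆ coverSet r ω} = 1) := by
  have hι : Nonempty ι := Fintype.card_pos_iff.1 (by omega)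
  have hP1 : P univ = 1 := by simpa using hP ∅ (fun _ => ∅) (fun _ => MeasurableSet.empty)
  have hμ1 : μ univ = 1 := by
    have := hP {0} (fun _ => univ) (fun _ => MeasurableSet.univ)
    simpa [hP1] using this.symm
  have hμprob : IsProbabilityMeasure μ := ⟨hμ1⟩
  have htop : (μH[s] X)⁻¹ ≠ ⊤ := by
    intro hcon
    rw [ENNReal.inv_eq_top] at hcon
    rw [hμ] at hμ1
    simp [hcon] at hμ1
  have hμk : μ = ((μH[s] X)⁻¹).toNNReal • (μH[s]).restrict X := by
    rw [hμ]
    ext S _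
    rw [Measure.smul_apply, Measure.smul_apply, ENNReal.smul_def, ENNReal.coe_toNNReal htop]
  obtain ⟨x0, hx0⟩ := hXne
  obtain ⟨J, R, θ, ε, Cg, δ, hIFS⟩ :=
    exists_conformalIFS g hreg hcontr hder X hXc ⟨x0, hx0⟩ hXinv hsep
  obtain ⟨C, κ, D, hcode⟩ := hIFS.exists_codedMeasure hspos hμk hx0
  have hmain : ∀ A, D < A → 0 < K ∧
      (c ^ s * (A + D) < K * (A - D) → P {ω | X ⊆ coverSet r ω} = 0) ∧
      (K * (A + D) < c ^ s * (A - D) → P {ω | X ⊆ coverSet r ω} = 1) := by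
    intro A hDA
    obtain ⟨n, hn, hA⟩ := hIFS.exists_length_le_energy hspos hμk hx0 A
    have hcard' : 1 < Fintype.card (Fin n → ι) := by
      rw [Fintype.card_fun, Fintype.card_fin]
      exact Nat.one_lt_pow (by omega) hcard
    refine (hcode.iterate hn).cover_dichotomy hcard' hs hP hc hr hK hDA fun u => ?_
    exact hA _ (by simp)
  have hK0 : 0 < K := (hmain (D + 1) (by linarith)).1
  have hpow : (K ^ (1 / s)) ^ s = K := by
    rw [← Real.rpow_mul hK0.le, one_div_mul_cancel hspos.ne', Real.rpow_one]
  have hscale : ∀ {x y : ℝ}, 0 < x → x < y → ∃ A, D < A ∧ x * (A + D) < y * (A - D) := by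
    intro x y hx hxy
    have hD := hcode.D_nonneg
    have hyx : 0 < y - x := sub_pos.2 hxy
    refine ⟨((x + y) * D + 1) / (y - x) + D, ?_, ?_⟩
    · have : 0 < ((x + y) * D + 1) / (y - x) := by
        have : 0 ≤ (x + y) * D := mul_nonneg (by linarith) hD
        positivity
      linarith
    · have h1 : ((x + y) * D + 1) / (y - x) * (y - x) = (x + y) * D + 1 :=
        div_mul_cancel₀ _ hyx.ne'
      have h2 : 0 ≤ (y - x) * D := mul_nonneg hyx.le hD
      linarith
  constructor
  · intro hlt
    have h1 : c ^ s < K := hpow ▸ Real.rpow_lt_rpow hc.le hlt hspos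
    obtain ⟨A, hA, hA'⟩ := hscale (by positivity) h1
    exact (hmain A hA).2.1 hA'
  · intro hlt
    have h1 : K < c ^ s := by
      have := Real.rpow_lt_rpow (by positivity) hlt hspos
      rwa [hpow] at this
    obtain ⟨A, hA, hA'⟩ := hscale hK0 h1
    exact (hmain A hA).2.2 hA'

end
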